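/- The only pairs (x, y) of rational numbers satisfying y^2 = x^6 - 4x^4 + 10x^3 - 4x^2 + 1 are (0, 1), (0, -1), (1, 2), (1, -2), (-3, 10), (-3, -10), (-1/3, 10/27), and (-1/3, -10/27). -/

import Mathlib

namespace X166
open WeierstrassCurve Height

/-- The curve `y² = x³ + a x² + b x`. -/
abbrev curve {K : Type*} [Field K] (a b : K) : WeierstrassCurve.Affine K := ⟨0, a, 0, b, 0⟩

section
variable {K : Type*} [Field K] [DecidableEq K] {a b : K}

lemma curve_equation {x y : K} : (curve a b).Equation x y ↔ y ^ 2 = x ^ 3 + a * x ^ 2 + b * x := by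
  rw [Affine.equation_iff]; simp [curve]

lemma add_of_ne {x₁ y₁ x₂ y₂ : K} (h₁ : (curve a b).Nonsingular x₁ y₁)
    (h₂ : (curve a b).Nonsingular x₂ y₂) (hx : x₁ ≠ x₂) :
    ∃ x₃ y₃, ∃ h₃ : (curve a b).Nonsingular x₃ y₃, Affine.Point.some x₁ y₁ h₁ + .some x₂ y₂ h₂ =
      .some x₃ y₃ h₃ ∧ x₃ = ((y₁ - y₂) / (x₁ - x₂)) ^ 2 - a - x₁ - x₂ ∧
      y₃ = -((y₁ - y₂) / (x₁ - x₂) * (x₃ - x₁) + y₁) := by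
  refine ⟨_, _, _, Affine.Point.add_some (fun h => hx h.1), ?_, ?_⟩
  · simp [Affine.slope_of_X_ne hx, Affine.addX, curve]
  · simp [Affine.slope_of_X_ne hx, Affine.addY, Affine.negAddY, Affine.negY, curve]

lemma two_nsmul_of_ne {x y : K} (h2 : (2 : K) ≠ 0) (h : (curve a b).Nonsingular x y) (hy : y ≠ 0) :
    ∃ x₃ y₃, ∃ h₃ : (curve a b).Nonsingular x₃ y₃, 2 • Affine.Point.some x y h =
      .some x₃ y₃ h₃ ∧ x₃ = ((3 * x ^ 2 + 2 * a * x + b) / (2 * y)) ^ 2 - a - 2 * x ∧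
      y₃ = -((3 * x ^ 2 + 2 * a * x + b) / (2 * y) * (x₃ - x) + y) := by
  have hne : y ≠ (curve a b).negY x y := by
    simp only [Affine.negY, curve]
    intro h
    apply hy
    have : (2 : K) * y = 0 := by linear_combination h
    simpa [h2] using this
  have hs : (curve a b).slope x x y y = (3 * x ^ 2 + 2 * a * x + b) / (2 * y) := by
    rw [Affine.slope_of_Y_ne rfl hne]
    simp [curve, Affine.negY]; ring
  rw [two_nsmul]
  refine ⟨_, _, _, Affine.Point.add_some (fun h => hne h.2), ?_, ?_⟩
  · simp [hs, Affine.addX, curve]; ring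
  · simp [hs, Affine.addY, Affine.negAddY, Affine.negY, curve]

lemma neg_some' {x y : K} (h : (curve a b).Nonsingular x y) :
    ∃ h', -(Affine.Point.some x y h) = .some x (-y) h' := by
  have : (curve a b).negY x y = -y := by simp [Affine.negY, curve]
  have h' := (Affine.nonsingular_neg (W' := curve a b) x y).mpr h
  rw [this] at h'
  refine ⟨h', ?_⟩
  rw [Affine.Point.neg_some]
  simp [this]

lemma addSubMap_curve (s t u : K) : (fun i => (addSubMap (curve a b) i).eval ![s, t, u]) =
    ![s ^ 2 - 2 * b * s * u + b ^ 2 * u ^ 2, 2 * t * s + 4 * a * s * u + 2 * b * t * u,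
      t ^ 2 - 4 * s * u] := by
  funext i
  fin_cases i <;> simp [addSubMap, curve, b₂, b₄, b₆, b₈] <;> ring

variable [(curve a b).IsElliptic]

lemma addSubMap_self (h2 : (2 : K) ≠ 0) (P : (curve a b).Point) :
    ∃ c : K, c ≠ 0 ∧ (fun i => (addSubMap (curve a b) i).eval (P.sym2x P)) =
      c • (P + P).sym2x (P - P) := by
  have hne := addSubMap_ne_zero (curve a b) (Affine.Point.sym2x_ne_zero P P)
  rcases P with _ | ⟨x, y, h⟩
  · refine ⟨1, one_ne_zero, ?_⟩
    rw [← Affine.Point.zero_def]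
    simp only [add_zero, sub_zero, Affine.Point.sym2x_zero_zero, addSubMap_curve]
    simp
  · rw [Affine.Point.sym2x_some_some, addSubMap_curve] at hne ⊢
    have heq := curve_equation.mp h.1
    rw [sub_self]
    by_cases hy : y = 0
    · have : Affine.Point.some x y h + .some x y h = 0 := by
        rw [add_eq_zero_iff_eq_neg]
        obtain ⟨h', e⟩ := neg_some' h
        rw [e]; simp [hy]
      rw [this, Affine.Point.sym2x_zero_zero]
      have e : (![(x * x) ^ 2 - 2 * b * (x * x) * 1 + b ^ 2 * 1 ^ 2,
        2 * (x + x) * (x * x) + 4 * a * (x * x) * 1 + 2 * b * (x + x) * 1,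
        (x + x) ^ 2 - 4 * (x * x) * 1] : Fin 3 → K) = (x ^ 2 - b) ^ 2 • ![1, 0, 0] := by
        subst hy
        ext i; fin_cases i <;> simp <;> first | linear_combination (-4) * heq | ring
      rw [e] at hne ⊢
      refine ⟨_, ?_, rfl⟩
      intro h0; simp [h0] at hne
    · obtain ⟨x₃, y₃, h₃, e, ex, -⟩ := two_nsmul_of_ne h2 h hy
      rw [two_nsmul] at e
      rw [e, Affine.Point.sym2x_some_zero]
      refine ⟨4 * y ^ 2, by simp [hy]; exact fun h => h2 (by
        have : (2 : K) * 2 = 0 := by linear_combination h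
        simpa using this), ?_⟩
      have ex' : 4 * y ^ 2 * x₃ = (3 * x ^ 2 + 2 * a * x + b) ^ 2 - 4 * y ^ 2 * (a + 2 * x) := by
        rw [ex]; field_simp; ring
      ext i; fin_cases i <;> simp
      · rw [ex', heq]; ring
      · rw [heq]; ring
      · ring

lemma addSubMap_eq (h2 : (2 : K) ≠ 0) (P Q : (curve a b).Point) :
    ∃ c : K, c ≠ 0 ∧ (fun i => (addSubMap (curve a b) i).eval (P.sym2x Q)) =
      c • (P + Q).sym2x (P - Q) := by
  rcases eq_or_ne P Q with rfl | hPQ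
  · exact addSubMap_self h2 P
  rcases eq_or_ne P (-Q) with rfl | hPQ'
  · obtain ⟨c, hc, e⟩ := addSubMap_self h2 Q
    refine ⟨c, hc, ?_⟩
    rw [Affine.Point.sym2x_neg_left, e, Affine.Point.sym2x_comm (-Q + Q), ← Affine.Point.sym2x_neg_left (-Q - Q)]
    congr 2 <;> abel
  rcases P with _ | ⟨x₁, y₁, h₁⟩
  · rw [← Affine.Point.zero_def] at *
    refine ⟨1, one_ne_zero, ?_⟩
    rcases Q with _ | ⟨x₂, y₂, h₂⟩
    · exact absurd rfl hPQ
    · rw [zero_add, zero_sub, Affine.Point.sym2x_neg_right, Affine.Point.sym2x_zero_some,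
        Affine.Point.sym2x_some_some, addSubMap_curve]
      ext i; fin_cases i <;> simp <;> ring
  rcases Q with _ | ⟨x₂, y₂, h₂⟩
  · rw [← Affine.Point.zero_def] at *
    refine ⟨1, one_ne_zero, ?_⟩
    rw [add_zero, sub_zero, Affine.Point.sym2x_some_zero,
        Affine.Point.sym2x_some_some, addSubMap_curve]
    ext i; fin_cases i <;> simp <;> ring
  have hx : x₁ ≠ x₂ := by
    rintro rfl
    rcases Affine.Point.eq_or_eq_neg_of_xRep_eq_xRep (P := .some x₁ y₁ h₁) (Q := .some x₁ y₂ h₂)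
      (by simp) with h | h
    · exact hPQ h
    · exact hPQ' h
  have hx' : x₁ - x₂ ≠ 0 := sub_ne_zero.mpr hx
  have e₁ := curve_equation.mp h₁.1
  have e₂ := curve_equation.mp h₂.1
  obtain ⟨h₂', hn⟩ := neg_some' h₂
  obtain ⟨x₃, y₃, h₃, e3, ex3, -⟩ := add_of_ne h₁ h₂ hx
  obtain ⟨x₄, y₄, h₄, e4, ex4, -⟩ := add_of_ne h₁ h₂' hx
  rw [sub_eq_add_neg, hn, e3, e4, Affine.Point.sym2x_some_some, Affine.Point.sym2x_some_some,
    addSubMap_curve]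
  refine ⟨(x₁ - x₂) ^ 2, pow_ne_zero 2 hx', ?_⟩
  have hx3 : (x₁ - x₂) ^ 2 * x₃ = (y₁ - y₂) ^ 2 - (a + x₁ + x₂) * (x₁ - x₂) ^ 2 := by
    rw [ex3]; field_simp; ring
  have hx4 : (x₁ - x₂) ^ 2 * x₄ = (y₁ + y₂) ^ 2 - (a + x₁ + x₂) * (x₁ - x₂) ^ 2 := by
    rw [ex4]; field_simp; ring
  ext i; fin_cases i <;> simp
  · apply mul_left_cancel₀ (pow_ne_zero 2 hx')
    have : (x₁ - x₂) ^ 2 * ((x₁ - x₂) ^ 2 * (x₃ * x₄)) =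
      ((y₁ - y₂) ^ 2 - (a + x₁ + x₂) * (x₁ - x₂) ^ 2) *
      ((y₁ + y₂) ^ 2 - (a + x₁ + x₂) * (x₁ - x₂) ^ 2) := by rw [← hx3, ← hx4]; ring
    rw [this]
    have e5 : ((y₁ - y₂) ^ 2 - (a + x₁ + x₂) * (x₁ - x₂) ^ 2) *
      ((y₁ + y₂) ^ 2 - (a + x₁ + x₂) * (x₁ - x₂) ^ 2) = (y₁ ^ 2 - y₂ ^ 2) ^ 2
      - 2 * (y₁ ^ 2 + y₂ ^ 2) * (a + x₁ + x₂) * (x₁ - x₂) ^ 2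
       + (a + x₁ + x₂) ^ 2 * (x₁ - x₂) ^ 4 := by ring
    rw [e5, e₁, e₂]; ring
  · rw [mul_add ((x₁ - x₂) ^ 2), hx3, hx4]
    linear_combination (-2) * e₁ - 2 * e₂
  · ring

end

section
variable {K : Type*} [Field K] [NumberField K] [DecidableEq K] {a b : K} [(curve a b).IsElliptic]

noncomputable def ht (P : (curve a b).Point) : ℝ := logHeight P.xRep

instance : Northcott (ht (a := a) (b := b)) where
  finite_le B := by
    have hf := _root_.NumberField.finite_setOfPred_logHeight₁_le (K := K) B
    have : {P : (curve a b).Point | ht P ≤ B} ⊆ {0} ∪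
        (⋃ x ∈ {x : K | logHeight₁ x ≤ B}, {P : (curve a b).Point | P.xRep = ![x, 1]}) := by
      intro P hP
      rcases P with _ | ⟨x, y, h⟩
      · left; rfl
      · right
        simp only [Set.mem_iUnion, Set.mem_ofPred_eq]
        refine ⟨x, ?_, by simp⟩
        rw [logHeight₁_eq_logHeight]
        simpa [ht] using hP
    refine Set.Finite.subset (Set.Finite.union (Set.finite_singleton 0) (Set.Finite.biUnion hf ?_)) this
    intro x _
    by_cases hne : ∃ P : (curve a b).Point, P.xRep = ![x, 1]
    · obtain ⟨P, hP⟩ := hne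
      refine Set.Finite.subset (Set.toFinite {P, -P}) ?_
      intro Q hQ
      have := Affine.Point.eq_or_eq_neg_of_xRep_eq_xRep (P := Q) (Q := P) (by rw [hP]; exact hQ)
      simpa using this
    · convert Set.finite_empty
      ext P
      simp only [Set.mem_ofPred_eq, Set.mem_empty_iff_false, iff_false]
      exact fun h => hne ⟨P, h⟩

lemma ht_parallelogram : ∃ C, ∀ P Q : (curve a b).Point,
    |ht (P + Q) + ht (P - Q) - 2 * (ht P + ht Q)| ≤ C := by
  obtain ⟨C₁, h₁⟩ := abs_logHeight_addSubMap_sub_two_mul_logHeight_le (curve a b)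
  obtain ⟨C₂, h₂⟩ := abs_logHeight_sym2_sub_le K
  have key : ∀ P Q : (curve a b).Point, |logHeight (P.sym2x Q) - (ht P + ht Q)| ≤ C₂ := by
    intro P Q
    have e : ∀ v : Fin 2 → K, v = ![v 0, v 1] := by
      intro v; ext i; fin_cases i <;> rfl
    have := h₂ (a := P.xRep 0) (b := P.xRep 1) (c := Q.xRep 0) (d := Q.xRep 1)
      (by rw [← e]; exact P.xRep_ne_zero) (by rw [← e]; exact Q.xRep_ne_zero)
    rw [← e, ← e] at this
    exact this
  refine ⟨C₁ + 3 * C₂, fun P Q => ?_⟩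
  obtain ⟨c, hc, e⟩ := addSubMap_eq two_ne_zero P Q
  have a₁ := h₁ (P.sym2x Q)
  rw [e, logHeight_smul_eq_logHeight _ hc] at a₁
  have a₂ := key P Q
  have a₃ := key (P + Q) (P - Q)
  rw [abs_le] at *
  constructor <;> linarith

lemma point_fg (s : Finset (curve a b).Point)
    (hs : ∀ P : (curve a b).Point, ∃ Q ∈ s, ∃ R, P = Q + 2 • R) :
    AddGroup.FG (curve a b).Point := by
  obtain ⟨C, hC⟩ := ht_parallelogram (a := a) (b := b)
  refine AddCommGroup.fg_of_descent' (h := ht) ?_ (fun P => logHeight_nonneg _) hC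
  have : Finite ((curve a b).Point ⧸ (nsmulAddMonoidHom (α := (curve a b).Point) 2).range) := by
    refine Finite.of_surjective (fun Q : s => QuotientAddGroup.mk Q.1) ?_
    intro q
    obtain ⟨P, rfl⟩ := QuotientAddGroup.mk_surjective q
    obtain ⟨Q, hQ, R, rfl⟩ := hs P
    refine ⟨⟨Q, hQ⟩, ?_⟩
    rw [QuotientAddGroup.eq]
    exact ⟨R, by simp⟩
  exact AddSubgroup.finiteIndex_of_finite_quotient

end

end X166

namespace X166

section
variable {K : Type*} [Field K] {v : AbsoluteValue K ℝ} (hv : IsNonarchimedean v)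
include hv

lemma na_add {x y : K} {r : ℝ} (hx : v x ≤ r) (hy : v y ≤ r) : v (x + y) ≤ r :=
  (hv x y).trans (max_le hx hy)

lemma na_sub {x y : K} {r : ℝ} (hx : v x ≤ r) (hy : v y ≤ r) : v (x - y) ≤ r := by
  rw [sub_eq_add_neg]; exact na_add hv hx (by rwa [v.map_neg])

lemma na_add_lt {x y : K} {r : ℝ} (hx : v x < r) (hy : v y < r) : v (x + y) < r :=
  (hv x y).trans_lt (max_lt hx hy)

lemma na_sub_lt {x y : K} {r : ℝ} (hx : v x < r) (hy : v y < r) : v (x - y) < r := by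
  rw [sub_eq_add_neg]; exact na_add_lt hv hx (by rwa [v.map_neg])

omit hv in
lemma v_mul_le {x y : K} {r s : ℝ} (hx : v x ≤ r) (hy : v y ≤ s) : v (x * y) ≤ r * s := by
  rw [map_mul]
  exact mul_le_mul hx hy (v.nonneg _) ((v.nonneg _).trans hx)

/-- `x` and `y` have the same leading term. -/
def Near (v : AbsoluteValue K ℝ) (x y : K) : Prop := v (x - y) < v y

omit hv in
lemma Near.ne_right {x y : K} (h : Near v x y) : y ≠ 0 := by
  rw [← v.pos_iff]; exact (v.nonneg _).trans_lt h

lemma Near.eq {x y : K} (h : Near v x y) : v x = v y := by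
  apply le_antisymm
  · rw [← sub_add_cancel x y]; exact na_add hv h.le le_rfl
  · by_contra! h2
    have : v (x - (x - y)) < v y := na_sub_lt hv h2 h
    simp at this

lemma Near.ne_left {x y : K} (h : Near v x y) : x ≠ 0 := by
  rw [← v.pos_iff, h.eq hv, v.pos_iff]; exact h.ne_right

omit hv in
lemma Near.rfl {x : K} (h : x ≠ 0) : Near v x x := by
  rw [Near, sub_self, map_zero]; exact v.pos h

lemma Near.symm {x y : K} (h : Near v x y) : Near v y x := by
  rw [Near, v.map_sub, h.eq hv]; exact h

lemma Near.trans {x y z : K} (h : Near v x y) (h' : Near v y z) : Near v x z := by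
  have e := h'.eq hv
  rw [Near] at *
  rw [← sub_add_sub_cancel x y z]
  exact na_add_lt hv (e ▸ h) h'

lemma Near.mul {x y z t : K} (h : Near v x y) (h' : Near v z t) : Near v (x * z) (y * t) := by
  have e := h.eq hv
  have hx := v.pos (h.ne_left hv)
  have ht := v.pos h'.ne_right
  rw [Near] at *
  rw [show x * z - y * t = x * (z - t) + (x - y) * t by ring]
  apply na_add_lt hv <;> rw [map_mul, map_mul]
  · rw [← e]; exact mul_lt_mul_of_pos_left h' hx
  · exact mul_lt_mul_of_pos_right h ht

lemma Near.inv {x y : K} (h : Near v x y) : Near v x⁻¹ y⁻¹ := by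
  have hx := h.ne_left hv
  have hy := h.ne_right
  have e := h.eq hv
  rw [Near, v.map_sub] at *
  rw [inv_sub_inv hy hx, map_div₀, map_mul, map_inv₀, e, div_lt_iff₀ (by simp [hy]), v.map_sub]
  have := v.pos hy
  field_simp
  exact h

lemma Near.div {x y z t : K} (h : Near v x y) (h' : Near v z t) : Near v (x / z) (y / t) := by
  rw [div_eq_mul_inv, div_eq_mul_inv]; exact h.mul hv (h'.inv hv)

lemma Near.sq {x y : K} (h : Near v x y) : Near v (x ^ 2) (y ^ 2) := by
  rw [pow_two, pow_two]; exact h.mul hv h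

omit hv in
lemma Near.neg {x y : K} (h : Near v x y) : Near v (-x) (-y) := by
  rw [Near, v.map_neg, neg_sub_neg, v.map_sub]; exact h

variable {a b : K} (ha : v a ≤ 1) (hb : v b ≤ 1)
include ha hb

lemma near_sq_cube {x y : K} (h : y ^ 2 = x ^ 3 + a * x ^ 2 + b * x) (hx : 1 < v x) :
    Near v (y ^ 2) (x ^ 3) := by
  have h0 : 0 < v x := zero_lt_one.trans hx
  rw [Near, show y ^ 2 - x ^ 3 = a * x ^ 2 + b * x by rw [h]; ring]
  apply na_add_lt hv
  · rw [map_mul, map_pow, map_pow]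
    calc v a * v x ^ 2 ≤ 1 * v x ^ 2 := by gcongr
      _ < v x ^ 3 := by rw [one_mul]; exact pow_lt_pow_right₀ hx (by norm_num)
  · rw [map_mul, map_pow]
    calc v b * v x ≤ 1 * v x := by gcongr
      _ < v x ^ 3 := by nlinarith [sq_nonneg (v x - 1), mul_pos h0 h0]

lemma big_point {x y : K} (h : y ^ 2 = x ^ 3 + a * x ^ 2 + b * x) (hx : 1 < v x) :
    y ≠ 0 ∧ x / y ≠ 0 ∧ v (x / y) < 1 ∧ v (1 / y) = v (x / y) ^ 3 ∧ v (x / y) ^ 2 = 1 / v x := by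
  have h0 : 0 < v x := zero_lt_one.trans hx
  have hx0 : x ≠ 0 := v.pos_iff.mp h0
  have hn := near_sq_cube hv ha hb h hx
  have e := hn.eq hv
  have hy0 : y ≠ 0 := by
    rintro rfl; simp at e; exact hx0 (by simpa using e.symm)
  have hy := v.pos hy0
  rw [map_pow, map_pow] at e
  have e2 : v (x / y) ^ 2 = 1 / v x := by
    rw [map_div₀, div_pow, e]; field_simp
  have e3 : v (x / y) < 1 := by
    have : v (x / y) ^ 2 < 1 := by rw [e2, div_lt_one h0]; exact hx
    nlinarith [v.nonneg (x / y)]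
  refine ⟨hy0, div_ne_zero hx0 hy0, e3, ?_, e2⟩
  rw [map_div₀, map_div₀, map_one, div_pow]
  field_simp
  exact e

lemma big_of_small {x y : K} (h : y ^ 2 = x ^ 3 + a * x ^ 2 + b * x) (hy0 : y ≠ 0)
    (hy : v (1 / y) < 1) : 1 < v x := by
  by_contra! hx
  have h1 : 1 < v y := by
    rw [map_div₀, map_one, div_lt_one (v.pos hy0)] at hy; exact hy
  have : v (y ^ 2) ≤ 1 := by
    have h2 : v (x ^ 2) ≤ 1 := by rw [map_pow]; exact pow_le_one₀ (v.nonneg _) hx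
    rw [h]
    apply na_add hv (na_add hv ?_ ?_) ?_
    · rw [map_pow]; exact pow_le_one₀ (v.nonneg _) hx
    · simpa using v_mul_le ha h2
    · simpa using v_mul_le hb hx
  rw [map_pow] at this
  nlinarith

lemma unit_of_small {Z₂ W₁ W₂ : K} {M : ℝ} (M1 : M < 1) (m2 : v Z₂ ≤ M) (n1 : v W₁ ≤ M)
    (n2 : v W₂ ≤ M) : v (1 - a * Z₂ ^ 2 - b * Z₂ * (W₁ + W₂)) = 1 := by
  have M0 : 0 ≤ M := (v.nonneg _).trans m2
  have hU : v (a * Z₂ ^ 2 + b * Z₂ * (W₁ + W₂)) ≤ M := by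
    have q1 : v (Z₂ ^ 2) ≤ M ^ 2 := by rw [map_pow]; gcongr
    have q2 : v (W₁ + W₂) ≤ 1 := na_add hv (n1.trans M1.le) (n2.trans M1.le)
    apply na_add hv
    · have := v_mul_le ha q1; nlinarith
    · have := v_mul_le (v_mul_le hb m2) q2; linarith
  have : Near v (1 - a * Z₂ ^ 2 - b * Z₂ * (W₁ + W₂)) 1 := by
    rw [Near, map_one, show 1 - a * Z₂ ^ 2 - b * Z₂ * (W₁ + W₂) - 1 =
      -(a * Z₂ ^ 2 + b * Z₂ * (W₁ + W₂)) by ring, v.map_neg]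
    exact hU.trans_lt M1
  rw [this.eq hv, map_one]

lemma formal_add {x₁ y₁ x₂ y₂ x₃ y₃ l c : K} (h₁ : y₁ ^ 2 = x₁ ^ 3 + a * x₁ ^ 2 + b * x₁)
    (h₂ : y₂ ^ 2 = x₂ ^ 3 + a * x₂ ^ 2 + b * x₂) (h₃ : y₃ ^ 2 = x₃ ^ 3 + a * x₃ ^ 2 + b * x₃)
    (b₁ : 1 < v x₁) (b₂ : 1 < v x₂) (e₁ : y₁ = l * x₁ + c) (e₂ : y₂ = l * x₂ + c)
    (e₃ : y₃ = -(l * x₃ + c)) (s₁ : x₃ = l ^ 2 - a - x₁ - x₂)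
    (s₂ : x₁ * x₂ + x₁ * x₃ + x₂ * x₃ = b - 2 * l * c) (s₃ : x₁ * x₂ * x₃ = c ^ 2)
    (hl : l * (1 - a * (x₂ / y₂) ^ 2 - b * (x₂ / y₂) * (1 / y₁ + 1 / y₂)) =
      -c * ((x₁ / y₁) ^ 2 + (x₁ / y₁) * (x₂ / y₂) + (x₂ / y₂) ^ 2 +
        a * (x₁ / y₁ + x₂ / y₂) * (1 / y₁) + b * (1 / y₁) ^ 2)) :
    1 < v x₃ ∧ v (x₃ / y₃ - x₁ / y₁ - x₂ / y₂) ≤ max (v (x₁ / y₁)) (v (x₂ / y₂)) ^ 3 := by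
  obtain ⟨y10, z10, z1, w1, -⟩ := big_point hv ha hb h₁ b₁
  obtain ⟨y20, z20, z2, w2, -⟩ := big_point hv ha hb h₂ b₂
  obtain ⟨M, hM⟩ : ∃ M, max (v (x₁ / y₁)) (v (x₂ / y₂)) = M := ⟨_, rfl⟩
  have m1 : v (x₁ / y₁) ≤ M := hM ▸ le_max_left _ _
  have m2 : v (x₂ / y₂) ≤ M := hM ▸ le_max_right _ _
  have M0 : 0 < M := (v.pos z10).trans_le m1
  have M1 : M < 1 := hM ▸ max_lt z1 z2
  have n1 : v (1 / y₁) ≤ M ^ 3 := by rw [w1]; gcongr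
  have n2 : v (1 / y₂) ≤ M ^ 3 := by rw [w2]; gcongr
  have M3 : M ^ 3 ≤ M ^ 2 := pow_le_pow_of_le_one M0.le M1.le (by norm_num)
  have M21 : M ^ 2 ≤ M := by simpa using pow_le_pow_of_le_one M0.le M1.le (show 1 ≤ 2 by norm_num)
  have M31 : M ^ 3 ≤ M := M3.trans M21
  rw [hM]
  have ez1 : l * (x₁ / y₁) + c * (1 / y₁) = 1 := by field_simp; exact e₁.symm
  generalize hz1 : x₁ / y₁ = Z₁ at *
  generalize hz2 : x₂ / y₂ = Z₂ at *
  generalize hw1 : 1 / y₁ = W₁ at *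
  generalize hw2 : 1 / y₂ = W₂ at *
  have hU1 : v (1 - a * Z₂ ^ 2 - b * Z₂ * (W₁ + W₂)) = 1 :=
    unit_of_small hv ha hb M1 m2 (n1.trans M31) (n2.trans M31)
  have U0 : 1 - a * Z₂ ^ 2 - b * Z₂ * (W₁ + W₂) ≠ 0 := by
    rw [← v.pos_iff, hU1]; exact one_pos
  obtain ⟨lam, hlam⟩ : ∃ lam, (1 - a * Z₂ ^ 2 - b * Z₂ * (W₁ + W₂)) * lam =
      Z₁ ^ 2 + Z₁ * Z₂ + Z₂ ^ 2 + a * (Z₁ + Z₂) * W₁ + b * W₁ ^ 2 :=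
    ⟨_, mul_div_cancel₀ _ U0⟩
  have hl : l = -c * lam := by
    apply mul_right_cancel₀ U0
    rw [hl, ← hlam]; ring
  have hlam2 : v lam ≤ M ^ 2 := by
    have e := congrArg v hlam
    rw [map_mul, hU1, one_mul] at e
    rw [e]
    apply na_add hv (na_add hv (na_add hv (na_add hv ?_ ?_) ?_) ?_) ?_
    · rw [map_pow]; gcongr
    · rw [pow_two]; exact v_mul_le m1 m2
    · rw [map_pow]; gcongr
    · have := v_mul_le (v_mul_le ha (na_add hv m1 m2)) n1
      nlinarith [mul_pos M0 M0, M31, M3]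
    · have q : v (W₁ ^ 2) ≤ (M ^ 3) ^ 2 := by rw [map_pow]; gcongr
      have := v_mul_le hb q
      have : (M ^ 3) ^ 2 ≤ M ^ 2 := by gcongr
      linarith
  obtain ⟨nu, hnu⟩ : ∃ nu, nu = W₁ - lam * Z₁ := ⟨_, rfl⟩
  have hcn : c * nu = 1 := by rw [hnu, ← ez1, hl]; ring
  have hln : l = -(lam * c) := by rw [hl]; ring
  have c0 : c ≠ 0 := left_ne_zero_of_mul (hcn ▸ one_ne_zero)
  have hnu3 : v nu ≤ M ^ 3 := by
    rw [hnu]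
    apply na_sub hv n1
    have := v_mul_le hlam2 m1
    rw [pow_succ]; exact this
  have hD : v (a * lam + b * lam ^ 2) ≤ M := by
    have q1 : v (lam ^ 2) ≤ (M ^ 2) ^ 2 := by rw [map_pow]; gcongr
    apply na_add hv
    · have := v_mul_le ha hlam2; linarith
    · have := v_mul_le hb q1
      have : (M ^ 2) ^ 2 ≤ M ^ 2 := by
        rw [← pow_mul]; exact pow_le_pow_of_le_one M0.le M1.le (by norm_num)
      linarith
  have hD1 : v (1 + a * lam + b * lam ^ 2) = 1 := by
    have : Near v (1 + a * lam + b * lam ^ 2) 1 := by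
      rw [Near, map_one, show 1 + a * lam + b * lam ^ 2 - 1 = a * lam + b * lam ^ 2 by ring]
      exact hD.trans_lt M1
    rw [this.eq hv, map_one]
  have D0 : 1 + a * lam + b * lam ^ 2 ≠ 0 := by
    rw [← v.pos_iff, hD1]; exact one_pos
  have prod : y₁ * y₂ * -y₃ = c ^ 3 * (1 + a * lam + b * lam ^ 2) := by
    rw [e₁, e₂, e₃]
    linear_combination l ^ 3 * s₃ + l ^ 2 * c * s₂ + l * c ^ 2 * s₁ + (-a*c^2 + b * c * (l - lam * c)) * hln
  have y30 : y₃ ≠ 0 := by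
    rintro rfl
    rw [neg_zero, mul_zero] at prod
    exact mul_ne_zero (pow_ne_zero 3 c0) D0 prod.symm
  have hz3 : x₃ / y₃ - Z₁ - Z₂ = (a * nu + 2 * b * lam * nu) / (1 + a * lam + b * lam ^ 2) := by
    have hnu' : nu = 1 / c := by field_simp; rw [mul_comm]; exact hcn
    have e : x₃ * y₁ * y₂ - x₁ * y₂ * y₃ - x₂ * y₁ * y₃ = -(c ^ 2 * (a + 2 * b * lam)) := by
      rw [e₁, e₂, e₃]
      linear_combination 3 * l ^ 2 * s₃ + 2 * l * c * s₂ + c ^ 2 * s₁ + 2 * c * b * hln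
    have e' : x₃ / y₃ - x₁ / y₁ - x₂ / y₂ =
        (x₃ * y₁ * y₂ - x₁ * y₂ * y₃ - x₂ * y₁ * y₃) / -(y₁ * y₂ * -y₃) := by
      field_simp
    rw [← hz1, ← hz2, hnu', e', e, prod]
    field_simp
  have hv3 : v (x₃ / y₃ - Z₁ - Z₂) ≤ M ^ 3 := by
    rw [hz3, map_div₀, hD1, div_one]
    have t2 : v 2 ≤ 1 := by
      rw [← one_add_one_eq_two]; exact na_add hv (by simp) (by simp)
    apply na_add hv
    · simpa using v_mul_le ha hnu3
    · have := v_mul_le (v_mul_le (v_mul_le t2 hb) (hlam2.trans (M21.trans M1.le))) hnu3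
      simpa using this
  refine ⟨?_, hv3⟩
  have hz3' : v (x₃ / y₃) ≤ M := by
    rw [show x₃ / y₃ = (x₃ / y₃ - Z₁ - Z₂) + Z₁ + Z₂ by ring]
    exact na_add hv (na_add hv (hv3.trans M31) m1) m2
  apply big_of_small hv ha hb h₃ y30
  have : 1 / y₃ = lam * (x₃ / y₃) - nu := by
    field_simp
    apply mul_left_cancel₀ c0
    linear_combination e₃ + y₃ * hcn - x₃ * hln
  rw [this]
  refine lt_of_le_of_lt (na_sub hv (r := M) ?_ (hnu3.trans M31)) M1
  have := v_mul_le hlam2 hz3'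
  nlinarith

variable [DecidableEq K]

/-- The kernel of reduction. -/
def InKer (v : AbsoluteValue K ℝ) : (curve a b).Point → Prop
  | 0 => True
  | .some x _ _ => 1 < v x

/-- The parameter `x / y` at the origin. -/
def zpar : (curve a b).Point → K
  | 0 => 0
  | .some x y _ => x / y

omit hv ha hb in
lemma zpar_neg (P : (curve a b).Point) : zpar (-P) = -zpar P := by
  rcases P with _ | ⟨x, y, h⟩
  · exact neg_zero.symm
  · obtain ⟨h', e⟩ := neg_some' h
    rw [e, zpar, zpar, div_neg]

omit hv ha hb in
lemma InKer.neg {P : (curve a b).Point} (h : InKer v P) : InKer v (-P) := by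
  rcases P with _ | ⟨x, y, h'⟩
  · trivial
  · obtain ⟨h', e⟩ := neg_some' h'
    rw [e]; exact h

theorem zpar_add [CharZero K] {P Q : (curve a b).Point} (hP : InKer v P) (hQ : InKer v Q) :
    InKer v (P + Q) ∧ v (zpar (P + Q) - zpar P - zpar Q) ≤ max (v (zpar P)) (v (zpar Q)) ^ 3 := by
  have nn : ∀ r s : K, 0 ≤ max (v r) (v s) ^ 3 := fun r s =>
    pow_nonneg ((v.nonneg _).trans (le_max_left _ _)) 3
  rcases P with _ | ⟨x₁, y₁, n₁⟩
  · change InKer v (0 + Q) ∧ v (zpar (0 + Q) - 0 - zpar Q) ≤ _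
    rw [zero_add, sub_zero, sub_self, map_zero]
    exact ⟨hQ, nn _ _⟩
  rcases Q with _ | ⟨x₂, y₂, n₂⟩
  · change InKer v (_ + 0) ∧ v (zpar (_ + 0) - _ - 0) ≤ _
    rw [add_zero, sub_zero, sub_self, map_zero]
    exact ⟨hP, nn _ _⟩
  have h₁ := curve_equation.mp n₁.1
  have h₂ := curve_equation.mp n₂.1
  obtain ⟨y10, -, z1, w1, -⟩ := big_point hv ha hb h₁ hP
  obtain ⟨y20, -, z2, w2, -⟩ := big_point hv ha hb h₂ hQ
  by_cases hx : x₁ = x₂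
  · subst hx
    have : (y₁ - y₂) * (y₁ + y₂) = 0 := by linear_combination h₁ - h₂
    rcases mul_eq_zero.mp this with h | h
    · obtain rfl := sub_eq_zero.mp h
      obtain ⟨x₃, y₃, n₃, e, ex, ey⟩ := two_nsmul_of_ne two_ne_zero n₁ y10
      rw [two_nsmul] at e
      have h₃ := curve_equation.mp n₃.1
      rw [e]
      obtain ⟨l, hl⟩ : ∃ l, (3 * x₁ ^ 2 + 2 * a * x₁ + b) / (2 * y₁) = l := ⟨_, rfl⟩
      rw [hl] at ex ey
      have hl' : 3 * x₁ ^ 2 + 2 * a * x₁ + b = l * (2 * y₁) := by rw [← hl]; field_simp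
      refine formal_add hv ha hb h₁ h₁ h₃ hP hP (l := l) (c := y₁ - l * x₁) (by ring) (by ring)
        (by rw [ey]; ring) (by rw [ex]; ring) ?_ ?_ ?_
      · rw [ex]; linear_combination -hl'
      · rw [ex]; linear_combination -h₁ - x₁ * hl'
      · field_simp
        linear_combination (y₁ + l * x₁) * hl' + l * (h₁ * 3 - x₁ * hl')
    · obtain ⟨h', e⟩ := neg_some' n₂
      have : (.some x₁ y₁ n₁ : (curve a b).Point) = -.some x₁ y₂ n₂ := by
        rw [e]; obtain rfl := eq_neg_of_add_eq_zero_left h; rfl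
      rw [this, neg_add_cancel, zpar_neg]
      refine ⟨trivial, ?_⟩
      change v (0 - _ - _) ≤ _
      rw [zero_sub, neg_neg, sub_self, map_zero]
      exact nn _ _
  · obtain ⟨x₃, y₃, n₃, e, ex, ey⟩ := add_of_ne n₁ n₂ hx
    have h₃ := curve_equation.mp n₃.1
    have hx' := sub_ne_zero.mpr hx
    rw [e]
    obtain ⟨l, hl⟩ : ∃ l, (y₁ - y₂) / (x₁ - x₂) = l := ⟨_, rfl⟩
    rw [hl] at ex ey
    have hl' : y₁ - y₂ = l * (x₁ - x₂) := by rw [← hl]; field_simp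
    have hy2 : y₂ = y₁ - l * (x₁ - x₂) := by linear_combination -hl'
    have hU1 : v (1 - a * (x₂ / y₂) ^ 2 - b * (x₂ / y₂) * (1 / y₁ + 1 / y₂)) = 1 := by
      refine unit_of_small hv ha hb (max_lt z1 z2) (le_max_right _ _) ?_ ?_
      · rw [w1]; exact (pow_le_of_le_one (v.nonneg _) z1.le (by norm_num)).trans (le_max_left _ _)
      · rw [w2]; exact (pow_le_of_le_one (v.nonneg _) z2.le (by norm_num)).trans (le_max_right _ _)
    have U0 : 1 - a * (x₂ / y₂) ^ 2 - b * (x₂ / y₂) * (1 / y₁ + 1 / y₂) ≠ 0 := by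
      rw [← v.pos_iff, hU1]; exact one_pos
    have hd : (1 / y₁ - 1 / y₂) * (1 - a * (x₂ / y₂) ^ 2 - b * (x₂ / y₂) * (1 / y₁ + 1 / y₂)) =
        (x₁ / y₁ - x₂ / y₂) * ((x₁ / y₁) ^ 2 + (x₁ / y₁) * (x₂ / y₂) + (x₂ / y₂) ^ 2 +
        a * (x₁ / y₁ + x₂ / y₂) * (1 / y₁) + b * (1 / y₁) ^ 2) := by
      have q1 : 1 / y₁ = (x₁ / y₁) ^ 3 + a * (x₁ / y₁) ^ 2 * (1 / y₁) + b * (x₁ / y₁) * (1 / y₁) ^ 2 := by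
        field_simp; linear_combination h₁
      have q2 : 1 / y₂ = (x₂ / y₂) ^ 3 + a * (x₂ / y₂) ^ 2 * (1 / y₂) + b * (x₂ / y₂) * (1 / y₂) ^ 2 := by
        field_simp; linear_combination h₂
      linear_combination q1 - q2
    have hz : x₁ / y₁ - x₂ / y₂ ≠ 0 := by
      intro h0
      rw [h0, zero_mul] at hd
      have h5 := (mul_eq_zero.mp hd).resolve_right U0
      have h6 : y₁ = y₂ := by field_simp at h5; linear_combination -h5
      rw [h6] at h0
      field_simp at h0
      exact hx' (by simpa using h0)
    refine formal_add hv ha hb h₁ h₂ h₃ hP hQ (l := l) (c := y₁ - l * x₁) (by ring)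
      (by rw [hy2]; ring) (by rw [ey]; ring) (by rw [ex]) ?_ ?_ ?_
    · rw [ex]
      rw [hy2] at h₂
      apply mul_left_cancel₀ hx'
      linear_combination h₁ - h₂
    · rw [ex]
      rw [hy2] at h₂
      apply mul_left_cancel₀ hx'
      linear_combination x₂ * h₁ - x₁ * h₂
    · apply mul_left_cancel₀ hz
      have h7 : l * (x₁ / y₁ - x₂ / y₂) = -(y₁ - l * x₁) * (1 / y₁ - 1 / y₂) := by
        field_simp
        linear_combination -y₁ * hl'
      linear_combination (1 - a * (x₂ / y₂) ^ 2 - b * (x₂ / y₂) * (1 / y₁ + 1 / y₂)) * h7 -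
        (y₁ - l * x₁) * hd

/-- Multiplication by an integer acts on the parameter as multiplication to leading order. -/
theorem zpar_nsmul [CharZero K] (h3 : ∀ x : K, v x < 1 → v x ≤ v 3) (h3' : v 3 < 1)
    (hm : ∀ m : ℕ, ¬ 3 ∣ m → v m = 1) {P : (curve a b).Point} (hP : InKer v P) (hz : zpar P ≠ 0)
    {m : ℕ} (hm0 : m ≠ 0) : InKer v (m • P) ∧ Near v (zpar (m • P)) (m * zpar P) := by
  have hz1 : ∀ {Q : (curve a b).Point}, InKer v Q → v (zpar Q) < 1 := by
    rintro (_ | ⟨x, y, h⟩) hQ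
    · change v 0 < 1; simp
    · exact (big_point hv ha hb (curve_equation.mp h.1) hQ).2.2.1
  have key : ∀ {Q : (curve a b).Point}, InKer v Q → ∀ m : ℕ, InKer v (m • Q) ∧
      v (zpar (m • Q) - m * zpar Q) ≤ v (zpar Q) ^ 3 := by
    intro Q hQ m
    induction m with
    | zero => rw [zero_smul]; exact ⟨trivial, by
        change v (0 - _) ≤ _; simp [pow_nonneg]⟩
    | succ m ih =>
      obtain ⟨i1, i2⟩ := ih
      obtain ⟨j1, j2⟩ := zpar_add hv ha hb i1 hQ
      rw [succ_nsmul]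
      refine ⟨j1, ?_⟩
      have q1 : v (m * zpar Q) ≤ v (zpar Q) := by
        rw [map_mul]
        refine mul_le_of_le_one_left (v.nonneg _) ?_
        exact hv.apply_natCast_le_one
      have q2 : v (zpar (m • Q)) ≤ v (zpar Q) := by
        rw [show zpar (m • Q) = (zpar (m • Q) - m * zpar Q) + m * zpar Q by ring]
        exact na_add hv (i2.trans (pow_le_of_le_one (v.nonneg _) (hz1 hQ).le (by norm_num))) q1
      rw [max_eq_right q2] at j2
      push_cast
      rw [show zpar (m • Q + Q) - (m + 1) * zpar Q = (zpar (m • Q + Q) - zpar (m • Q) - zpar Q) +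
        (zpar (m • Q) - m * zpar Q) by ring]
      exact na_add hv j2 i2
  have v3 : 0 < v 3 := v.pos (by norm_num)
  induction m using Nat.strong_induction_on with
  | _ m ih =>
  refine ⟨(key hP m).1, ?_⟩
  by_cases hd : 3 ∣ m
  · obtain ⟨k, rfl⟩ := hd
    obtain ⟨i1, i2⟩ := ih k (by omega) (by omega)
    have e : (3 * k) • P = 3 • (k • P) := by rw [mul_smul]
    have hp := v.pos (i2.ne_left hv)
    have : Near v (zpar (3 • (k • P))) (3 * zpar (k • P)) := by
      have h1 := (key i1 3).2
      have h2 := h3 _ (hz1 i1)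
      push_cast at h1
      rw [Near]
      refine h1.trans_lt ?_
      rw [map_mul]
      nlinarith [mul_pos hp hp, mul_le_mul h2 h2 hp.le v3.le, mul_pos hp v3]
    rw [e]
    refine this.trans hv ?_
    push_cast
    rw [mul_assoc]
    exact (Near.rfl (by norm_num)).mul hv i2
  · have h1 := (key hP m).2
    rw [Near]
    refine h1.trans_lt ?_
    rw [map_mul, hm m hd, one_mul]
    have := v.pos hz
    nlinarith [hz1 hP, mul_pos this this]

lemma zpar_zsmul [CharZero K] (h3 : ∀ x : K, v x < 1 → v x ≤ v 3) (h3' : v 3 < 1)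
    (hm : ∀ m : ℕ, ¬ 3 ∣ m → v m = 1) {P : (curve a b).Point} (hP : InKer v P) (hz : zpar P ≠ 0)
    {m : ℤ} (hm0 : m ≠ 0) : InKer v (m • P) ∧ Near v (zpar (m • P)) (m * zpar P) := by
  obtain ⟨k, rfl | rfl⟩ := m.eq_nat_or_neg
  · rw [natCast_zsmul, Int.cast_natCast]
    exact zpar_nsmul hv ha hb h3 h3' hm hP hz (by simpa using hm0)
  · obtain ⟨i1, i2⟩ := zpar_nsmul hv ha hb h3 h3' hm hP hz (m := k) (by simpa using hm0)
    rw [neg_smul, natCast_zsmul, Int.cast_neg, Int.cast_natCast, zpar_neg, neg_mul]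
    exact ⟨i1.neg, i2.neg⟩

/-- Two points of the kernel of reduction with a common multiple have parameters in a rational
ratio, to leading order. -/
theorem zpar_ratio [CharZero K] (h3 : ∀ x : K, v x < 1 → v x ≤ v 3) (h3' : v 3 < 1)
    (hm : ∀ m : ℕ, ¬ 3 ∣ m → v m = 1) {P R : (curve a b).Point} (hP : InKer v P) (hR : InKer v R)
    (hz : zpar P ≠ 0) (hz' : zpar R ≠ 0) {m g : ℤ} (hm0 : m ≠ 0) (e : m • P = g • R) :
    ∃ q : ℚ, q ≠ 0 ∧ Near v (zpar P) (q * zpar R) := by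
  have h1 := (zpar_zsmul hv ha hb h3 h3' hm hP hz hm0).2
  have hg : g ≠ 0 := by
    rintro rfl
    rw [e, zero_smul] at h1
    exact h1.ne_left hv rfl
  have h2 := (zpar_zsmul hv ha hb h3 h3' hm hR hz' hg).2
  rw [e] at h1
  have h4 := (h1.symm hv).trans hv h2
  have hm1 : (m : K) ≠ 0 := by exact_mod_cast hm0
  refine ⟨g / m, div_ne_zero (by exact_mod_cast hg) (by exact_mod_cast hm0), ?_⟩
  have h5 := (Near.rfl (v := v) (inv_ne_zero hm1)).mul hv h4
  convert h5 using 1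
  · field_simp
  · push_cast; field_simp

end

end X166

namespace X166
open Polynomial NumberField

/-- The polynomial `X³ - X² + X - 2`, of discriminant `-83`. -/
noncomputable def fZ : ℤ[X] := X ^ 3 - X ^ 2 + X - 2

lemma fZ_monic : fZ.Monic := by unfold fZ; monicity!

lemma fZ_natDegree : fZ.natDegree = 3 := by unfold fZ; compute_degree!

lemma fZ_irreducible : Irreducible fZ := by
  have key : ∀ r : ZMod 3, r ^ 3 - r ^ 2 + r - 2 ≠ 0 := by decide
  have : Fact (Nat.Prime 3) := ⟨by norm_num⟩
  apply fZ_monic.irreducible_of_irreducible_map (Int.castRingHom (ZMod 3))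
  have e : fZ.map (Int.castRingHom (ZMod 3)) = X ^ 3 - X ^ 2 + X - 2 := by
    simp [fZ]
  have hm : (fZ.map (Int.castRingHom (ZMod 3))).Monic := fZ_monic.map _
  have hd : (fZ.map (Int.castRingHom (ZMod 3))).natDegree = 3 := by
    rw [fZ_monic.natDegree_map, fZ_natDegree]
  rw [Polynomial.Monic.irreducible_iff_roots_eq_zero_of_degree_le_three hm (by omega) (by omega)]
  rw [Multiset.eq_zero_iff_forall_notMem]
  intro r hr
  rw [mem_roots hm.ne_zero, IsRoot.def, e] at hr
  simp only [eval_sub, eval_add, eval_pow, eval_X, eval_ofNat] at hr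
  exact key r hr

noncomputable def fQ : ℚ[X] := fZ.map (Int.castRingHom ℚ)

lemma fQ_natDegree : fQ.natDegree = 3 := by
  rw [fQ, fZ_monic.natDegree_map, fZ_natDegree]

lemma fQ_irreducible : Irreducible fQ :=
  (fZ_monic.irreducible_iff_irreducible_map_fraction_map (K := ℚ)).mp fZ_irreducible

instance : Fact (Irreducible fQ) := ⟨fQ_irreducible⟩

/-- The cubic field of discriminant `-83`. -/
abbrev K83 : Type := AdjoinRoot fQ

noncomputable def pbK : PowerBasis ℚ K83 := AdjoinRoot.powerBasis fQ_irreducible.ne_zero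

lemma pbK_dim : pbK.dim = 3 := by
  simp [pbK, AdjoinRoot.powerBasis_dim, fQ_natDegree]

instance : CharZero K83 := algebraRat.charZero K83

instance : NumberField K83 where
  to_charZero := inferInstance
  to_finiteDimensional := pbK.finite

noncomputable def alK : K83 := AdjoinRoot.root fQ

lemma alK_rel : alK ^ 3 = alK ^ 2 - alK + 2 := by
  have h := AdjoinRoot.eval₂_root fQ
  have e : fQ = X ^ 3 - X ^ 2 + X - 2 := by simp [fQ, fZ]
  rw [show eval₂ (AdjoinRoot.of fQ) (AdjoinRoot.root fQ) fQ =
    eval₂ (AdjoinRoot.of fQ) (AdjoinRoot.root fQ) (X ^ 3 - X ^ 2 + X - 2) by rw [← e]] at h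
  simp only [eval₂_sub, eval₂_add, eval₂_pow, eval₂_X, eval₂_ofNat] at h
  unfold alK
  linear_combination h

lemma exists_coord (x : K83) : ∃ a b c : ℚ, x = a + b * alK + c * alK ^ 2 := by
  have h := pbK.basis.sum_repr x
  have e : pbK.gen = alK := by simp [pbK, alK]
  rw [← (finCongr pbK_dim).symm.sum_comp, Fin.sum_univ_three] at h
  simp only [PowerBasis.coe_basis, e] at h
  refine ⟨pbK.basis.repr x ((finCongr pbK_dim).symm 0), pbK.basis.repr x ((finCongr pbK_dim).symm 1),
    pbK.basis.repr x ((finCongr pbK_dim).symm 2), h.symm.trans ?_⟩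
  simp [Algebra.smul_def]

lemma coord_eq_zero {a b c : ℚ} (h : (a : K83) + b * alK + c * alK ^ 2 = 0) :
    a = 0 ∧ b = 0 ∧ c = 0 := by
  have h1 : AdjoinRoot.mk fQ (C a + C b * X + C c * X ^ 2) = 0 := by
    rw [← h]; simp [alK]
  rw [AdjoinRoot.mk_eq_zero] at h1
  have h2 : C a + C b * X + C c * X ^ 2 = 0 := by
    apply Polynomial.eq_zero_of_dvd_of_natDegree_lt h1
    rw [fQ_natDegree]
    have : (C a + C b * X + C c * X ^ 2).natDegree ≤ 2 := by compute_degree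
    omega
  refine ⟨?_, ?_, ?_⟩
  · simpa using congrArg (coeff · 0) h2
  · simpa [coeff_X, coeff_C] using congrArg (coeff · 1) h2
  · simpa [coeff_X, coeff_C] using congrArg (coeff · 2) h2

lemma coord_inj {a b c a' b' c' : ℚ}
    (h : (a : K83) + b * alK + c * alK ^ 2 = a' + b' * alK + c' * alK ^ 2) :
    a = a' ∧ b = b' ∧ c = c' := by
  have := coord_eq_zero (a := a - a') (b := b - b') (c := c - c')
    (by push_cast; linear_combination h)
  refine ⟨by linarith [this.1], by linarith [this.2.1], by linarith [this.2.2]⟩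

noncomputable def bK : Module.Basis (Fin 3) ℚ K83 := pbK.basis.reindex (finCongr pbK_dim)

lemma bK_apply (i : Fin 3) : bK i = alK ^ (i : ℕ) := by
  have e : pbK.gen = alK := by simp [pbK, alK]
  simp [bK, e]

lemma bK_repr (a b c : ℚ) : bK.equivFun (a + b * alK + c * alK ^ 2) = ![a, b, c] := by
  rw [← LinearEquiv.eq_symm_apply, Module.Basis.equivFun_symm_apply, Fin.sum_univ_three]
  simp [bK_apply, Algebra.smul_def]

lemma finrank_K : Module.finrank ℚ K83 = 3 := by
  simpa using Module.finrank_eq_card_basis bK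

lemma mulMatrix (a b c : ℚ) : Algebra.leftMulMatrix bK (a + b * alK + c * alK ^ 2) =
    !![a, 2 * c, 2 * b + 2 * c; b, a - c, c - b; c, b + c, a + b] := by
  ext i j
  rw [Algebra.leftMulMatrix_eq_repr_mul, bK_apply, ← Module.Basis.equivFun_apply]
  have h := alK_rel
  fin_cases j
  · have : ((a : K83) + b * alK + c * alK ^ 2) * alK ^ 0 = a + b * alK + c * alK ^ 2 := by ring
    simp only [Fin.zero_eta, Fin.val_zero]
    rw [this, bK_repr]
    fin_cases i <;> simp
  · have : ((a : K83) + b * alK + c * alK ^ 2) * alK ^ 1 = (2 * c : ℚ) + (a - c : ℚ) * alK + (b + c : ℚ) * alK ^ 2 := by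
      push_cast; linear_combination (c : K83) * h
    simp only [Fin.mk_one, Fin.val_one]
    rw [this, bK_repr]
    fin_cases i <;> simp
  · have : ((a : K83) + b * alK + c * alK ^ 2) * alK ^ 2 = (2 * b + 2 * c : ℚ) + (c - b : ℚ) * alK + (a + b : ℚ) * alK ^ 2 := by
      push_cast; linear_combination ((b : K83) + c * alK + c) * h
    simp only [Fin.reduceFinMk, Fin.val_two]
    rw [this, bK_repr]
    fin_cases i <;> simp

lemma trace_coord (a b c : ℚ) :
    Algebra.trace ℚ K83 (a + b * alK + c * alK ^ 2) = 3 * a + b - c := by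
  rw [Algebra.trace_eq_matrix_trace bK, mulMatrix, Matrix.trace_fin_three]
  simp; ring

/-- The norm form of `ℤ[α]`. -/
def nrm {R : Type*} [CommRing R] (a b c : R) : R :=
  a * ((a - c) * (a + b) - (c - b) * (b + c)) - 2 * c * (b * (a + b) - (c - b) * c) +
    (2 * b + 2 * c) * (b * (b + c) - (a - c) * c)

lemma norm_coord (a b c : ℚ) :
    Algebra.norm ℚ ((a : K83) + b * alK + c * alK ^ 2) = nrm a b c := by
  rw [Algebra.norm_eq_matrix_det bK, mulMatrix, Matrix.det_fin_three]
  simp [nrm]; ring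

lemma int_of_integral_trace {x : K83} (hx : IsIntegral ℤ x) : ∃ n : ℤ, Algebra.trace ℚ K83 x = n := by
  have := Algebra.isIntegral_trace (L := ℚ) (F := K83) hx
  obtain ⟨n, hn⟩ := IsIntegrallyClosed.isIntegral_iff.mp this
  exact ⟨n, by simpa using hn.symm⟩

/-- An integral element of the form `(a + bα + cα²) / 83` lies in `ℤ[α]`. -/
lemma dvd_of_integral {a b c : ℤ} {x : K83} (hx : IsIntegral ℤ x)
    (h : 83 * x = a + b * alK + c * alK ^ 2) : (83 : ℤ) ∣ a ∧ (83 : ℤ) ∣ b ∧ (83 : ℤ) ∣ c := by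
  have hal : IsIntegral ℤ alK := ⟨fZ, fZ_monic, by
    simp [fZ]; linear_combination alK_rel⟩
  have hx' : x = ((a / 83 : ℚ) : K83) + ((b / 83 : ℚ) : K83) * alK + ((c / 83 : ℚ) : K83) * alK ^ 2 := by
    push_cast; field_simp; linear_combination h
  have hr := alK_rel
  have t : ∀ {y : K83} {u v w : ℚ}, IsIntegral ℤ y → y = u + v * alK + w * alK ^ 2 →
      ∃ n : ℤ, 3 * u + v - w = n := by
    intro y u v w hy e
    obtain ⟨n, hn⟩ := int_of_integral_trace hy
    rw [e, trace_coord] at hn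
    exact ⟨n, hn⟩
  obtain ⟨n₀, h₀⟩ := t hx hx'
  obtain ⟨n₁, h₁⟩ := t (u := 2 * c / 83) (v := (a - c) / 83) (w := (b + c) / 83) (hx.mul hal) (by
    rw [hx']; push_cast; field_simp; linear_combination (c : K83) * hr)
  obtain ⟨n₂, h₂⟩ := t (u := (2 * b + 2 * c) / 83) (v := (c - b) / 83) (w := (a + b) / 83)
    (hx.mul (hal.pow 2)) (by
    rw [hx']; push_cast; field_simp; linear_combination ((b : K83) + c * alK + c) * hr)
  obtain ⟨n₃, h₃⟩ := t (u := (a ^ 2 + 4 * b * c + 2 * c ^ 2) / 83 ^ 2)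
    (v := (2 * a * b - 2 * b * c + c ^ 2) / 83 ^ 2)
    (w := (2 * a * c + b ^ 2 + 2 * b * c) / 83 ^ 2) (hx.pow 2) (by
    rw [hx']; push_cast; field_simp
    linear_combination (2 * (b : K83) * c + c ^ 2 * alK + c ^ 2) * hr)
  have i₀ : 3 * a + b - c = 83 * n₀ := by
    field_simp at h₀; exact_mod_cast (by linear_combination h₀ : (3 * a + b - c : ℚ) = 83 * n₀)
  have i₁ : a - b + 4 * c = 83 * n₁ := by
    field_simp at h₁; exact_mod_cast (by linear_combination h₁ : (a - b + 4 * c : ℚ) = 83 * n₁)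
  have i₃ : 3 * (a ^ 2 + 4 * b * c + 2 * c ^ 2) + (2 * a * b - 2 * b * c + c ^ 2) -
      (2 * a * c + b ^ 2 + 2 * b * c) = 83 ^ 2 * n₃ := by
    field_simp at h₃; exact_mod_cast (by linear_combination h₃ :
      (3 * (a ^ 2 + 4 * b * c + 2 * c ^ 2) + (2 * a * b - 2 * b * c + c ^ 2) -
      (2 * a * c + b ^ 2 + 2 * b * c) : ℚ) = 83 ^ 2 * n₃)
  obtain ⟨b', hb⟩ : ∃ b', b = 51 * a + 83 * b' := ⟨(b - 51 * a) / 83, by omega⟩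
  obtain ⟨c', hc⟩ : ∃ c', c = 54 * a + 83 * c' := ⟨(c - 54 * a) / 83, by omega⟩
  have ha : (83 : ℤ) ∣ 480 * a ^ 2 := by
    refine ⟨n₃ - 4 * a * b' - 14 * a * c' - (3 * (4 * b' * c' + 2 * c' ^ 2) +
      (- 2 * b' * c' + c' ^ 2) - (b' ^ 2 + 2 * b' * c')), ?_⟩
    subst hb hc
    have : (83 : ℤ) ≠ 0 := by norm_num
    apply mul_left_cancel₀ this
    linear_combination i₃
  have hp : Prime (83 : ℤ) := by rw [Int.prime_iff_natAbs_prime]; norm_num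
  have ha' : (83 : ℤ) ∣ a := by
    rcases hp.dvd_or_dvd ha with h | h
    · norm_num at h
    · exact hp.dvd_of_dvd_pow h
  refine ⟨ha', ?_, ?_⟩ <;> omega

abbrev O83 : Type := 𝓞 K83

lemma alK_integral : IsIntegral ℤ alK := ⟨fZ, fZ_monic, by
    simp [fZ]; linear_combination alK_rel⟩

noncomputable def al : O83 := ⟨alK, alK_integral⟩

@[simp] lemma coe_al : (al : K83) = alK := rfl

lemma al_rel : al ^ 3 = al ^ 2 - al + 2 := by
  apply RingOfIntegers.ext
  push_cast
  exact alK_rel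

lemma exists_coordO (x : O83) : ∃ a b c : ℤ, x = a + b * al + c * al ^ 2 := by
  obtain ⟨a, b, c, h⟩ : ∃ a b c : ℤ, 83 * (x : K83) = a + b * alK + c * alK ^ 2 := by
    obtain ⟨a, b, c, hx⟩ := exists_coord (x : K83)
    have hr := alK_rel
    have hal := alK_integral
    have hxi : IsIntegral ℤ (x : K83) := RingOfIntegers.isIntegral_coe x
    have t : ∀ {y : K83} {u v w : ℚ}, IsIntegral ℤ y → y = u + v * alK + w * alK ^ 2 →
        ∃ n : ℤ, 3 * u + v - w = n := by
      intro y u v w hy e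
      obtain ⟨n, hn⟩ := int_of_integral_trace hy
      rw [e, trace_coord] at hn
      exact ⟨n, hn⟩
    obtain ⟨n₀, h₀⟩ := t hxi hx
    obtain ⟨n₁, h₁⟩ := t (u := 2 * c) (v := (a - c)) (w := (b + c)) (hxi.mul hal) (by
      rw [hx]; push_cast; linear_combination (c : K83) * hr)
    obtain ⟨n₂, h₂⟩ := t (u := (2 * b + 2 * c)) (v := (c - b)) (w := (a + b))
      (hxi.mul (hal.pow 2)) (by
      rw [hx]; push_cast; linear_combination ((b : K83) + c * alK + c) * hr)
    refine ⟨23 * n₀ + 11 * n₁ - 3 * n₂, 11 * n₀ - 20 * n₁ + 13 * n₂, -3 * n₀ + 13 * n₁ + 4 * n₂, ?_⟩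
    have ea : (83 * a : ℚ) = 23 * n₀ + 11 * n₁ - 3 * n₂ := by rw [← h₀, ← h₁, ← h₂]; ring
    have eb : (83 * b : ℚ) = 11 * n₀ - 20 * n₁ + 13 * n₂ := by rw [← h₀, ← h₁, ← h₂]; ring
    have ec : (83 * c : ℚ) = -3 * n₀ + 13 * n₁ + 4 * n₂ := by rw [← h₀, ← h₁, ← h₂]; ring
    have ea' := congrArg (fun q : ℚ => (q : K83)) ea
    have eb' := congrArg (fun q : ℚ => (q : K83)) eb
    have ec' := congrArg (fun q : ℚ => (q : K83)) ec
    push_cast at ea' eb' ec' ⊢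
    rw [← ea', ← eb', ← ec', hx]; ring
  obtain ⟨⟨a, rfl⟩, ⟨b, rfl⟩, ⟨c, rfl⟩⟩ := dvd_of_integral x.2 h
  refine ⟨a, b, c, ?_⟩
  apply RingOfIntegers.ext
  simp only [map_add, map_mul, map_pow, map_intCast]
  push_cast at h
  have : (83 : K83) ≠ 0 := by norm_num
  apply mul_left_cancel₀ this
  have e : algebraMap O83 K83 al = alK := rfl
  rw [e]
  linear_combination h

end X166

namespace X166
open Polynomial NumberField

lemma coordO_inj {a b c a' b' c' : ℤ}
    (h : (a : O83) + b * al + c * al ^ 2 = a' + b' * al + c' * al ^ 2) :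
    a = a' ∧ b = b' ∧ c = c' := by
  have h' := congrArg (algebraMap O83 K83) h
  simp only [map_add, map_mul, map_pow, map_intCast] at h'
  have e : algebraMap O83 K83 al = alK := rfl
  rw [e] at h'
  have := coord_inj (a := a) (b := b) (c := c) (a' := a') (b' := b') (c' := c')
    (by push_cast; exact h')
  exact_mod_cast this

/-- Evaluation of `ℤ[α]` at a root of the defining cubic. -/
lemma exists_hom {R : Type*} [CommRing R] (r : R) (hr : r ^ 3 = r ^ 2 - r + 2) :
    ∃ φ : O83 →+* R, φ al = r := by
  choose f g k h using exists_coordO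
  have key : ∀ (x : O83) (a b c : ℤ), x = a + b * al + c * al ^ 2 →
      (f x + g x * r + k x * r ^ 2 : R) = a + b * r + c * r ^ 2 := by
    intro x a b c hx
    obtain ⟨h1, h2, h3⟩ := coordO_inj ((h x).symm.trans hx)
    rw [h1, h2, h3]
  refine ⟨RingHom.mk ⟨⟨fun x => (f x + g x * r + k x * r ^ 2 : R), ?_⟩, ?_⟩ ?_ ?_, ?_⟩
  · show (f 1 + g 1 * r + k 1 * r ^ 2 : R) = 1
    rw [key 1 1 0 0 (by push_cast; ring)]; push_cast; ring
  · intro x y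
    show (f (x * y) + g (x * y) * r + k (x * y) * r ^ 2 : R) = (f x + g x * r + k x * r ^ 2) * (f y + g y * r + k y * r ^ 2)
    have e := key (x * y) (f x * f y + 2 * (g x * k y + k x * g y) + 2 * (k x * k y))
      (f x * g y + g x * f y - (g x * k y + k x * g y) + k x * k y)
      (f x * k y + g x * g y + k x * f y + (g x * k y + k x * g y)) (by
        push_cast
        linear_combination h x * y + (f x + g x * al + k x * al ^ 2) * h y +
          ((g x * k y + k x * g y) + (al + 1) * (k x * k y)) * al_rel)
    rw [e]
    push_cast
    linear_combination - ((g x * k y + k x * g y) + (r + 1) * (k x * k y) : R) * hr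
  · show (f 0 + g 0 * r + k 0 * r ^ 2 : R) = 0
    rw [key 0 0 0 0 (by push_cast; ring)]; push_cast; ring
  · intro x y
    show (f (x + y) + g (x + y) * r + k (x + y) * r ^ 2 : R) = (f x + g x * r + k x * r ^ 2) + (f y + g y * r + k y * r ^ 2)
    rw [key (x + y) (f x + f y) (g x + g y) (k x + k y)
      (by push_cast; linear_combination h x + h y)]
    push_cast; ring
  · show (f al + g al * r + k al * r ^ 2 : R) = r
    rw [key al 0 1 0 (by push_cast; ring)]; push_cast; ring

/-- The integral basis `1, α, α²`. -/
noncomputable def bO : Module.Basis (Fin 3) ℤ O83 :=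
  Module.Basis.mk (v := ![1, al, al ^ 2])
    (by
      rw [Fintype.linearIndependent_iff]
      intro w hw
      simp only [Fin.sum_univ_three, Matrix.cons_val_zero, Matrix.cons_val_one, Matrix.cons_val,
        zsmul_eq_mul, mul_one] at hw
      obtain ⟨h1, h2, h3⟩ := coordO_inj (a := w 0) (b := w 1) (c := w 2) (a' := 0) (b' := 0)
        (c' := 0) (by rw [hw]; push_cast; ring)
      intro i
      fin_cases i <;> assumption)
    (by
      intro x _
      obtain ⟨a, b, c, rfl⟩ := exists_coordO x
      refine add_mem (add_mem ?_ ?_) ?_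
      · rw [← mul_one (a : O83), ← zsmul_eq_mul]
        exact Submodule.smul_mem _ _ (Submodule.subset_span ⟨0, rfl⟩)
      · rw [← zsmul_eq_mul]
        exact Submodule.smul_mem _ _ (Submodule.subset_span ⟨1, rfl⟩)
      · rw [← zsmul_eq_mul]
        exact Submodule.smul_mem _ _ (Submodule.subset_span ⟨2, rfl⟩))

lemma bO_apply (i : Fin 3) : bO i = ![1, al, al ^ 2] i := by
  simp [bO]

lemma norm_coordO (a b c : ℤ) : Algebra.norm ℤ (a + b * al + c * al ^ 2 : O83) = nrm a b c := by
  have h := Algebra.coe_norm_int (K := K83) (a + b * al + c * al ^ 2)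
  simp only [map_add, map_mul, map_pow, map_intCast] at h
  have e : algebraMap O83 K83 al = alK := rfl
  rw [e] at h
  have h2 := norm_coord a b c
  push_cast at h2
  rw [h2] at h
  unfold nrm at h ⊢
  exact_mod_cast h

lemma trace_coordO (a b c : ℤ) : Algebra.trace ℤ O83 (a + b * al + c * al ^ 2 : O83) =
    3 * a + b - c := by
  have h := Algebra.coe_trace_int (K := K83) (a + b * al + c * al ^ 2)
  have e : algebraMap O83 K83 (a + b * al + c * al ^ 2) =
      ((a : ℚ) : K83) + ((b : ℚ) : K83) * alK + ((c : ℚ) : K83) * alK ^ 2 := by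
    simp only [map_add, map_mul, map_pow, map_intCast]
    push_cast; rfl
  have h2 := h.trans ((congrArg (Algebra.trace ℚ K83) e).trans (trace_coord a b c))
  exact_mod_cast h2

lemma discr_K : discr K83 = -83 := by
  rw [← discr_eq_discr K83 bO, Algebra.discr_def]
  have e : Algebra.traceMatrix ℤ bO = !![3, 1, -1; 1, -1, 4; -1, 4, 7] := by
    ext i j
    rw [Algebra.traceMatrix_apply, Algebra.traceForm_apply, bO_apply, bO_apply]
    have t : ∀ (x : O83) (a b c : ℤ), x = a + b * al + c * al ^ 2 →
        Algebra.trace ℤ O83 x = 3 * a + b - c := by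
      rintro x a b c rfl; exact trace_coordO a b c
    have hr := al_rel
    fin_cases i <;> fin_cases j
    · exact (t (1 * 1) 1 0 0 (by push_cast; ring)).trans (by norm_num)
    · exact (t (1 * al) 0 1 0 (by push_cast; ring)).trans (by norm_num)
    · exact (t (1 * al ^ 2) 0 0 1 (by push_cast; ring)).trans (by norm_num)
    · exact (t (al * 1) 0 1 0 (by push_cast; ring)).trans (by norm_num)
    · exact (t (al * al) 0 0 1 (by push_cast; ring)).trans (by norm_num)
    · exact (t (al * al ^ 2) 2 (-1) 1 (by push_cast; linear_combination hr)).trans (by norm_num)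
    · exact (t (al ^ 2 * 1) 0 0 1 (by push_cast; ring)).trans (by norm_num)
    · exact (t (al ^ 2 * al) 2 (-1) 1 (by push_cast; linear_combination hr)).trans (by norm_num)
    · exact (t (al ^ 2 * al ^ 2) 2 1 0 (by push_cast; linear_combination (al + 1) * hr)).trans (by norm_num)
  rw [e, Matrix.det_fin_three]
  simp

lemma norm_al : Algebra.norm ℤ al = 2 := by
  have := norm_coordO 0 1 0
  simpa [nrm] using this

lemma isUnit_al_sub_one : IsUnit (al - 1) :=
  IsUnit.of_mul_eq_one (al ^ 2 + 1) (by linear_combination al_rel)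

lemma span_al_of_absNorm {I : Ideal O83} (h : Ideal.absNorm I = 2) : I = Ideal.span {al} := by
  have hi : I.toAddSubgroup.index = 2 := h
  have hn : Ideal.absNorm (Ideal.span {al}) = 2 := by
    rw [Ideal.absNorm_span_singleton, norm_al]; rfl
  have key : al ∈ I := by
    by_contra hc
    have h1 : (-1 : O83) ∉ I := by
      intro h1
      have : I = ⊤ := (Ideal.eq_top_iff_one I).mpr (by simpa using I.neg_mem h1)
      rw [this, Ideal.absNorm_top] at h
      omega
    have h2 : al + -1 ∈ I :=
      (AddSubgroup.add_mem_iff_of_index_two hi).mpr ⟨fun h => absurd h hc, fun h => absurd h h1⟩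
    have : I = ⊤ := Ideal.eq_top_of_isUnit_mem I h2 (by simpa [sub_eq_add_neg] using isUnit_al_sub_one)
    rw [this, Ideal.absNorm_top] at h
    omega
  obtain ⟨J, hJ⟩ := Ideal.dvd_iff_le.mpr ((Ideal.span_singleton_le_iff_mem _).mpr key)
  rw [hJ, map_mul, h] at hn
  have : J = ⊤ := Ideal.absNorm_eq_one_iff.mp (by omega)
  rw [hJ, this, Ideal.mul_top]

lemma complexPlaces : InfinitePlace.nrComplexPlaces K83 = 1 := by
  have h := sign_discr K83
  have h2 := InfinitePlace.card_add_two_mul_card_eq_rank K83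
  rw [finrank_K] at h2
  rw [discr_K] at h
  have : InfinitePlace.nrComplexPlaces K83 = 0 ∨ InfinitePlace.nrComplexPlaces K83 = 1 := by omega
  rcases this with h3 | h3
  · rw [h3] at h; exact absurd h (by decide)
  · exact h3

lemma rank_K : Units.rank K83 = 1 := by
  have h2 := InfinitePlace.card_add_two_mul_card_eq_rank K83
  rw [finrank_K, complexPlaces] at h2
  rw [Units.rank, InfinitePlace.card_eq_nrRealPlaces_add_nrComplexPlaces, complexPlaces]
  omega

instance : IsPrincipalIdealRing O83 := by
  apply RingOfIntegers.isPrincipalIdealRing_of_isPrincipal_of_norm_le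
  intro I hI
  rw [complexPlaces, finrank_K, discr_K] at hI
  have hs : √(|((-83 : ℤ) : ℝ)|) < 9.2 := by
    rw [Real.sqrt_lt' (by norm_num)]
    norm_num
  have hb : (4 / Real.pi) ^ 1 * ((Nat.factorial 3 : ℝ) / (3 : ℕ) ^ 3 * √|((-83 : ℤ) : ℝ)|) < 3 := by
    have hp := Real.pi_gt_three
    have : 4 / Real.pi < 4 / 3 := by gcongr
    have h0 : 0 < 4 / Real.pi := by positivity
    simp only [pow_one, Nat.factorial]
    push_cast at hs ⊢
    nlinarith
  have hlt : (Ideal.absNorm (I : Ideal O83) : ℝ) < 3 := by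
    refine lt_of_le_of_lt hI ?_
    exact_mod_cast hb
  have hlt' : Ideal.absNorm (I : Ideal O83) < 3 := by exact_mod_cast hlt
  have h0 := Ideal.absNorm_pos_of_nonZeroDivisors I
  have : Ideal.absNorm (I : Ideal O83) = 1 ∨ Ideal.absNorm (I : Ideal O83) = 2 := by omega
  rcases this with h | h
  · rw [Ideal.absNorm_eq_one_iff.mp h]; exact top_isPrincipal
  · rw [span_al_of_absNorm h]; exact ⟨⟨al, rfl⟩⟩

/-- The fundamental unit. -/
noncomputable def ep : O83 := al - 1

lemma unit_eq (u : O83ˣ) : ∃ v : O83, IsUnit v ∧ ((u : O83) = v ^ 2 ∨ (u : O83) = -v ^ 2 ∨ 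
    (u : O83) = ep * v ^ 2 ∨ (u : O83) = -(ep * v ^ 2)) := by
  have gen : ∃ η : O83ˣ, ∀ x : O83ˣ, ∃ n : ℤ, x = η ^ n ∨ x = -η ^ n := by
    refine ⟨Units.fundSystem K83 (finCongr rank_K.symm 0), fun x => ?_⟩
    obtain ⟨⟨ζ, e⟩, h, -⟩ := Units.exist_unique_eq_mul_prod K83 x
    rw [← (finCongr rank_K.symm).prod_comp, Fin.prod_univ_one] at h
    refine ⟨e (finCongr rank_K.symm 0), ?_⟩
    rcases Units.torsion_eq_one_or_neg_one_of_odd_finrank (by rw [finrank_K]; decide) ζ with h1 | h1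
    · left; rw [h]; simp [h1]
    · right; rw [h]; simp [h1]
  obtain ⟨η, hη⟩ := gen
  obtain ⟨e, he⟩ : IsUnit ep := isUnit_al_sub_one
  obtain ⟨φ, hφ⟩ := exists_hom (4 : ZMod 5) (by decide)
  have hne : ∀ v : O83, ep ≠ v ^ 2 ∧ ep ≠ -v ^ 2 := by
    have key : ∀ r : ZMod 5, 4 - 1 ≠ r ^ 2 ∧ 4 - 1 ≠ -r ^ 2 := by decide
    intro v
    refine ⟨fun h => (key (φ v)).1 ?_, fun h => (key (φ v)).2 ?_⟩ <;>
    · have := congrArg φ h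
      simpa [ep, hφ] using this
  obtain ⟨m, hm⟩ := hη e
  have hodd : ∀ k, m ≠ k + k := by
    rintro k rfl
    rcases hm with hm | hm
    · exact (hne (η ^ k : O83ˣ)).1 (by rw [← he, hm, zpow_add]; push_cast; ring)
    · exact (hne (η ^ k : O83ˣ)).2 (by rw [← he, hm, zpow_add]; push_cast; ring)
  obtain ⟨m', hm'⟩ : Odd m := by
    rw [← Int.not_even_iff_odd]; rintro ⟨k, hk⟩; exact hodd k hk
  obtain ⟨n, hn⟩ := hη u
  rcases Int.even_or_odd' n with ⟨k, hk | hk⟩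
  · refine ⟨(η ^ k : O83ˣ), Units.isUnit _, ?_⟩
    rw [hk, two_mul, zpow_add] at hn
    rcases hn with hn | hn
    · left; rw [hn]; push_cast; ring
    · right; left; rw [hn]; push_cast; ring
  · refine ⟨(η ^ (k - m') : O83ˣ), Units.isUnit _, ?_⟩
    have e1 : η ^ n = η ^ m * (η ^ (k - m') * η ^ (k - m')) := by
      rw [← zpow_add, ← zpow_add]; congr 1; omega
    rw [e1] at hn
    right; right
    rcases hm with hm | hm <;> rcases hn with hn | hn
    · left; rw [hn, ← he, hm]; push_cast; ring
    · right; rw [hn, ← he, hm]; push_cast; ring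
    · right; rw [hn, ← he, hm]; push_cast; ring
    · left; rw [hn, ← he, hm]; push_cast; ring

/-- The real embedding. -/
lemma exists_real : ∃ φ : K83 →+* ℝ, 1.353 < φ alK ∧ φ alK < 1.354 := by
  have hc : ContinuousOn (fun x : ℝ => x ^ 3 - x ^ 2 + x - 2) (Set.Icc 1.353 1.354) := by fun_prop
  have := intermediate_value_Ioo (by norm_num) hc (show (0 : ℝ) ∈ Set.Ioo _ _ by norm_num)
  obtain ⟨r, ⟨h1, h2⟩, h3⟩ := this
  refine ⟨AdjoinRoot.lift (algebraMap ℚ ℝ) r ?_, ?_, ?_⟩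
  · rw [eval₂_eq_eval_map]
    have e : fQ.map (algebraMap ℚ ℝ) = X ^ 3 - X ^ 2 + X - 2 := by simp [fQ, fZ]
    rw [e]
    simpa using h3
  · simpa [alK] using h1
  · simpa [alK] using h2

end X166

namespace X166
open Polynomial NumberField

section UFD
variable {R : Type*} [CommRing R] [IsDomain R] [UniqueFactorizationMonoid R]

lemma exists_sq_mul_squarefree (a : R) : a ≠ 0 → ∃ g r : R, Squarefree g ∧ a = g * r ^ 2 := by
  refine UniqueFactorizationMonoid.induction_on_prime a ?_ ?_ ?_
  · intro h; exact absurd rfl h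
  · intro x hx _
    exact ⟨x, 1, hx.squarefree, by ring⟩
  · intro b p hb hp ih _
    obtain ⟨g, r, hg, h⟩ := ih hb
    by_cases hd : p ∣ g
    · obtain ⟨g', rfl⟩ := hd
      exact ⟨g', p * r, hg.of_mul_right, by rw [h]; ring⟩
    · refine ⟨p * g, r, ?_, by rw [h]; ring⟩
      rw [squarefree_mul_iff]
      exact ⟨(hp.irreducible.isRelPrime_iff_not_dvd).mpr hd, hp.squarefree, hg⟩

lemma dvd_of_squarefree_mul {g r b c : R} (hg : Squarefree g) (hr : r ≠ 0)
    (h : g * r ^ 2 * b = c ^ 2) {q : R} (hq : Prime q) (hqg : q ∣ g) : q ∣ b := by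
  have h1 : r ^ 2 ∣ c ^ 2 := ⟨g * b, by rw [← h]; ring⟩
  obtain ⟨c', rfl⟩ : r ∣ c := by
    exact (IsIntegrallyClosed.pow_dvd_pow_iff two_ne_zero).mp h1
  have h2 : g * b = c' ^ 2 := by
    apply mul_left_cancel₀ (pow_ne_zero 2 hr); linear_combination h
  have h3 : q ∣ c' := hq.dvd_of_dvd_pow (h2 ▸ hqg.mul_right b)
  obtain ⟨g', rfl⟩ := hqg
  obtain ⟨d, rfl⟩ := h3
  have h4 : g' * b = q * d ^ 2 := by
    apply mul_left_cancel₀ hq.ne_zero; linear_combination h2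
  rcases hq.dvd_or_dvd ⟨_, h4⟩ with ⟨e, rfl⟩ | h5
  · exact absurd (hg q ⟨e, by ring⟩) hq.not_unit
  · exact h5

lemma squarefree_peel {g q : R} (hg : Squarefree g) (hq : Prime q) :
    ∃ (i : ℕ) (g' : R), i < 2 ∧ g = q ^ i * g' ∧ Squarefree g' ∧ ¬ q ∣ g' := by
  by_cases h : q ∣ g
  · obtain ⟨g', rfl⟩ := h
    refine ⟨1, g', by norm_num, by ring, hg.of_mul_right, ?_⟩
    rintro ⟨e, rfl⟩
    exact hq.not_unit (hg q ⟨e, by ring⟩)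
  · exact ⟨0, g, by norm_num, by ring, hg, h⟩

end UFD

lemma unit_class {u : O83} (hu : IsUnit u) : ∃ (s k : ℕ) (v : O83), s < 2 ∧ k < 2 ∧ v ≠ 0 ∧ 
    u = (-1) ^ s * ep ^ k * v ^ 2 := by
  obtain ⟨u, rfl⟩ := hu
  obtain ⟨v, hv, h | h | h | h⟩ := unit_eq u
  · exact ⟨0, 0, v, by norm_num, by norm_num, hv.ne_zero, by rw [h]; ring⟩
  · exact ⟨1, 0, v, by norm_num, by norm_num, hv.ne_zero, by rw [h]; ring⟩
  · exact ⟨0, 1, v, by norm_num, by norm_num, hv.ne_zero, by rw [h]; ring⟩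
  · exact ⟨1, 1, v, by norm_num, by norm_num, hv.ne_zero, by rw [h]; ring⟩

lemma class_of_mul_eq_sq {a b c x y z : O83} (ha : a ≠ 0) (h : a * b = c ^ 2)
    (hx : Prime x) (hy : Prime y) (hz : Prime z)
    (H : ∀ q, Prime q → q ∣ a → q ∣ b → q ∣ x ∨ q ∣ y ∨ q ∣ z) :
    ∃ (s k i j l : ℕ) (r : O83), s < 2 ∧ k < 2 ∧ i < 2 ∧ j < 2 ∧ l < 2 ∧ r ≠ 0 ∧
      (i = 1 → x ∣ a ∧ x ∣ b) ∧ (j = 1 → y ∣ a ∧ y ∣ b) ∧ (l = 1 → z ∣ a ∧ z ∣ b) ∧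
      a = (-1) ^ s * ep ^ k * x ^ i * y ^ j * z ^ l * r ^ 2 := by
  obtain ⟨g, r, hg, rfl⟩ := exists_sq_mul_squarefree a ha
  have hr : r ≠ 0 := by rintro rfl; simp at ha
  have hd : ∀ q, Prime q → q ∣ g → q ∣ g * r ^ 2 ∧ q ∣ b := fun q hq h1 =>
    ⟨h1.mul_right _, dvd_of_squarefree_mul hg hr h hq h1⟩
  obtain ⟨i, g1, hi, e1, s1, n1⟩ := squarefree_peel hg hx
  obtain ⟨j, g2, hj, e2, s2, n2⟩ := squarefree_peel s1 hy
  obtain ⟨l, g3, hl, e3, s3, n3⟩ := squarefree_peel s2 hz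
  have hu : IsUnit g3 := by
    by_contra hu
    obtain ⟨q, hq, hqg⟩ := WfDvdMonoid.exists_irreducible_factor hu s3.ne_zero
    have hq := UniqueFactorizationMonoid.irreducible_iff_prime.mp hq
    have h2 : q ∣ g2 := e3 ▸ hqg.mul_left _
    have h1 : q ∣ g1 := e2 ▸ h2.mul_left _
    have h0 : q ∣ g := e1 ▸ h1.mul_left _
    obtain ⟨ha', hb'⟩ := hd q hq h0
    have as : ∀ w, Prime w → q ∣ w → w ∣ q := fun w hw h =>
      ((hq.associated_of_dvd hw h).symm).dvd
    rcases H q hq ha' hb' with h | h | h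
    · exact n1 ((as x hx h).trans h1)
    · exact n2 ((as y hy h).trans h2)
    · exact n3 ((as z hz h).trans hqg)
  obtain ⟨s, k, v, hs, hk, hv, e⟩ := unit_class hu
  refine ⟨s, k, i, j, l, v * r, hs, hk, hi, hj, hl, mul_ne_zero hv hr, ?_, ?_, ?_, ?_⟩
  · rintro rfl; exact hd x hx ⟨g1, by rw [e1]; ring⟩
  · rintro rfl; exact hd y hy ⟨x ^ i * g2, by rw [e1, e2]; ring⟩
  · rintro rfl; exact hd z hz ⟨x ^ i * (y ^ j * g3), by rw [e1, e2, e3]; ring⟩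
  · rw [e1, e2, e3, e]; ring

/-- The prime of norm four. -/
noncomputable def be : O83 := 1 - al + al ^ 2

/-- A prime of norm `-83`. -/
noncomputable def pp : O83 := 7 - 3 * al - 2 * al ^ 2

lemma al_mul_be : al * be = 2 := by rw [be]; linear_combination al_rel

lemma prime_of_norm {x : O83} (h : (Algebra.norm ℤ x).natAbs.Prime) : Prime x := by
  apply Ideal.prime_of_irreducible_absNorm_span
  · rintro rfl; simp at h; exact absurd h (by norm_num)
  · rw [Ideal.absNorm_span_singleton]; exact h

lemma prime_al : Prime al := prime_of_norm (by rw [norm_al]; exact Nat.prime_two)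

lemma norm_pp : Algebra.norm ℤ pp = -83 := by
  have := norm_coordO 7 (-3) (-2)
  push_cast at this
  rw [show pp = 7 + -3 * al + -2 * al ^ 2 by rw [pp]; ring, this]
  norm_num [nrm]

lemma prime_pp : Prime pp := prime_of_norm (by rw [norm_pp]; norm_num)

lemma norm_be : Algebra.norm ℤ be = 4 := by
  have := norm_coordO 1 (-1) 1
  push_cast at this
  rw [show be = 1 + -1 * al + 1 * al ^ 2 by rw [be]; ring, this]
  norm_num [nrm]

lemma al_not_dvd_be : ¬ al ∣ be := by
  obtain ⟨φ, hφ⟩ := exists_hom (0 : ZMod 2) (by decide)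
  rintro ⟨y, hy⟩
  have := congrArg φ hy
  simp [be, hφ] at this

lemma norm_unit {x : O83} (h : (Algebra.norm ℤ x).natAbs = 1) : IsUnit x := by
  rw [← Ideal.span_singleton_eq_top, ← Ideal.absNorm_eq_one_iff, Ideal.absNorm_span_singleton, h]

lemma prime_be : Prime be := by
  rw [← UniqueFactorizationMonoid.irreducible_iff_prime]
  refine ⟨?_, ?_⟩
  · intro h
    have := h.map (Algebra.norm ℤ (S := O83))
    rw [norm_be, Int.isUnit_iff] at this
    omega
  · intro x y h
    by_contra! hc
    have hn := congrArg (fun t => (Algebra.norm ℤ t).natAbs) h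
    simp only [norm_be, map_mul, Int.natAbs_mul] at hn
    have hx : (Algebra.norm ℤ x).natAbs ≠ 1 := fun h => hc.1 (norm_unit h)
    have hy : (Algebra.norm ℤ y).natAbs ≠ 1 := fun h => hc.2 (norm_unit h)
    have h2 : (Algebra.norm ℤ x).natAbs = 2 := by
      generalize (Algebra.norm ℤ x).natAbs = m at *
      generalize (Algebra.norm ℤ y).natAbs = n at *
      have hm : m ∣ 4 := ⟨n, hn⟩
      have : m ≤ 4 := Nat.le_of_dvd (by norm_num) hm
      interval_cases m <;> omega
    have h3 := span_al_of_absNorm (I := Ideal.span {x}) (by rw [Ideal.absNorm_span_singleton, h2])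
    rw [Ideal.span_singleton_eq_span_singleton] at h3
    exact al_not_dvd_be (h3.symm.dvd.trans ⟨y, h⟩)

end X166

namespace X166
open Polynomial NumberField

lemma norm_ep : Algebra.norm ℤ ep = 1 := by
  have := norm_coordO (-1) 1 0
  push_cast at this
  rw [show ep = -1 + 1 * al + 0 * al ^ 2 by rw [ep]; ring, this]
  norm_num [nrm]

lemma norm_neg_one : Algebra.norm ℤ (-1 : O83) = -1 := by
  have := norm_coordO (-1) 0 0
  push_cast at this
  rw [show (-1 : O83) = -1 + 0 * al + 0 * al ^ 2 by ring, this]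
  norm_num [nrm]

/-- A root of `X³ - 7 X + 10`. -/
noncomputable def th : O83 := -al - al ^ 2

lemma th_rel : th ^ 3 = 7 * th - 10 := by
  rw [th]; linear_combination (-al ^ 3 - 4 * al ^ 2 - 6 * al - 5) * al_rel

/-- The ramified prime above `83`. -/
noncomputable def qq : O83 := 9 - 7 * al

lemma norm_qq : Algebra.norm ℤ qq = -83 := by
  have := norm_coordO 9 (-7) 0
  push_cast at this
  rw [show qq = 9 + -7 * al + 0 * al ^ 2 by rw [qq]; ring, this]
  norm_num [nrm]

lemma prime_qq : Prime qq := prime_of_norm (by rw [norm_qq]; norm_num)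

lemma eq_sq_of_mul_sq {n Y m : ℤ} (hm : m ≠ 0) (h : Y ^ 2 = n * m ^ 2) : ∃ y, n = y ^ 2 := by
  obtain ⟨y, rfl⟩ : m ∣ Y := (Int.pow_dvd_pow_iff two_ne_zero).mp ⟨n, by rw [h]; ring⟩
  refine ⟨y, ?_⟩
  apply mul_right_cancel₀ (pow_ne_zero 2 hm)
  rw [← h]; ring

lemma linear_factor_class {p q Y : ℤ} (hpq : IsCoprime p q)
    (h : (p ^ 2 + q ^ 2) ^ 3 - 7 * (p ^ 2 + q ^ 2) * (p * q) ^ 2 + 10 * (p * q) ^ 3 = Y ^ 2) :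
    ∃ (k : ℕ) (r : O83), k < 2 ∧ r ≠ 0 ∧
      ((p ^ 2 + q ^ 2 : ℤ) - th * (p * q : ℤ) : O83) = ep ^ k * r ^ 2 := by
  have hTS : IsCoprime (p ^ 2 + q ^ 2) (p * q) := by
    apply IsCoprime.mul_right
    · rw [sq p, add_comm]; exact IsCoprime.add_mul_left_left hpq.symm.pow_left p
    · rw [sq q]; exact IsCoprime.add_mul_left_left hpq.pow_left q
  obtain ⟨T, hT⟩ : ∃ T, p ^ 2 + q ^ 2 = T := ⟨_, rfl⟩
  obtain ⟨S, hS⟩ : ∃ S, p * q = S := ⟨_, rfl⟩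
  rw [hT, hS] at h hTS ⊢
  have hne : (T - th * S : O83) ≠ 0 := by
    intro h0
    have e : (T - th * S : O83) = (T : ℤ) + (S : ℤ) * al + (S : ℤ) * al ^ 2 := by rw [th]; ring
    rw [e] at h0
    have := coordO_inj (a := T) (b := S) (c := S) (a' := 0) (b' := 0) (c' := 0)
      (by rw [h0]; push_cast; ring)
    rw [this.1, this.2.1] at hTS
    exact not_isCoprime_zero_zero hTS
  have hO : (T ^ 3 - 7 * T * S ^ 2 + 10 * S ^ 3 : O83) = Y ^ 2 := by exact_mod_cast congrArg (Int.cast (R := O83)) h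
  obtain ⟨s, k, i, j, l, r, hs, hk, hi, hj, hl, hr, hi1, hj1, hl1, e⟩ :=
    class_of_mul_eq_sq (a := (T - th * S : O83)) (b := T ^ 2 + th * T * S + (th ^ 2 - 7) * S ^ 2)
      (c := (Y : O83)) (x := al) (y := be) (z := qq) hne
      (by linear_combination hO - S ^ 3 * th_rel) prime_al prime_be prime_qq (by
        intro π hπ h1 h2
        have h3 : π ∣ (3 * th ^ 2 - 7) * (S : O83) ^ 2 := by
          have := dvd_sub h2 (h1.mul_right (T + 2 * th * S))
          ring_nf at this ⊢
          exact this
        rcases hπ.dvd_or_dvd h3 with h4 | h4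
        · have hu : IsUnit (-9 - 2 * al - 6 * al ^ 2 : O83) := norm_unit (by
            have := norm_coordO (-9) (-2) (-6)
            push_cast at this
            rw [show (-9 - 2 * al - 6 * al ^ 2 : O83) = -9 + -2 * al + -6 * al ^ 2 by ring, this]
            norm_num [nrm])
          have e : 3 * th ^ 2 - 7 = qq * be ^ 2 * (-9 - 2 * al - 6 * al ^ 2) := by
            rw [th, qq, be]
            linear_combination ((-37) + (85) * al ^ 1 + (-127) * al ^ 2 + (82) * al ^ 3 + (-42) * al ^ 4) * al_rel
          rw [e, hu.dvd_mul_right] at h4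
          rcases hπ.dvd_or_dvd h4 with h5 | h5
          · exact Or.inr (Or.inr h5)
          · exact Or.inr (Or.inl (hπ.dvd_of_dvd_pow h5))
        · have h5 : π ∣ (S : O83) := hπ.dvd_of_dvd_pow h4
          have h6 : π ∣ (T : O83) := by
            have := dvd_add h1 (h5.mul_left th)
            simpa using this
          obtain ⟨m, n, hmn⟩ := hTS
          exfalso
          apply hπ.not_unit
          apply isUnit_of_dvd_one
          have := dvd_add (h6.mul_left (m : O83)) (h5.mul_left (n : O83))
          rw [show (1 : O83) = m * T + n * S by exact_mod_cast hmn.symm]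
          exact this)
  have hj0 : j = 0 := by
    by_contra hj0
    have hb := (hj1 (by omega)).1
    obtain ⟨φ, hφ⟩ := exists_hom (⟨0, 1⟩ : QuadraticAlgebra (ZMod 2) 1 1) (by decide)
    have h0 : φ be = 0 := by
      simp only [be, map_add, map_sub, map_one, map_pow, hφ]; decide
    obtain ⟨y, hy⟩ := hb
    have := congrArg φ hy
    simp only [map_mul, h0, zero_mul, map_sub, th, map_neg, map_pow, hφ, map_intCast] at this
    have key : ∀ p q : ZMod 2, (⟨p ^ 2 + q ^ 2, 0⟩ : QuadraticAlgebra (ZMod 2) 1 1) -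
      (-⟨0, 1⟩ - ⟨0, 1⟩ ^ 2) * ⟨p * q, 0⟩ = 0 → p = 0 ∧ q = 0 := by decide
    have := key p q (by
      rw [← this, ← hT, ← hS]; 
      congr 1
      · ext <;> simp [sq]
      · congr 1; ext <;> simp)
    rw [ZMod.intCast_zmod_eq_zero_iff_dvd, ZMod.intCast_zmod_eq_zero_iff_dvd] at this
    have := hpq.isUnit_of_dvd' this.1 this.2
    rw [Int.isUnit_iff] at this
    omega
  have hn := congrArg (Algebra.norm ℤ) e
  have hN : Algebra.norm ℤ (T - th * S : O83) = Y ^ 2 := by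
    rw [show (T - th * S : O83) = (T : ℤ) + (S : ℤ) * al + (S : ℤ) * al ^ 2 by rw [th]; ring,
      norm_coordO, ← h, nrm]; ring
  rw [hN, hj0] at hn
  simp only [map_mul, map_pow, norm_ep, norm_neg_one, norm_al, norm_qq, one_pow, mul_one, pow_zero] at hn
  have hr' : Algebra.norm ℤ r ≠ 0 := by rwa [ne_eq, Algebra.norm_eq_zero_iff]
  obtain ⟨y, hy⟩ := eq_sq_of_mul_sq hr' hn
  have h0 : s = 0 ∧ i = 0 ∧ l = 0 := by
    interval_cases s <;> interval_cases i <;> interval_cases l <;> norm_num at hy ⊢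
    all_goals
      first
      | nlinarith [sq_nonneg y]
      | (have h1 : y ≤ 13 := by nlinarith
         have h2 : -13 ≤ y := by nlinarith
         interval_cases y <;> omega)
  obtain ⟨rfl, rfl, rfl⟩ := h0
  refine ⟨k, r, hk, hr, ?_⟩
  rw [e, hj0]; ring

end X166

namespace X166
open Polynomial NumberField

lemma class_two {a b c x y : O83} (ha : a ≠ 0) (h : a * b = c ^ 2) (hx : Prime x) (hy : Prime y)
    (H : ∀ q, Prime q → q ∣ a → q ∣ b → q ∣ x ∨ q ∣ y) :
    ∃ (s k i j : ℕ) (r : O83), r ≠ 0 ∧ a = (-1) ^ s * ep ^ k * x ^ i * y ^ j * r ^ 2 := by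
  obtain ⟨s, k, i, j, l, r, -, -, -, -, -, hr, -, -, -, e⟩ := class_of_mul_eq_sq ha h hx hy hy
    (fun q h1 h2 h3 => by have := H q h1 h2 h3; tauto)
  exact ⟨s, k, i, j + l, r, hr, by rw [e]; ring⟩

/-- The inclusion of the ring of integers. -/
noncomputable def io : O83 →+* K83 := algebraMap O83 K83

lemma io_inj : Function.Injective io := RingOfIntegers.coe_injective

lemma io_ne {a : O83} : io a ≠ 0 ↔ a ≠ 0 := map_ne_zero_iff io io_inj

/-- Equality up to nonzero squares. -/
def Sim (a : K83) (b : O83) : Prop := ∃ c : K83, c ≠ 0 ∧ a = io b * c ^ 2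

lemma exists_sqrt {x : K83} {a : O83} (h : x ^ 2 = io a) : ∃ y : O83, io y = x :=
  IsIntegrallyClosed.exists_algebraMap_eq_of_isIntegral_pow (n := 2) (by norm_num)
    (by rw [h]; exact isIntegral_algebraMap)

lemma exists_frac (w : K83) : ∃ m d : O83, d ≠ 0 ∧ IsRelPrime m d ∧ w * io d = io m := by
  obtain ⟨m, ⟨d, hd0⟩, hmd, hw⟩ := IsFractionRing.exists_reduced_fraction (A := O83) w
  refine ⟨m, d, mem_nonZeroDivisors_iff_ne_zero.mp hd0, hmd, ?_⟩
  rw [← hw, mul_comm]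
  exact IsLocalization.mk'_spec' K83 m ⟨d, hd0⟩

lemma class_gen {e e' e'' x y : O83} (hx : Prime x) (hy : Prime y)
    (H : ∀ q, Prime q → q ∣ (e - e') * (e - e'') → q ∣ x ∨ q ∣ y) {w V : K83}
    (h : V ^ 2 = (w - io e) * (w - io e') * (w - io e'')) (hV : V ≠ 0) :
    ∃ s k i j : ℕ, Sim (w - io e) ((-1) ^ s * ep ^ k * x ^ i * y ^ j) := by
  obtain ⟨m, d, hd, hmd, hwm⟩ := exists_frac w
  have hdK : io d ≠ 0 := io_ne.mpr hd
  have hf : ∀ u : O83, (w - io u) * io d = io (m - u * d) := by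
    intro u; rw [map_sub, map_mul, ← hwm]; ring
  have h2 : (V * io d ^ 2) ^ 2 = io (((m - e * d) * d) * ((m - e' * d) * (m - e'' * d))) := by
    rw [map_mul, map_mul, map_mul, ← hf, ← hf, ← hf]
    linear_combination io d ^ 4 * h
  obtain ⟨c, hc⟩ := exists_sqrt h2
  rw [← hc] at h2
  have h3 : ((m - e * d) * d) * ((m - e' * d) * (m - e'' * d)) = c ^ 2 := by
    apply io_inj; rw [← h2, map_pow]
  have hwe : w - io e ≠ 0 := by rintro h0; rw [h0] at h; simp at h; exact hV h
  have ha : (m - e * d) * d ≠ 0 := by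
    rw [← io_ne, map_mul, ← hf]
    exact mul_ne_zero (mul_ne_zero hwe hdK) hdK
  obtain ⟨s, k, i, j, r, hr, e1⟩ := class_two ha h3 hx hy (by
    intro q hq h1 h2
    have hqd : ¬ q ∣ d := by
      intro hqd
      have hqm : q ∣ m := by
        rcases hq.dvd_or_dvd h2 with h4 | h4
        · simpa using dvd_add h4 (hqd.mul_left e')
        · simpa using dvd_add h4 (hqd.mul_left e'')
      exact hq.not_unit (hmd hqm hqd)
    have h5 : q ∣ m - e * d := (hq.dvd_or_dvd h1).resolve_right hqd
    have h6 : q ∣ (e - e') * (e - e'') * d ^ 2 := by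
      have := dvd_sub h2 (h5.mul_right (m + e * d - e' * d - e'' * d))
      ring_nf at this ⊢
      exact this
    exact H q hq ((hq.dvd_or_dvd h6).resolve_right (fun h => hqd (hq.dvd_of_dvd_pow h))))
  refine ⟨s, k, i, j, io r / io d, div_ne_zero (io_ne.mpr hr) hdK, ?_⟩
  have := congrArg io e1
  rw [map_mul, ← hf, map_mul _ _ (r ^ 2), map_pow _ r] at this
  field_simp
  linear_combination this

noncomputable def e1 : O83 := 3 + 2 * al - 2 * al ^ 2

noncomputable def e2 : O83 := 2 - al - al ^ 2

lemma e1_eq : e1 = -(ep * pp * (1 + al ^ 2) ^ 2) := by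
  rw [e1, ep, pp]; linear_combination (2 - 5 * al + 5 * al ^ 2 - 3 * al ^ 3 - 2 * al ^ 4) * al_rel

lemma e2_eq : e2 = -(ep * al ^ 4) := by
  rw [e2, ep]; linear_combination (-1 + al ^ 2) * al_rel

lemma e1_sub_e2 : e1 - e2 = be ^ 3 := by
  rw [e1, e2, be]; linear_combination (-3 * al + 2 * al ^ 2 - al ^ 3) * al_rel

lemma ep_mul : ep * (1 + al ^ 2) = 1 := by
  rw [ep]; linear_combination al_rel

lemma isUnit_ep : IsUnit ep := IsUnit.of_mul_eq_one _ ep_mul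

lemma ep_ne : ep ≠ 0 := isUnit_ep.ne_zero

lemma isUnit_one_add : IsUnit (1 + al ^ 2) := IsUnit.of_mul_eq_one ep (by rw [mul_comm, ep_mul])

lemma be_ne : be ≠ 0 := prime_be.ne_zero

lemma al_ne : al ≠ 0 := prime_al.ne_zero

lemma pp_ne : pp ≠ 0 := prime_pp.ne_zero

/-- The twisted roots. -/
noncomputable def E₁ (n : ℕ) : O83 := ep ^ n * e1

noncomputable def E₂ (n : ℕ) : O83 := ep ^ n * e2

/-- The curve `y² = x (x - εⁿe₁) (x - εⁿe₂)`. -/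
noncomputable abbrev cE (n : ℕ) : WeierstrassCurve.Affine K83 :=
  curve (-(io (E₁ n) + io (E₂ n))) (io (E₁ n) * io (E₂ n))

noncomputable instance : DecidableEq K83 := Classical.decEq _

lemma cE_equation {n : ℕ} {w V : K83} :
    (cE n).Equation w V ↔ V ^ 2 = w * (w - io (E₁ n)) * (w - io (E₂ n)) := by
  rw [curve_equation]
  constructor <;> intro h <;> linear_combination h

lemma E_ne (n : ℕ) : E₁ n ≠ 0 ∧ E₂ n ≠ 0 ∧ E₁ n - E₂ n ≠ 0 := by
  have h := pow_ne_zero n ep_ne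
  refine ⟨mul_ne_zero h ?_, mul_ne_zero h ?_, ?_⟩
  · rw [e1_eq, neg_ne_zero]
    exact mul_ne_zero (mul_ne_zero ep_ne pp_ne) (pow_ne_zero _ isUnit_one_add.ne_zero)
  · rw [e2_eq, neg_ne_zero]
    exact mul_ne_zero ep_ne (pow_ne_zero _ al_ne)
  · rw [E₁, E₂, ← mul_sub, e1_sub_e2]
    exact mul_ne_zero h (pow_ne_zero _ be_ne)

lemma cE_nonsingular {n : ℕ} {w V : K83} :
    (cE n).Nonsingular w V ↔ V ^ 2 = w * (w - io (E₁ n)) * (w - io (E₂ n)) := by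
  rw [← cE_equation]
  refine ⟨fun h => h.1, fun h => ?_⟩
  rw [WeierstrassCurve.Affine.nonsingular_iff]
  refine ⟨h, ?_⟩
  simp only [curve]
  by_contra! hc
  obtain ⟨hc1, hc2⟩ := hc
  have hV : V = 0 := by
    have : 2 * V = 0 := by linear_combination hc2
    simpa using this
  obtain ⟨h1, h2, h3⟩ := E_ne n
  rw [← io_ne] at h1 h2 h3
  rw [cE_equation, hV] at h
  have hprod : w * (w - io (E₁ n)) * (w - io (E₂ n)) = 0 := by linear_combination -h
  rw [hV] at hc1
  rw [map_sub] at h3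
  rcases mul_eq_zero.mp hprod with h4 | h4
  · rcases mul_eq_zero.mp h4 with h5 | h5
    · rw [h5] at hc1
      exact mul_ne_zero h1 h2 (by linear_combination -hc1)
    · rw [show w = io (E₁ n) by linear_combination h5] at hc1
      exact mul_ne_zero h1 h3 (by linear_combination -hc1)
  · rw [show w = io (E₂ n) by linear_combination h4] at hc1
    exact mul_ne_zero h2 h3 (by linear_combination hc1)

end X166

namespace X166
open Polynomial NumberField

lemma Sim.parity {a : K83} {b x : O83} {i j : ℕ} (h : Sim a (b * x ^ i)) (hx : x ≠ 0)
    (hij : i % 2 = j % 2) : Sim a (b * x ^ j) := by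
  obtain ⟨c, hc, e⟩ := h
  have hx' := io_ne.mpr hx
  refine ⟨c * io x ^ (i / 2) / io x ^ (j / 2), by simp [hc, hx'], ?_⟩
  rw [e, map_mul, map_mul, map_pow, map_pow]
  have hi : i = 2 * (i / 2) + i % 2 := by omega
  have hj : j = 2 * (j / 2) + i % 2 := by omega
  have : io x ^ i * (io x ^ (j / 2)) ^ 2 = io x ^ j * (io x ^ (i / 2)) ^ 2 := by
    rw [← pow_mul, ← pow_mul, ← pow_add, ← pow_add]; congr 1; omega
  field_simp
  linear_combination io b * this

lemma Sim.mul {a b : K83} {c d : O83} (h : Sim a c) (h' : Sim b d) : Sim (a * b) (c * d) := by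
  obtain ⟨u, hu, rfl⟩ := h
  obtain ⟨v, hv, rfl⟩ := h'
  exact ⟨u * v, mul_ne_zero hu hv, by rw [map_mul]; ring⟩

lemma sq_of_sim {V : K83} {c : O83} (h : Sim (V ^ 2) c) (hc : c ≠ 0) : ∃ y, c = y ^ 2 := by
  obtain ⟨u, hu, e⟩ := h
  obtain ⟨y, hy⟩ := exists_sqrt (x := V / u) (a := c) (by rw [div_pow, e]; field_simp)
  refine ⟨y, io_inj ?_⟩
  rw [map_pow, hy]; field_simp; exact e.symm

instance : Fact (Nat.Prime 577) := ⟨by norm_num⟩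

lemma sq_prod {R : Type*} [CommRing R] (a b c d e : R) (s k j l i : ℕ) :
    (a ^ 2) ^ s * (b ^ 2) ^ k * (c ^ 2) ^ j * (d ^ 2) ^ l * e ^ (2 * i + 1) =
    e * (a ^ s * b ^ k * c ^ j * d ^ l * e ^ i) ^ 2 := by ring

lemma pp_parity {s k j l i : ℕ} {y : O83}
    (h : (-1) ^ s * ep ^ k * al ^ j * be ^ l * pp ^ i = y ^ 2) : i % 2 = 0 := by
  obtain ⟨φ, hφ⟩ := exists_hom (479 : ZMod 577) (by decide)
  have he : φ ep = 47 ^ 2 := by rw [ep, map_sub, map_one, hφ]; decide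
  have hm : (-1 : ZMod 577) = 24 ^ 2 := by decide
  have ha : φ al = 58 ^ 2 := by rw [hφ]; decide
  have hb : φ be = 79 ^ 2 := by simp only [be, map_add, map_sub, map_one, map_pow, hφ]; decide
  have hp : φ pp = 134 := by
    simp only [pp, map_sub, map_mul, map_pow, hφ, map_ofNat]; decide
  have := congrArg φ h
  simp only [map_mul, map_pow, map_neg, map_one, he, ha, hb, hp] at this
  rw [hm] at this
  by_contra hi
  have h2 : i = 2 * (i / 2) + 1 := by omega
  set u : ZMod 577 := 24 ^ s * 47 ^ k * 58 ^ j * 79 ^ l * 134 ^ (i / 2) with hu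
  have hu0 : u ≠ 0 := by
    simp only [hu, mul_ne_zero_iff]
    refine ⟨⟨⟨⟨?_, ?_⟩, ?_⟩, ?_⟩, ?_⟩ <;> exact pow_ne_zero _ (by decide)
  have key : (φ y / u) ^ 2 = 134 := by
    rw [div_pow, div_eq_iff (pow_ne_zero 2 hu0), ← this, hu, ← sq_prod, ← h2]
  have no : (134 : ZMod 577) ^ 288 ≠ 1 := by
    rw [show (134 : ZMod 577) ^ 288 = -1 by
      rw [show 288 = 2 * 2 * 2 * 2 * 2 * 9 by norm_num]
      simp only [pow_mul]; decide]
    decide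
  apply no
  rw [← key, ← pow_mul]
  apply ZMod.pow_card_sub_one_eq_one
  intro h0
  rw [h0] at key
  exact absurd key (by decide)

lemma io_al : io al = alK := coe_al

/-- A real embedding with the signs of all the relevant numbers. -/
lemma exists_real_signs : ∃ φ : K83 →+* ℝ, 0 < φ (io ep) ∧ 0 < φ (io al) ∧ 0 < φ (io be) ∧
    0 < φ (io e1) ∧ φ (io e2) < 0 := by
  obtain ⟨φ, h1, h2⟩ := exists_real
  refine ⟨φ, ?_, ?_, ?_, ?_, ?_⟩ <;>
  simp only [ep, be, e1, e2, map_add, map_sub, map_mul, map_pow, map_one, map_ofNat, io_al] <;>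
  nlinarith

/-- The descent class of a point, given by the classes of `w` and `w - E₁`. -/
def Form {n : ℕ} (P : (cE n).Point) (c₁ c₂ : O83) : Prop :=
  ∃ w V h, P = .some w V h ∧ V ≠ 0 ∧ Sim w c₁ ∧ Sim (w - io (E₁ n)) c₂

lemma unit_dvd {n : ℕ} {q a : O83} (h : q ∣ ep ^ n * a) : q ∣ a :=
  (isUnit_ep.pow n).dvd_mul_left.mp h

lemma form_exists {n : ℕ} {w V : K83} (h : (cE n).Nonsingular w V) (hV : V ≠ 0) :
    ∃ s k j m l i : ℕ, Form (.some w V h : (cE n).Point) ((-1) ^ s * ep ^ k * al ^ j * pp ^ i)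
      ((-1) ^ s * ep ^ m * be ^ l * pp ^ i) := by
  have he := cE_nonsingular.mp h
  have d1 : ∀ q : O83, Prime q → q ∣ e1 → q ∣ pp := by
    intro q hq hd
    rw [e1_eq, dvd_neg, mul_assoc, isUnit_ep.dvd_mul_left,
      (isUnit_one_add.pow 2).dvd_mul_right] at hd
    exact hd
  have d2 : ∀ q : O83, Prime q → q ∣ e2 → q ∣ al := by
    intro q hq hd
    rw [e2_eq, dvd_neg, isUnit_ep.dvd_mul_left] at hd
    exact hq.dvd_of_dvd_pow hd
  have d3 : ∀ q : O83, Prime q → q ∣ e1 - e2 → q ∣ be := by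
    intro q hq hd
    rw [e1_sub_e2] at hd
    exact hq.dvd_of_dvd_pow hd
  have e12 : E₁ n - E₂ n = ep ^ n * (e1 - e2) := by rw [E₁, E₂]; ring
  obtain ⟨s, k, j, i, h1⟩ := class_gen (e := 0) (e' := E₁ n) (e'' := E₂ n) prime_al prime_pp (by
    intro q hq hd
    rcases hq.dvd_or_dvd hd with h | h
    · rw [zero_sub, dvd_neg] at h; exact Or.inr (d1 q hq (unit_dvd h))
    · rw [zero_sub, dvd_neg] at h; exact Or.inl (d2 q hq (unit_dvd h)))
    (w := w) (V := V) (by rw [he, map_zero, sub_zero]) hV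
  obtain ⟨t, m, l, i', h2⟩ := class_gen (e := E₁ n) (e' := 0) (e'' := E₂ n) prime_be prime_pp (by
    intro q hq hd
    rcases hq.dvd_or_dvd hd with h | h
    · rw [sub_zero] at h; exact Or.inr (d1 q hq (unit_dvd h))
    · rw [e12] at h; exact Or.inl (d3 q hq (unit_dvd h)))
    (w := w) (V := V) (by rw [he, map_zero]; ring) hV
  obtain ⟨u, v, j', l', h3⟩ := class_gen (e := E₂ n) (e' := 0) (e'' := E₁ n) prime_al prime_be (by
    intro q hq hd
    rcases hq.dvd_or_dvd hd with h | h
    · rw [sub_zero] at h; exact Or.inl (d2 q hq (unit_dvd h))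
    · rw [← dvd_neg, neg_sub, e12] at h; exact Or.inr (d3 q hq (unit_dvd h)))
    (w := w) (V := V) (by rw [he, map_zero]; ring) hV
  rw [map_zero, sub_zero] at h1
  have hs := (h1.mul h2).mul h3
  rw [← he] at hs
  obtain ⟨y, hy⟩ := sq_of_sim hs (by
    simp only [ne_eq, mul_eq_zero, pow_eq_zero_iff', neg_eq_zero, one_ne_zero, ep_ne, al_ne, be_ne,
      pp_ne, false_and, or_self, not_false_eq_true])
  have hi := pp_parity (s := s + t + u) (k := k + m + v) (j := j + j') (l := l + l') (i := i + i')
    (y := y) (by rw [← hy]; ring)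
  have h2 := h2.parity (j := i) pp_ne (by omega)
  have hst : t % 2 = s % 2 := by
    obtain ⟨φ, p1, p2, p3, p4, p5⟩ := exists_real_signs
    obtain ⟨c, hc, f1⟩ := h1
    obtain ⟨d, hd, f2⟩ := h2
    have q1 : 0 < φ (io (E₁ n)) := by
      rw [E₁, map_mul, map_mul, map_pow, map_pow]; positivity
    have q2 : φ (io (E₂ n)) < 0 := by
      rw [E₂, map_mul, map_mul, map_pow, map_pow]
      exact mul_neg_of_pos_of_neg (by positivity) p5
    have q3 : 0 < φ w * (φ w - φ (io (E₁ n))) * (φ w - φ (io (E₂ n))) := by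
      rw [← map_sub, ← map_sub, ← map_mul, ← map_mul, ← he, map_pow]
      have := (map_ne_zero φ).mpr hV
      positivity
    have q4 : 0 < φ w * φ (w - io (E₁ n)) := by
      rw [map_sub]
      by_contra! hneg
      rcases lt_trichotomy (φ w) 0 with h0 | h0 | h0
      · nlinarith
      · rw [h0] at q3; simp at q3
      · have : φ w * (φ w - φ (io (E₁ n))) * (φ w - φ (io (E₂ n))) ≤ 0 :=
          mul_nonpos_of_nonpos_of_nonneg hneg (by linarith)
        linarith
    rw [f2] at q4
    nth_rw 1 [f1] at q4
    simp only [map_mul, map_pow, map_neg, map_one] at q4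
    have hc' := (map_ne_zero φ).mpr hc
    have hd' := (map_ne_zero φ).mpr hd
    have hp' := (map_ne_zero φ).mpr (io_ne.mpr pp_ne)
    have q5 : 0 < (-1 : ℝ) ^ (s + t) * ((φ (io ep)) ^ (k + m) * φ (io al) ^ j * φ (io be) ^ l *
      (φ (io pp) ^ i) ^ 2 * (φ c * φ d) ^ 2) := by
      convert q4 using 1; ring
    have q6 := pos_of_mul_pos_left q5 (by positivity)
    rcases Nat.even_or_odd (s + t) with hh | hh
    · obtain ⟨r, hr⟩ := hh; omega
    · rw [hh.neg_one_pow] at q6; norm_num at q6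
  have h2 : Sim (w - io (E₁ n)) ((ep ^ m * be ^ l * pp ^ i) * (-1) ^ s) :=
    Sim.parity (i := t) (by convert h2 using 1; ring) (by norm_num) hst
  refine ⟨s, k, j, m, l, i, w, V, h, rfl, hV, h1, ?_⟩
  convert h2 using 1; ring

end X166

namespace X166
open Polynomial NumberField

lemma Sim.of_mul_sq {a : K83} {c c' d : O83} (h : Sim a c) (hd : d ≠ 0) (e : c = c' * d ^ 2) :
    Sim a c' := by
  obtain ⟨u, hu, rfl⟩ := h
  exact ⟨u * io d, mul_ne_zero hu (io_ne.mpr hd), by rw [e, map_mul, map_pow]; ring⟩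

lemma Sim.refl {c : O83} : Sim (io c) c := ⟨1, one_ne_zero, by ring⟩

lemma Sim.third {a b c d : K83} {u v : O83} (ha : Sim a u) (hb : Sim b v) (ha0 : a ≠ 0)
    (hb0 : b ≠ 0) (hc : c ≠ 0) (h : a * b * c = d ^ 2) : Sim c (u * v) := by
  obtain ⟨r, hr, rfl⟩ := ha
  obtain ⟨t, ht, rfl⟩ := hb
  have hu : io u ≠ 0 := left_ne_zero_of_mul ha0
  have hv : io v ≠ 0 := left_ne_zero_of_mul hb0
  have hd : d ≠ 0 := by
    rintro rfl
    have := mul_ne_zero (mul_ne_zero ha0 hb0) hc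
    rw [h] at this; simp at this
  refine ⟨d / (io u * io v * r * t), by simp [hd, hu, hv, hr, ht], ?_⟩
  rw [map_mul, div_pow, ← h]; field_simp

lemma chord {K : Type*} [Field K] {a b x₁ y₁ x₂ y₂ x₃ e : K} (h₁ : y₁ ^ 2 = x₁ ^ 3 + a * x₁ ^ 2 + b * x₁)
    (h₂ : y₂ ^ 2 = x₂ ^ 3 + a * x₂ ^ 2 + b * x₂) (hx : x₁ ≠ x₂)
    (h₃ : x₃ = ((y₁ - y₂) / (x₁ - x₂)) ^ 2 - a - x₁ - x₂) (he : e ^ 3 + a * e ^ 2 + b * e = 0) :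
    (x₁ - e) * (x₂ - e) * (x₃ - e) = ((y₁ - y₂) / (x₁ - x₂) * (e - x₁) + y₁) ^ 2 := by
  have hx' := sub_ne_zero.mpr hx
  obtain ⟨l, hl⟩ : ∃ l, (y₁ - y₂) / (x₁ - x₂) = l := ⟨_, rfl⟩
  have hl' : y₁ - y₂ = l * (x₁ - x₂) := by rw [← hl]; field_simp
  rw [hl] at h₃ ⊢
  subst h₃
  have hy2 : y₂ = y₁ - l * (x₁ - x₂) := by linear_combination -hl'
  rw [hy2] at h₂
  apply mul_left_cancel₀ hx'
  linear_combination (x₂ - x₁) * he + (-(e - x₂)) * h₁ + (e - x₁) * h₂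

lemma nonsing_left {n : ℕ} : (cE n).Nonsingular 0 0 := by rw [cE_nonsingular]; ring

lemma nonsing_mid {n : ℕ} : (cE n).Nonsingular (io (E₁ n)) 0 := by rw [cE_nonsingular]; ring

lemma nonsing_right {n : ℕ} : (cE n).Nonsingular (io (E₂ n)) 0 := by rw [cE_nonsingular]; ring

noncomputable def T₁ (n : ℕ) : (cE n).Point := .some _ _ nonsing_left

noncomputable def T₂ (n : ℕ) : (cE n).Point := .some _ _ nonsing_mid

noncomputable def T₃ (n : ℕ) : (cE n).Point := .some _ _ nonsing_right

lemma ne_of_sq {n : ℕ} {w V : K83} (h : (cE n).Nonsingular w V) (hV : V ≠ 0) :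
    w ≠ 0 ∧ w - io (E₁ n) ≠ 0 ∧ w - io (E₂ n) ≠ 0 := by
  have := cE_nonsingular.mp h
  have h2 : w * (w - io (E₁ n)) * (w - io (E₂ n)) ≠ 0 := by rw [← this]; exact pow_ne_zero 2 hV
  simp only [mul_ne_zero_iff] at h2
  tauto

lemma Form.add_T₁ {n : ℕ} {P : (cE n).Point} {c₁ c₂ : O83} (h : Form P c₁ c₂) :
    Form (P + T₁ n) (c₁ * (E₁ n * E₂ n)) (c₂ * -E₁ n) := by
  obtain ⟨w, V, hn, rfl, hV, h1, h2⟩ := h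
  obtain ⟨n1, n2, n3⟩ := ne_of_sq hn hV
  obtain ⟨hE1, hE2, hE3⟩ := E_ne n
  have i1 := io_ne.mpr hE1
  have i2 := io_ne.mpr hE2
  have i3 := io_ne.mpr hE3
  rw [map_sub] at i3
  have he := curve_equation.mp hn.1
  obtain ⟨x₃, y₃, h₃, e, ex, ey⟩ := add_of_ne hn nonsing_left n1
  have ex' : x₃ = io (E₁ n) * io (E₂ n) / w := by
    rw [ex, sub_zero, sub_zero]; field_simp; linear_combination w * he
  have hx3 : x₃ ≠ 0 := by rw [ex']; simp [i1, i2, n1]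
  refine ⟨x₃, y₃, h₃, e, ?_, ?_, ?_⟩
  · rw [ey]
    have : V * x₃ / w ≠ 0 := div_ne_zero (mul_ne_zero hV hx3) n1
    intro h0; apply this
    rw [← neg_eq_zero, ← h0]; field_simp; ring
  · refine h1.third Sim.refl (by assumption) (by simp [i1, i2]) hx3 (d := io (E₁ n * E₂ n)) ?_
    rw [ex', map_mul]; field_simp
  · have hc := chord he (by ring) n1 ex (e := io (E₁ n)) (by ring)
    refine h2.third (Sim.refl (c := -E₁ n)) n2 (by simpa using i1) ?_ (by rw [← hc, map_neg]; ring)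
    rw [ex', div_sub' n1]
    apply div_ne_zero _ n1
    rw [show io (E₁ n) * io (E₂ n) - w * io (E₁ n) = -(io (E₁ n) * (w - io (E₂ n))) by ring]
    simp [i1, n3]

lemma Form.add_T₃ {n : ℕ} {P : (cE n).Point} {c₁ c₂ : O83} (h : Form P c₁ c₂) :
    Form (P + T₃ n) (c₁ * E₂ n) (c₂ * (E₂ n - E₁ n)) := by
  obtain ⟨w, V, hn, rfl, hV, h1, h2⟩ := h
  obtain ⟨n1, n2, n3⟩ := ne_of_sq hn hV
  obtain ⟨hE1, hE2, hE3⟩ := E_ne n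
  have i1 := io_ne.mpr hE1
  have i2 := io_ne.mpr hE2
  have i3 := io_ne.mpr hE3
  rw [map_sub] at i3
  have he := curve_equation.mp hn.1
  have hne : w ≠ io (E₂ n) := sub_ne_zero.mp n3
  obtain ⟨x₃, y₃, h₃, e, ex, ey⟩ := add_of_ne hn nonsing_right hne
  have ex' : x₃ = io (E₂ n) * (w - io (E₁ n)) / (w - io (E₂ n)) := by
    rw [ex]; field_simp; linear_combination he
  have hx3 : x₃ ≠ 0 := by rw [ex']; exact div_ne_zero (mul_ne_zero i2 n2) n3
  refine ⟨x₃, y₃, h₃, e, ?_, ?_, ?_⟩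
  · have : V * (io (E₂ n) * (io (E₂ n) - io (E₁ n))) / (w - io (E₂ n)) ^ 2 ≠ 0 := by
      apply div_ne_zero (mul_ne_zero hV (mul_ne_zero i2 ?_)) (pow_ne_zero 2 n3)
      rw [← neg_sub]; exact neg_ne_zero.mpr i3
    intro h0; apply this
    rw [← neg_eq_zero, ← h0, ey, ex']; field_simp; ring
  · have hc := chord he (by ring) hne ex (e := 0) (by ring)
    refine h1.third Sim.refl n1 i2 hx3 (by rw [← hc]; ring)
  · have hc := chord he (by ring) hne ex (e := io (E₁ n)) (by ring)
    refine h2.third (Sim.refl (c := E₂ n - E₁ n)) n2 ?_ ?_ (by rw [← hc, map_sub])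
    · rw [map_sub, ← neg_sub]; exact neg_ne_zero.mpr i3
    rw [ex', div_sub' n3]
    apply div_ne_zero _ n3
    rw [show io (E₂ n) * (w - io (E₁ n)) - (w - io (E₂ n)) * io (E₁ n) =
      -((io (E₁ n) - io (E₂ n)) * w) by ring]
    exact neg_ne_zero.mpr (mul_ne_zero i3 n1)

lemma form_or_mem {n : ℕ} {L : AddSubgroup (cE n).Point} (h1 : T₁ n ∈ L) (h2 : T₂ n ∈ L)
    (h3 : T₃ n ∈ L) {P : (cE n).Point} (hP : P ∉ L) : ∃ w V h, P = .some w V h ∧ V ≠ 0 := by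
  rcases P with _ | ⟨w, V, h⟩
  · exact absurd L.zero_mem hP
  refine ⟨w, V, h, rfl, ?_⟩
  rintro rfl
  have := cE_nonsingular.mp h
  have h4 : w * (w - io (E₁ n)) * (w - io (E₂ n)) = 0 := by rw [← this]; ring
  rcases mul_eq_zero.mp h4 with h4 | h4
  · rcases mul_eq_zero.mp h4 with h4 | h4
    · subst h4; exact hP h1
    · obtain rfl := sub_eq_zero.mp h4; exact hP h2
  · obtain rfl := sub_eq_zero.mp h4; exact hP h3

lemma Form.add_gen {n : ℕ} {L : AddSubgroup (cE n).Point} (t1 : T₁ n ∈ L) (t2 : T₂ n ∈ L)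
    (t3 : T₃ n ∈ L) {P G : (cE n).Point} {c₁ c₂ d₁ d₂ : O83} (hG : G ∈ L) (hP : P ∉ L)
    (h : Form P c₁ c₂) (hg : Form G d₁ d₂) : Form (P + G) (c₁ * d₁) (c₂ * d₂) := by
  obtain ⟨w, V, hn, rfl, hV, h1, h2⟩ := h
  obtain ⟨w', V', hn', rfl, hV', h1', h2'⟩ := hg
  have he := curve_equation.mp hn.1
  have he' := curve_equation.mp hn'.1
  have hne : w ≠ w' := by
    rintro rfl
    have : (V - V') * (V + V') = 0 := by linear_combination he - he'
    rcases mul_eq_zero.mp this with h | h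
    · obtain rfl := sub_eq_zero.mp h; exact hP hG
    · obtain ⟨h', e⟩ := neg_some' hn'
      have hm := L.neg_mem hG
      rw [e] at hm
      obtain rfl := eq_neg_of_add_eq_zero_left h
      exact hP hm
  obtain ⟨n1, n2, n3⟩ := ne_of_sq hn hV
  obtain ⟨n1', n2', n3'⟩ := ne_of_sq hn' hV'
  obtain ⟨x₃, y₃, h₃, e, ex, ey⟩ := add_of_ne hn hn' hne
  have hm : (.some w V hn : (cE n).Point) + .some w' V' hn' ∉ L := fun h => hP
    ((L.add_mem_cancel_right hG).mp h)
  obtain ⟨x, y, h', e', hy⟩ := form_or_mem t1 t2 t3 hm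
  rw [e] at e'
  obtain ⟨rfl, rfl⟩ : x₃ = x ∧ y₃ = y := by
    rw [WeierstrassCurve.Affine.Point.some.injEq] at e'; exact e'
  obtain ⟨m1, m2, m3⟩ := ne_of_sq h₃ hy
  refine ⟨x₃, y₃, h₃, e, hy, ?_, ?_⟩
  · have hc := chord he he' hne ex (e := 0) (by ring)
    exact h1.third h1' n1 n1' m1 (by rw [← hc]; ring)
  · have hc := chord he he' hne ex (e := io (E₁ n)) (by ring)
    exact h2.third h2' n2 n2' m2 hc.symm.symm

/-- Every point outside `L` has a translate by an element of `L` of a very restricted class. -/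
lemma exists_reduced {n : ℕ} {L : AddSubgroup (cE n).Point} (t1 : T₁ n ∈ L) (t2 : T₂ n ∈ L)
    (t3 : T₃ n ∈ L) {P G : (cE n).Point} (hG : G ∈ L) (hg : Form G 1 ep) (hP : P ∉ L) :
    ∃ Q, Q ∉ L ∧ ∃ s k j, Form Q ((-1) ^ s * ep ^ k * al ^ j) ((-1) ^ s) := by
  have add_nmem : ∀ {P Q}, P ∉ L → Q ∈ L → P + Q ∉ L := fun hP hQ h =>
    hP ((L.add_mem_cancel_right hQ).mp h)
  obtain ⟨P, hP, s, k, j, m, l, hF⟩ : ∃ P, P ∉ L ∧ ∃ s k j m l, 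
      Form P ((-1) ^ s * ep ^ k * al ^ j) ((-1) ^ s * ep ^ m * be ^ l) := by
    obtain ⟨w, V, h, rfl, hV⟩ := form_or_mem t1 t2 t3 hP
    obtain ⟨s, k, j, m, l, i, hF⟩ := form_exists h hV
    rcases Nat.mod_two_eq_zero_or_one i with hi | hi
    · refine ⟨_, hP, s, k, j, m, l, ?_⟩
      obtain ⟨w, V, h, e, hV, f1, f2⟩ := hF
      refine ⟨w, V, h, e, hV, ?_, ?_⟩
      · simpa using f1.parity (j := 0) pp_ne hi
      · simpa using f2.parity (j := 0) pp_ne hi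
    · refine ⟨_, add_nmem hP t1, s, k, j, m + n + 1, l, ?_⟩
      obtain ⟨w, V, h, e, hV, f1, f2⟩ := hF
      have := (show Form (.some w V h : (cE n).Point) _ _ from ⟨w, V, h, rfl, hV, 
        f1.parity (j := 1) pp_ne hi, f2.parity (j := 1) pp_ne hi⟩).add_T₁
      rw [← e] at this
      obtain ⟨w, V, h, e, hV, f1, f2⟩ := this
      have hu := isUnit_one_add.ne_zero
      refine ⟨w, V, h, e, hV, f1.of_mul_sq (d := pp * ep ^ (n + 1) * (1 + al ^ 2) * al ^ 2) ?_ ?_, 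
        f2.of_mul_sq (d := pp * (1 + al ^ 2)) ?_ ?_⟩
      · simp [hu, pp_ne, ep_ne, al_ne]
      · rw [E₁, E₂, e1_eq, e2_eq]; ring
      · simp [hu, pp_ne]
      · rw [E₁, e1_eq]; ring
  obtain ⟨P, hP, s, k, j, m, hF⟩ : ∃ P, P ∉ L ∧ ∃ s k j m, 
      Form P ((-1) ^ s * ep ^ k * al ^ j) ((-1) ^ s * ep ^ m) := by
    rcases Nat.mod_two_eq_zero_or_one l with hi | hi
    · refine ⟨_, hP, s, k, j, m, ?_⟩
      obtain ⟨w, V, h, e, hV, f1, f2⟩ := hF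
      refine ⟨w, V, h, e, hV, f1, ?_⟩
      simpa using f2.parity (j := 0) be_ne hi
    · refine ⟨_, add_nmem hP t3, s + 1, k + n + 1, j, m + n, ?_⟩
      obtain ⟨w, V, h, e, hV, f1, f2⟩ := hF
      have := (show Form (.some w V h : (cE n).Point) _ _ from ⟨w, V, h, rfl, hV, 
        f1, f2.parity (j := 1) be_ne hi⟩).add_T₃
      rw [← e] at this
      obtain ⟨w, V, h, e, hV, f1, f2⟩ := this
      refine ⟨w, V, h, e, hV, f1.of_mul_sq (d := al ^ 2) ?_ ?_, f2.of_mul_sq (d := be ^ 2) ?_ ?_⟩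
      · simp [al_ne]
      · rw [E₂, e2_eq]; ring
      · simp [be_ne]
      · rw [← neg_sub, E₁, E₂, ← mul_sub, e1_sub_e2]; ring
  rcases Nat.mod_two_eq_zero_or_one m with hi | hi
  · refine ⟨_, hP, s, k, j, ?_⟩
    obtain ⟨w, V, h, e, hV, f1, f2⟩ := hF
    refine ⟨w, V, h, e, hV, f1, ?_⟩
    simpa using f2.parity (j := 0) ep_ne hi
  · refine ⟨_, add_nmem hP hG, s, k, j, ?_⟩
    obtain ⟨w, V, h, e, hV, f1, f2⟩ := hF.add_gen t1 t2 t3 hG hP hg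
    refine ⟨w, V, h, e, hV, by simpa using f1, ?_⟩
    have f2 : Sim (w - io (E₁ n)) ((-1) ^ s * ep ^ (m + 1)) := by convert f2 using 1; ring
    simpa using f2.parity (j := 0) ep_ne (by omega)

end X166

namespace X166
open Polynomial NumberField

lemma exists_primitive {π : O83} (hπ : Prime π) (r s t : K83) : ∃ R S T N : O83, N ≠ 0 ∧
    io R = io N * r ∧ io S = io N * s ∧ io T = io N * t ∧ ¬ (π ∣ R ∧ π ∣ S ∧ π ∣ T ∧ π ∣ N) := by
  have key : ∀ (k : ℕ) (N : O83), N ≠ 0 → ¬ π ^ k ∣ N → ∀ R S T : O83, io R = io N * r →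
      io S = io N * s → io T = io N * t → ∃ R S T N : O83, N ≠ 0 ∧
      io R = io N * r ∧ io S = io N * s ∧ io T = io N * t ∧
        ¬ (π ∣ R ∧ π ∣ S ∧ π ∣ T ∧ π ∣ N) := by
    intro k
    induction k with
    | zero => intro N _ h; simp at h
    | succ k ih =>
      intro N hN hk R S T h1 h2 h3
      by_cases h : π ∣ R ∧ π ∣ S ∧ π ∣ T ∧ π ∣ N
      · obtain ⟨⟨R, rfl⟩, ⟨S, rfl⟩, ⟨T, rfl⟩, ⟨N, rfl⟩⟩ := h
        have hp := io_ne.mpr hπ.ne_zero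
        simp only [map_mul, mul_assoc] at h1 h2 h3
        refine ih N (right_ne_zero_of_mul hN) (fun hd => hk ?_) R S T (mul_left_cancel₀ hp h1)
          (mul_left_cancel₀ hp h2) (mul_left_cancel₀ hp h3)
        rw [pow_succ, mul_comm]; exact mul_dvd_mul_left _ hd
      · exact ⟨R, S, T, N, hN, h1, h2, h3, h⟩
  obtain ⟨R, a, ha, -, hR⟩ := exists_frac r
  obtain ⟨S, b, hb, -, hS⟩ := exists_frac s
  obtain ⟨T, c, hc, -, hT⟩ := exists_frac t
  have hN : a * b * c ≠ 0 := mul_ne_zero (mul_ne_zero ha hb) hc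
  obtain ⟨k, hk⟩ := FiniteMultiplicity.of_prime_left hπ hN
  refine key (k + 1) _ hN hk (R * b * c) (S * a * c) (T * a * b) ?_ ?_ ?_
  · simp only [map_mul, ← hR]; ring
  · simp only [map_mul, ← hS]; ring
  · simp only [map_mul, ← hT]; ring

lemma form_system {n : ℕ} {Q : (cE n).Point} {c₁ c₂ π : O83} (h : Form Q c₁ c₂) (hπ : Prime π) :
    ∃ R S T N : O83, N ≠ 0 ∧ c₁ * R ^ 2 - E₁ n * N ^ 2 = c₂ * S ^ 2 ∧
      c₁ * R ^ 2 - E₂ n * N ^ 2 = c₁ * c₂ * T ^ 2 ∧ ¬ (π ∣ R ∧ π ∣ S ∧ π ∣ T ∧ π ∣ N) := by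
  obtain ⟨w, V, hn, rfl, hV, h1, h2⟩ := h
  obtain ⟨n1, n2, n3⟩ := ne_of_sq hn hV
  have h3 := h1.third h2 n1 n2 n3 (cE_nonsingular.mp hn).symm
  obtain ⟨r, hr, f1⟩ := h1
  obtain ⟨s, hs, f2⟩ := h2
  obtain ⟨t, ht, f3⟩ := h3
  obtain ⟨R, S, T, N, hN, g1, g2, g3, hp⟩ := exists_primitive hπ r s t
  refine ⟨R, S, T, N, hN, ?_, ?_, hp⟩
  · apply io_inj; simp only [map_mul, map_sub, map_pow, g1, g2]
    linear_combination io N ^ 2 * f2 - io N ^ 2 * f1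
  · apply io_inj; simp only [map_mul, map_sub, map_pow, g1, g3] at f3 ⊢
    linear_combination io N ^ 2 * f3 - io N ^ 2 * f1

lemma pp_dvd {φ : O83 →+* ZMod 83} (hφ : φ al = 34) {x : O83} (hx : φ x = 0) : pp ∣ x := by
  obtain ⟨a, b, c, rfl⟩ := exists_coordO x
  have h1 : pp ∣ al - 34 := ⟨(16) + (4) * al ^ 1 + (13) * al ^ 2, by rw [pp]; linear_combination ((73) + (26) * al ^ 1) * al_rel⟩
  have h2 : pp ∣ 83 := ⟨(-41) + (-10) * al ^ 1 + (-33) * al ^ 2, by rw [pp]; linear_combination ((-185) + (-66) * al ^ 1) * al_rel⟩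
  have h3 : (83 : ℤ) ∣ a + 34 * b + 34 ^ 2 * c := by
    apply (ZMod.intCast_zmod_eq_zero_iff_dvd _ 83).mp
    simp only [map_add, map_mul, map_pow, map_intCast, hφ] at hx
    push_cast; rw [← hx]; ring
  obtain ⟨d, hd⟩ := h3
  have e : (a + b * al + c * al ^ 2 : O83) = (al - 34) * (b + c * (al + 34)) + 83 * d := by
    have : (a + 34 * b + 34 ^ 2 * c : O83) = 83 * d := by exact_mod_cast congrArg (Int.cast (R := O83)) hd
    linear_combination this
  rw [e]
  exact dvd_add (h1.mul_right _) (h2.mul_right _)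

instance : Fact (Nat.Prime 83) := ⟨by norm_num⟩

lemma not_form_al {n s k : ℕ} {Q : (cE n).Point} :
    ¬ Form Q ((-1) ^ s * ep ^ k * al) ((-1) ^ s) := by
  intro h
  obtain ⟨R, S, T, N, hN, h1, h2, hp⟩ := form_system h prime_pp
  obtain ⟨φ, hφ⟩ := exists_hom (34 : ZMod 83) (by decide)
  have hu : IsUnit ((-1 : O83) ^ s) := (isUnit_one.neg).pow s
  have q : φ pp = 0 := by simp only [pp, map_sub, map_mul, map_pow, hφ, map_ofNat]; decide
  have he : φ ep = 38 ^ 2 := by rw [ep, map_sub, map_one, hφ]; decide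
  have h3 : (34 : ZMod 83) * (38 ^ k * φ R) ^ 2 = φ S ^ 2 := by
    have := congrArg φ h1
    simp only [E₁, e1_eq, map_sub, map_mul, map_neg, map_pow, map_one, q, he, hφ] at this
    have hm : ((-1 : ZMod 83) ^ s) ≠ 0 := pow_ne_zero _ (by decide)
    apply mul_left_cancel₀ hm
    rw [← this, mul_pow, show ((38 : ZMod 83) ^ k) ^ 2 = (38 ^ 2) ^ k by rw [← pow_mul, mul_comm, pow_mul]]; ring
  have no : ∀ z : ZMod 83, z ^ 2 ≠ 34 := by decide
  have hR : φ R = 0 := by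
    by_contra hR
    have : 38 ^ k * φ R ≠ 0 := mul_ne_zero (pow_ne_zero _ (by decide)) hR
    apply no (φ S / (38 ^ k * φ R))
    rw [div_pow, ← h3, mul_div_assoc, div_self (pow_ne_zero 2 this), mul_one]
  have hS : φ S = 0 := by
    rw [hR] at h3
    have : φ S ^ 2 = 0 := by rw [← h3]; ring
    exact pow_eq_zero_iff two_ne_zero |>.mp this
  obtain ⟨R, rfl⟩ := pp_dvd hφ hR
  obtain ⟨S, rfl⟩ := pp_dvd hφ hS
  have dN : pp ∣ N := by
    have e : ep ^ n * (ep * (1 + al ^ 2) ^ 2) * N ^ 2 =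
        pp * ((-1) ^ s * S ^ 2 - (-1) ^ s * ep ^ k * al * R ^ 2) := by
      apply mul_left_cancel₀ pp_ne
      rw [E₁, e1_eq] at h1; linear_combination h1
    have hd := Dvd.intro _ e.symm
    rw [((isUnit_ep.pow n).mul (isUnit_ep.mul (isUnit_one_add.pow 2))).dvd_mul_left] at hd
    exact prime_pp.dvd_of_dvd_pow hd
  refine hp ⟨Dvd.intro _ rfl, Dvd.intro _ rfl, ?_, dN⟩
  obtain ⟨N, rfl⟩ := dN
  have hd : pp ∣ (-1) ^ s * ((-1) ^ s * (ep ^ k * (al * T ^ 2))) :=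
    ⟨pp * ((-1) ^ s * ep ^ k * al * R ^ 2 - E₂ n * N ^ 2), by linear_combination -h2⟩
  rw [hu.dvd_mul_left, hu.dvd_mul_left, (isUnit_ep.pow k).dvd_mul_left] at hd
  refine prime_pp.dvd_of_dvd_pow ((prime_pp.dvd_or_dvd hd).resolve_left ?_)
  rintro ⟨z, hz⟩
  have := congrArg φ hz
  rw [map_mul, q, hφ, zero_mul] at this
  exact absurd this (by decide)

lemma al_dvd {φ : O83 →+* ZMod 4} (hφ : φ al = 2) {x : O83} (hx : 2 * φ x = 0) : al ∣ x := by
  obtain ⟨a, b, c, rfl⟩ := exists_coordO x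
  have h3 : (4 : ℤ) ∣ 2 * (a + 2 * b + 4 * c) := by
    have := ZMod.intCast_zmod_eq_zero_iff_dvd (2 * (a + 2 * b + 4 * c)) 4
    apply this.mp
    simp only [map_add, map_mul, map_pow, map_intCast, hφ] at hx
    push_cast; rw [← hx]; ring
  obtain ⟨d, rfl⟩ : (2 : ℤ) ∣ a := by omega
  exact ⟨be * d + b + c * al, by push_cast; linear_combination -(d : O83) * al_mul_be⟩

lemma not_form_neg {n k : ℕ} {Q : (cE n).Point} : ¬ Form Q (-ep ^ k) (-1) := by
  intro h
  obtain ⟨R, S, T, N, hN, h1, h2, hp⟩ := form_system h prime_al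
  obtain ⟨φ, hφ⟩ := exists_hom (2 : ZMod 4) (by decide)
  have e : S ^ 2 + ep ^ k * T ^ 2 = ep ^ n * be ^ 3 * N ^ 2 := by
    rw [← e1_sub_e2]; rw [E₁] at h1; rw [E₂] at h2; linear_combination h1 - h2
  have he : φ ep = 1 := by rw [ep, map_sub, map_one, hφ]; decide
  have hb : φ be = -1 := by simp only [be, map_add, map_sub, map_one, map_pow, hφ]; decide
  have e' := congrArg φ e
  simp only [map_add, map_mul, map_pow, he, hb, one_pow, one_mul] at e'
  have key : ∀ x y z : ZMod 4, x ^ 2 + y ^ 2 = (-1) ^ 3 * z ^ 2 → 2 * x = 0 ∧ 2 * y = 0 ∧ 2 * z = 0 := by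
    decide
  obtain ⟨k1, k2, k3⟩ := key _ _ _ e'
  have k1 := al_dvd hφ k1
  have k2 := al_dvd hφ k2
  have k3 := al_dvd hφ k3
  refine hp ⟨?_, k1, k2, k3⟩
  have : al ∣ ep ^ k * R ^ 2 := by
    rw [show ep ^ k * R ^ 2 = S ^ 2 - E₁ n * N ^ 2 by linear_combination -h1]
    exact dvd_sub (dvd_pow k1 two_ne_zero) ((dvd_pow k3 two_ne_zero).mul_left _)
  rw [(isUnit_ep.pow k).dvd_mul_left] at this
  exact prime_al.dvd_of_dvd_pow this

lemma be_dvd_of_coord {a b c : ℤ} (h1 : (2 : ℤ) ∣ a + c) (h2 : (2 : ℤ) ∣ b + 3 * c) :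
    be ∣ (a + b * al + c * al ^ 2 : O83) := by
  obtain ⟨d, hd⟩ := h1
  obtain ⟨e, he⟩ := h2
  obtain rfl : a = 2 * d - c := by omega
  obtain rfl : b = 2 * e - 3 * c := by omega
  refine ⟨al * (d + e * al - c * al - c) + c, ?_⟩
  push_cast
  rw [be]
  linear_combination (-((d : O83) + e * al - c * al - c)) * al_rel

lemma be_dvd_four {φ : O83 →+* QuadraticAlgebra (ZMod 4) 1 3} (hφ : φ al = ⟨0, 1⟩) {x : O83}
    (hx : 2 * φ x = 0) : be ∣ x := by
  obtain ⟨a, b, c, rfl⟩ := exists_coordO x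
  simp only [map_add, map_mul, map_pow, map_intCast, hφ] at hx
  rw [show (2 : QuadraticAlgebra (ZMod 4) 1 3) = ⟨2, 0⟩ from rfl] at hx
  have r := congrArg QuadraticAlgebra.re hx
  have i := congrArg QuadraticAlgebra.im hx
  simp [sq] at r i
  have hr := (ZMod.intCast_zmod_eq_zero_iff_dvd (2 * (a + c)) 4).mp (by push_cast; exact r)
  have hi := (ZMod.intCast_zmod_eq_zero_iff_dvd (2 * (b + c * 3)) 4).mp (by push_cast; exact i)
  exact be_dvd_of_coord (by omega) (by omega)

lemma be_dvd_eight {φ : O83 →+* QuadraticAlgebra (ZMod 8) 1 3} (hφ : φ al = ⟨0, 1⟩) {x : O83}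
    (hx : 4 * φ x = 0) : be ∣ x := by
  obtain ⟨a, b, c, rfl⟩ := exists_coordO x
  simp only [map_add, map_mul, map_pow, map_intCast, hφ] at hx
  rw [show (4 : QuadraticAlgebra (ZMod 8) 1 3) = ⟨4, 0⟩ from rfl] at hx
  have r := congrArg QuadraticAlgebra.re hx
  have i := congrArg QuadraticAlgebra.im hx
  simp [sq] at r i
  have hr := (ZMod.intCast_zmod_eq_zero_iff_dvd (4 * (a + c)) 8).mp (by push_cast; exact r)
  have hi := (ZMod.intCast_zmod_eq_zero_iff_dvd (4 * (b + c * 3)) 8).mp (by push_cast; exact i)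
  exact be_dvd_of_coord (by omega) (by omega)

end X166

namespace X166
open Polynomial NumberField

lemma not_form_ep_zero {Q : (cE 0).Point} : ¬ Form Q ep 1 := by
  intro h
  obtain ⟨R, S, T, N, hN, h1, h2, hp⟩ := form_system h prime_be
  obtain ⟨φ, hφ⟩ := exists_hom (⟨0, 1⟩ : QuadraticAlgebra (ZMod 4) 1 3) (by decide)
  have key : ∀ a b c d : ZMod 4, (⟨a, b⟩ : QuadraticAlgebra (ZMod 4) 1 3) ^ 2 =
    ⟨-1, 1⟩ * ⟨c, d⟩ ^ 2 → (⟨2 * a, 2 * b⟩ : QuadraticAlgebra (ZMod 4) 1 3) = 0 := by decide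
  have key : ∀ x y : QuadraticAlgebra (ZMod 4) 1 3, x ^ 2 = ⟨-1, 1⟩ * y ^ 2 → 2 * x = 0 := by
    rintro ⟨a, b⟩ ⟨c, d⟩ h
    have := key a b c d h
    rw [← this, show (2 : QuadraticAlgebra (ZMod 4) 1 3) = ⟨2, 0⟩ from rfl]
    ext <;> simp
  have he : φ ep = ⟨-1, 1⟩ := by rw [ep, map_sub, map_one, hφ]; decide
  have hb : φ be ^ 2 = 0 := by simp only [be, map_add, map_sub, map_one, map_pow, hφ]; decide
  have hE : φ e1 = 1 := by
    simp only [e1, map_add, map_sub, map_mul, map_ofNat, map_pow, hφ]; decide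
  have e : S ^ 2 = ep * T ^ 2 - be ^ 2 * (be * N ^ 2) := by
    rw [show be ^ 2 * (be * N ^ 2) = be ^ 3 * N ^ 2 by ring, ← e1_sub_e2]
    rw [E₁] at h1; rw [E₂] at h2; linear_combination h2 - h1
  have hS : be ∣ S := by
    refine be_dvd_four hφ (key (φ S) (φ T) ?_)
    have := congrArg φ e
    simpa only [map_add, map_sub, map_mul, map_pow, he, hb, zero_mul, sub_zero] using this
  have hT : be ∣ T := by
    have : be ∣ ep * T ^ 2 := by
      rw [show ep * T ^ 2 = S ^ 2 + be * (be * (be * N ^ 2)) by rw [e]; ring]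
      exact dvd_add (dvd_pow hS two_ne_zero) (Dvd.intro _ rfl)
    rw [isUnit_ep.dvd_mul_left] at this
    exact prime_be.dvd_of_dvd_pow this
  have hN' : be ∣ N := by
    refine be_dvd_four hφ (key (φ N) (φ R) ?_)
    obtain ⟨S, rfl⟩ := hS
    have := congrArg φ h1
    simp only [E₁, map_add, map_sub, map_mul, map_pow, he, hb, hE, zero_mul, sub_zero, pow_zero,
      one_mul, mul_pow, map_one] at this
    linear_combination -this
  refine hp ⟨?_, hS, hT, hN'⟩
  have : be ∣ ep * R ^ 2 := by
    rw [show ep * R ^ 2 = S ^ 2 + E₁ 0 * N ^ 2 by linear_combination h1]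
    exact dvd_add (dvd_pow hS two_ne_zero) ((dvd_pow hN' two_ne_zero).mul_left _)
  rw [isUnit_ep.dvd_mul_left] at this
  exact prime_be.dvd_of_dvd_pow this

set_option maxRecDepth 100000 in
lemma eight_norm : ∀ a b c d : ZMod 8, (⟨a, b⟩ : QuadraticAlgebra (ZMod 8) 1 3) ^ 2 -
    ⟨-1, 1⟩ * ⟨c, d⟩ ^ 2 = -(⟨-1, 1⟩ * ⟨2, 2⟩) →
    4 * (⟨a, b⟩ : QuadraticAlgebra (ZMod 8) 1 3) ^ 2 = ⟨0, 4⟩ := by decide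

set_option maxRecDepth 100000 in
lemma eight_unit : ∀ a b : ZMod 8, (∃ c d : ZMod 8,
    (⟨a, b⟩ : QuadraticAlgebra (ZMod 8) 1 3) * ⟨c, d⟩ = 1) ∨
    4 * (⟨a, b⟩ : QuadraticAlgebra (ZMod 8) 1 3) = 0 := by decide

set_option maxRecDepth 100000 in
lemma eight_square : ∀ a b : ZMod 8, (⟨a, b⟩ : QuadraticAlgebra (ZMod 8) 1 3) ^ 2 ≠
    (3 + 2 * ⟨0, 1⟩ - 2 * ⟨0, 1⟩ ^ 2) + (1 + ⟨0, 1⟩ ^ 2) * ⟨2, 5⟩ * ⟨0, 4⟩ := by decide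

lemma not_form_ep_one {Q : (cE 1).Point} : ¬ Form Q ep 1 := by
  intro h
  obtain ⟨R, S, T, N, hN, h1, h2, hp⟩ := form_system h prime_be
  obtain ⟨φ, hφ⟩ := exists_hom (⟨0, 1⟩ : QuadraticAlgebra (ZMod 4) 1 3) (by decide)
  have key : ∀ a b c d : ZMod 4, (⟨a, b⟩ : QuadraticAlgebra (ZMod 4) 1 3) ^ 2 =
    ⟨-1, 1⟩ * ⟨c, d⟩ ^ 2 → (⟨2 * a, 2 * b⟩ : QuadraticAlgebra (ZMod 4) 1 3) = 0 := by decide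
  have key : ∀ x y : QuadraticAlgebra (ZMod 4) 1 3, x ^ 2 = ⟨-1, 1⟩ * y ^ 2 → 2 * x = 0 := by
    rintro ⟨a, b⟩ ⟨c, d⟩ h
    have := key a b c d h
    rw [← this, show (2 : QuadraticAlgebra (ZMod 4) 1 3) = ⟨2, 0⟩ from rfl]
    ext <;> simp
  have he : φ ep = ⟨-1, 1⟩ := by rw [ep, map_sub, map_one, hφ]; decide
  have hb : φ be ^ 2 = 0 := by simp only [be, map_add, map_sub, map_one, map_pow, hφ]; decide
  rw [E₁, pow_one] at h1
  rw [E₂, pow_one] at h2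
  have e : S ^ 2 = ep * T ^ 2 - ep * be ^ 2 * (be * N ^ 2) := by
    rw [show ep * be ^ 2 * (be * N ^ 2) = ep * be ^ 3 * N ^ 2 by ring, ← e1_sub_e2]
    linear_combination h2 - h1
  have hS : be ∣ S := by
    refine be_dvd_four hφ (key (φ S) (φ T) ?_)
    have := congrArg φ e
    simpa only [map_add, map_sub, map_mul, map_pow, he, hb, zero_mul, mul_zero, sub_zero] using this
  have hT : be ∣ T := by
    have : be ∣ ep * T ^ 2 := by
      rw [show ep * T ^ 2 = S ^ 2 + be * (ep * be * (be * N ^ 2)) by rw [e]; ring]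
      exact dvd_add (dvd_pow hS two_ne_zero) (Dvd.intro _ rfl)
    rw [isUnit_ep.dvd_mul_left] at this
    exact prime_be.dvd_of_dvd_pow this
  have hN' : ¬ be ∣ N := by
    intro hN'
    refine hp ⟨?_, hS, hT, hN'⟩
    have : be ∣ ep * R ^ 2 := by
      rw [show ep * R ^ 2 = S ^ 2 + ep * e1 * N ^ 2 by linear_combination h1]
      exact dvd_add (dvd_pow hS two_ne_zero) ((dvd_pow hN' two_ne_zero).mul_left _)
    rw [isUnit_ep.dvd_mul_left] at this
    exact prime_be.dvd_of_dvd_pow this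
  obtain ⟨S, rfl⟩ := hS
  obtain ⟨T, rfl⟩ := hT
  obtain ⟨ψ, hψ⟩ := exists_hom (⟨0, 1⟩ : QuadraticAlgebra (ZMod 8) 1 3) (by decide)
  have f1 : S ^ 2 - ep * T ^ 2 = -(ep * be) * N ^ 2 := by
    apply mul_left_cancel₀ (pow_ne_zero 2 be_ne); linear_combination e
  have f2 : R ^ 2 = e1 * N ^ 2 + (1 + al ^ 2) * be ^ 2 * S ^ 2 := by
    apply mul_left_cancel₀ ep_ne
    linear_combination h1 - be ^ 2 * S ^ 2 * ep_mul
  obtain ⟨ν, hν⟩ : ∃ ν, ψ N * ν = 1 := by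
    obtain ⟨⟨a, b⟩, hab⟩ : ∃ z, z = ψ N := ⟨_, rfl⟩
    rcases eight_unit a b with ⟨c, d, h⟩ | h
    · exact ⟨⟨c, d⟩, hab ▸ h⟩
    · exact absurd (be_dvd_eight hψ (hab ▸ h)) hN'
  have he8 : ψ ep = ⟨-1, 1⟩ := by rw [ep, map_sub, map_one, hψ]; decide
  have hb8 : ψ be = ⟨2, 2⟩ := by simp only [be, map_add, map_sub, map_one, map_pow, hψ]; decide
  have g1 := congrArg ψ f1
  have g2 := congrArg ψ f2
  simp only [map_add, map_sub, map_mul, map_pow, map_neg, he8, hb8] at g1 g2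
  have g3 : (ψ S * ν) ^ 2 - ⟨-1, 1⟩ * (ψ T * ν) ^ 2 = -(⟨-1, 1⟩ * ⟨2, 2⟩) := by
    linear_combination ν ^ 2 * g1 - (⟨-1, 1⟩ * ⟨2, 2⟩) * (ψ N * ν + 1) * hν
  have g4 := eight_norm (ψ S * ν).re (ψ S * ν).im (ψ T * ν).re (ψ T * ν).im g3
  apply eight_square (ψ R * ν).re (ψ R * ν).im
  have g4 : 4 * (ψ S * ν) ^ 2 = ⟨0, 4⟩ := g4
  change (ψ R * ν) ^ 2 = _
  have hb2 : (⟨2, 2⟩ : QuadraticAlgebra (ZMod 8) 1 3) ^ 2 = 4 * ⟨2, 5⟩ := by decide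
  have h11 : ψ e1 = (3 + 2 * ⟨0, 1⟩ - 2 * ⟨0, 1⟩ ^ 2) := by
    simp only [e1, map_add, map_sub, map_mul, map_ofNat, map_pow, hψ]
  have h12 : ψ 1 + ψ al ^ 2 = 1 + ⟨0, 1⟩ ^ 2 := by rw [map_one, hψ]
  rw [hb2, h12, h11] at g2
  linear_combination ν ^ 2 * g2 + (3 + 2 * ⟨0, 1⟩ - 2 * ⟨0, 1⟩ ^ 2) * (ψ N * ν + 1) * hν +
    (1 + ⟨0, 1⟩ ^ 2) * ⟨2, 5⟩ * g4

lemma double_of_form_one {n : ℕ} {Q : (cE n).Point} (h : Form Q 1 1) : ∃ R, Q = 2 • R := by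
  obtain ⟨w, V, hn, rfl, hV, h1, h2⟩ := h
  obtain ⟨n1, n2, n3⟩ := ne_of_sq hn hV
  have he := cE_nonsingular.mp hn
  have h3 := h1.third h2 n1 n2 n3 he.symm
  obtain ⟨r, hr, f1⟩ := h1
  obtain ⟨s, hs, f2⟩ := h2
  obtain ⟨t, ht, f3⟩ := h3
  simp only [map_one, one_mul] at f1 f2 f3
  obtain ⟨r, hr, f1, hv⟩ : ∃ r, r ≠ 0 ∧ w = r ^ 2 ∧ V = r * s * t := by
    refine ⟨V / (s * t), div_ne_zero hV (mul_ne_zero hs ht), ?_, by field_simp⟩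
    rw [div_pow, he, f2, f3]; field_simp
  obtain ⟨hE1, hE2, hE3⟩ := E_ne n
  have i1 := io_ne.mpr hE1
  have i2 := io_ne.mpr hE2
  have i3 := io_ne.mpr hE3
  rw [map_sub] at i3
  have e1 : io (E₁ n) = r ^ 2 - s ^ 2 := by linear_combination f1 - f2
  have e2 : io (E₂ n) = r ^ 2 - t ^ 2 := by linear_combination f1 - f3
  have m1 : r + s ≠ 0 := fun h => i1 (by rw [e1]; linear_combination (r - s) * h)
  have m2 : r + t ≠ 0 := fun h => i2 (by rw [e2]; linear_combination (r - t) * h)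
  have m3 : s + t ≠ 0 := fun h => i3 (by rw [e1, e2]; linear_combination (t - s) * h)
  have hR : (cE n).Nonsingular ((r + s) * (r + t)) ((r + s) * (r + t) * (s + t)) := by
    rw [cE_nonsingular, e1, e2]; ring
  have hy := mul_ne_zero (mul_ne_zero m1 m2) m3
  obtain ⟨x₃, y₃, h₃, e, ex, ey⟩ := two_nsmul_of_ne (by norm_num) hR hy
  refine ⟨.some _ _ hR, ?_⟩
  rw [e]
  have sl : (3 * ((r + s) * (r + t)) ^ 2 + 2 * (-(io (E₁ n) + io (E₂ n))) * ((r + s) * (r + t)) +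
      io (E₁ n) * io (E₂ n)) / (2 * ((r + s) * (r + t) * (s + t))) = r + s + t := by
    rw [div_eq_iff (mul_ne_zero (by norm_num) hy), e1, e2]; ring
  rw [sl] at ex ey
  have hx : w = x₃ := by rw [ex, e1, e2, f1]; ring
  have hyy : V = y₃ := by rw [ey, ← hx, f1, hv]; ring
  subst hx hyy
  rfl

/-- Two-descent. -/
theorem descent {n : ℕ} (hn : n < 2) {L : AddSubgroup (cE n).Point} (t1 : T₁ n ∈ L)
    (t2 : T₂ n ∈ L) (t3 : T₃ n ∈ L) {G : (cE n).Point} (hG : G ∈ L) (hg : Form G 1 ep)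
    (h2 : ∀ R : (cE n).Point, 2 • R ∈ L) : L = ⊤ := by
  rw [AddSubgroup.eq_top_iff']
  intro P
  by_contra hP
  obtain ⟨Q, hQ, s, k, j, w, V, h, e, hV, f1, f2⟩ := exists_reduced t1 t2 t3 hG hg hP
  rcases Nat.mod_two_eq_zero_or_one j with hj | hj
  · have f1 : Sim w (ep ^ k * (-1) ^ s) := by
      have := f1.parity (j := 0) al_ne hj
      convert this using 1; ring
    have f2 : Sim (w - io (E₁ n)) (1 * (-1) ^ s) := by rwa [one_mul]
    rcases Nat.mod_two_eq_zero_or_one s with hs | hs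
    · have f1 := f1.parity (j := 0) (by norm_num) hs
      have f2 := f2.parity (j := 0) (by norm_num) hs
      have f1 : Sim w (1 * ep ^ k) := by convert f1 using 1; ring
      have f2 : Sim (w - io (E₁ n)) 1 := by simpa using f2
      rcases Nat.mod_two_eq_zero_or_one k with hk | hk
      · have f1 : Sim w 1 := by simpa using f1.parity (j := 0) ep_ne hk
        obtain ⟨R, rfl⟩ := double_of_form_one ⟨w, V, h, e, hV, f1, f2⟩
        exact hQ (h2 R)
      · have f1 : Sim w ep := by simpa using f1.parity (j := 1) ep_ne hk
        interval_cases n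
        · exact not_form_ep_zero ⟨w, V, h, e, hV, f1, f2⟩
        · exact not_form_ep_one ⟨w, V, h, e, hV, f1, f2⟩
    · have f1 : Sim w (-ep ^ k) := by simpa using f1.parity (j := 1) (by norm_num) hs
      have f2 : Sim (w - io (E₁ n)) (-1) := by simpa using f2.parity (j := 1) (by norm_num) hs
      exact not_form_neg ⟨w, V, h, e, hV, f1, f2⟩
  · have f1 : Sim w ((-1) ^ s * ep ^ k * al) := by simpa using f1.parity (j := 1) al_ne hj
    exact not_form_al ⟨w, V, h, e, hV, f1, f2⟩

end X166

namespace X166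
open Polynomial NumberField

instance (n : ℕ) : (cE n).IsElliptic := by
  refine ⟨?_⟩
  obtain ⟨hE1, hE2, hE3⟩ := E_ne n
  have i1 := io_ne.mpr hE1
  have i2 := io_ne.mpr hE2
  have i3 := io_ne.mpr hE3
  rw [map_sub] at i3
  rw [isUnit_iff_ne_zero]
  have : (cE n).Δ = 16 * (io (E₁ n) * io (E₂ n) * (io (E₁ n) - io (E₂ n))) ^ 2 := by
    simp only [WeierstrassCurve.Δ, WeierstrassCurve.b₂, WeierstrassCurve.b₄, WeierstrassCurve.b₆,
      WeierstrassCurve.b₈, curve]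
    ring
  rw [this]
  exact mul_ne_zero (by norm_num) (pow_ne_zero 2 (mul_ne_zero (mul_ne_zero i1 i2) i3))

lemma two_nsmul_of_y_zero {n : ℕ} {w : K83} (h : (cE n).Nonsingular w 0) :
    2 • (.some w 0 h : (cE n).Point) = 0 := by
  obtain ⟨h', e⟩ := neg_some' h
  rw [two_nsmul, add_eq_zero_iff_eq_neg, e]
  simp

lemma two_nsmul_T (n : ℕ) : 2 • T₁ n = 0 ∧ 2 • T₂ n = 0 ∧ 2 • T₃ n = 0 :=
  ⟨two_nsmul_of_y_zero _, two_nsmul_of_y_zero _, two_nsmul_of_y_zero _⟩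

lemma exists_comb {n : ℕ} (hn : n < 2) {G : (cE n).Point} (hg : Form G 1 ep) (P : (cE n).Point) :
    ∃ (a b c d : ℤ) (R : (cE n).Point), P = (a • G + b • T₁ n + c • T₂ n + d • T₃ n) + 2 • R := by
  let L : AddSubgroup (cE n).Point :=
    { carrier := {P | ∃ (a b c d : ℤ) (R : (cE n).Point),
        P = (a • G + b • T₁ n + c • T₂ n + d • T₃ n) + 2 • R}
      zero_mem' := ⟨0, 0, 0, 0, 0, by module⟩
      add_mem' := by
        rintro _ _ ⟨a, b, c, d, R, rfl⟩ ⟨a', b', c', d', R', rfl⟩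
        exact ⟨a + a', b + b', c + c', d + d', R + R', by module⟩
      neg_mem' := by
        rintro _ ⟨a, b, c, d, R, rfl⟩
        exact ⟨-a, -b, -c, -d, -R, by module⟩ }
  have : L = ⊤ := descent hn ⟨0, 1, 0, 0, 0, by module⟩ ⟨0, 0, 1, 0, 0, by module⟩
    ⟨0, 0, 0, 1, 0, by module⟩ (G := G) ⟨1, 0, 0, 0, 0, by module⟩ hg
    (fun R => ⟨0, 0, 0, 0, R, by module⟩)
  have h : P ∈ L := by rw [this]; trivial
  exact h

lemma point_fg_cE {n : ℕ} (hn : n < 2) {G : (cE n).Point} (hg : Form G 1 ep) :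
    AddGroup.FG (cE n).Point := by
  classical
  refine point_fg (Finset.image (fun i : Fin 2 × Fin 2 × Fin 2 × Fin 2 => (i.1 : ℕ) • G +
    (i.2.1 : ℕ) • T₁ n + (i.2.2.1 : ℕ) • T₂ n + (i.2.2.2 : ℕ) • T₃ n) Finset.univ) ?_
  intro P
  obtain ⟨a, b, c, d, R, rfl⟩ := exists_comb hn hg P
  have key : ∀ x : ℤ, ∃ (i : Fin 2) (y : ℤ), x = (i : ℕ) + 2 * y := fun x =>
    ⟨⟨(x % 2).toNat, by omega⟩, x / 2, by simp only; omega⟩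
  obtain ⟨i, a, rfl⟩ := key a
  obtain ⟨j, b, rfl⟩ := key b
  obtain ⟨k, c, rfl⟩ := key c
  obtain ⟨l, d, rfl⟩ := key d
  refine ⟨_, Finset.mem_image_of_mem _ (Finset.mem_univ (i, j, k, l)),
    a • G + b • T₁ n + c • T₂ n + d • T₃ n + R, ?_⟩
  module

/-- Up to an odd factor and torsion, every point is a multiple of the generator. -/
theorem exists_odd_smul {n : ℕ} (hn : n < 2) {G : (cE n).Point} (hg : Form G 1 ep)
    (P : (cE n).Point) : ∃ m g : ℤ, Odd m ∧ (2 * m) • P = (2 * g) • G := by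
  let S : Submodule ℤ (cE n).Point := Submodule.span ℤ {G, T₁ n, T₂ n, T₃ n}
  have hfg : (⊤ : Submodule ℤ (cE n).Point).FG := by
    have := point_fg_cE hn hg
    exact Module.finite_def.mp (Module.Finite.iff_addGroup_fg.mpr this)
  have hle : (⊤ : Submodule ℤ (cE n).Point) ≤ S ⊔ (Ideal.span {(2 : ℤ)}) • ⊤ := by
    intro P _
    obtain ⟨a, b, c, d, R, rfl⟩ := exists_comb hn hg P
    refine Submodule.add_mem_sup ?_ ?_
    · refine S.add_mem (S.add_mem (S.add_mem ?_ ?_) ?_) ?_ <;>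
      exact S.smul_mem _ (Submodule.subset_span (by simp))
    · rw [show 2 • R = (2 : ℤ) • R by module]
      exact Submodule.smul_mem_smul (Ideal.mem_span_singleton_self _) trivial
  obtain ⟨r, hr, hr'⟩ := Submodule.exists_sub_one_mem_and_smul_le_of_fg_of_le_sup hfg le_rfl hle
  have h1 : r • P ∈ S := hr' (Submodule.smul_mem_pointwise_smul _ _ _ trivial)
  obtain ⟨k, hk⟩ := Ideal.mem_span_singleton.mp hr
  obtain ⟨a, b, c, d, e⟩ : ∃ a b c d : ℤ, r • P = a • G + b • T₁ n + c • T₂ n + d • T₃ n := by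
    simp only [S, Submodule.mem_span_insert, Submodule.mem_span_singleton] at h1
    obtain ⟨a, _, ⟨b, _, ⟨c, _, ⟨d, rfl⟩, rfl⟩, rfl⟩, e⟩ := h1
    exact ⟨a, b, c, d, by rw [e]; module⟩
  refine ⟨r, a, ⟨k, by omega⟩, ?_⟩
  obtain ⟨h1, h2, h3⟩ := two_nsmul_T n
  calc (2 * r) • P = (2 : ℤ) • (r • P) := by module
    _ = (2 * a) • G + b • (2 • T₁ n) + c • (2 • T₂ n) + d • (2 • T₃ n) := by rw [e]; module
    _ = _ := by rw [h1, h2, h3]; module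

end X166

namespace X166
open Polynomial NumberField IsDedekindDomain

lemma three_dvd {a b c : ℤ} : (3 : O83) ∣ a + b * al + c * al ^ 2 ↔ 3 ∣ a ∧ 3 ∣ b ∧ 3 ∣ c := by
  constructor
  · rintro ⟨x, hx⟩
    obtain ⟨a', b', c', rfl⟩ := exists_coordO x
    obtain ⟨h1, h2, h3⟩ := coordO_inj (a := a) (b := b) (c := c) (a' := 3 * a') (b' := 3 * b')
      (c' := 3 * c') (by rw [hx]; push_cast; ring)
    exact ⟨⟨_, h1⟩, ⟨_, h2⟩, ⟨_, h3⟩⟩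
  · rintro ⟨⟨a', rfl⟩, ⟨b', rfl⟩, ⟨c', rfl⟩⟩
    exact ⟨a' + b' * al + c' * al ^ 2, by push_cast; ring⟩

lemma three_dvd_of_norm {x : O83} (h : 3 ∣ Algebra.norm ℤ x) : 3 ∣ x := by
  obtain ⟨a, b, c, rfl⟩ := exists_coordO x
  rw [norm_coordO] at h
  have key : ∀ a b c : ZMod 3, nrm a b c = 0 → a = 0 ∧ b = 0 ∧ c = 0 := by decide
  have h' : nrm (a : ZMod 3) b c = 0 := by
    have := (ZMod.intCast_zmod_eq_zero_iff_dvd _ 3).mpr h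
    simpa [nrm] using this
  obtain ⟨h1, h2, h3⟩ := key _ _ _ h'
  rw [ZMod.intCast_zmod_eq_zero_iff_dvd] at h1 h2 h3
  exact three_dvd.mpr ⟨h1, h2, h3⟩

lemma prime_three : Prime (3 : O83) := by
  refine ⟨by norm_num, ?_, ?_⟩
  · intro h
    have h1 := isUnit_iff_dvd_one.mp h
    have := (three_dvd (a := 1) (b := 0) (c := 0)).mp (by simpa using h1)
    omega
  · rintro x y ⟨z, hz⟩
    have h := congrArg (Algebra.norm ℤ) hz
    rw [map_mul, map_mul] at h
    have h3 := norm_coordO 3 0 0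
    simp [nrm] at h3
    rw [h3] at h
    have : (3 : ℤ) ∣ Algebra.norm ℤ x * Algebra.norm ℤ y := by rw [h]; exact dvd_mul_of_dvd_left (by norm_num) _
    exact (Int.prime_three.dvd_or_dvd this).imp three_dvd_of_norm three_dvd_of_norm

noncomputable def h3 : HeightOneSpectrum O83 :=
  ⟨Ideal.span {3}, (Ideal.span_singleton_prime (by norm_num)).mpr prime_three, by simp⟩

/-- The `3`-adic absolute value. -/
noncomputable def nu : AbsoluteValue K83 ℝ := h3.adicAbv (b := 3) (by norm_num)

lemma nu_na : IsNonarchimedean nu := h3.isNonarchimedean_adicAbv _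

lemma nu_le_one (a : O83) : nu (io a) ≤ 1 := h3.adicAbv_coe_le_one _ _

lemma nu_lt_one {a : O83} : nu (io a) < 1 ↔ 3 ∣ a := by
  rw [← Ideal.mem_span_singleton]
  exact h3.adicAbv_coe_lt_one_iff _ _

lemma nu_three_lt : nu 3 < 1 := by
  have := (nu_lt_one (a := 3)).mpr dvd_rfl
  rwa [map_ofNat] at this

lemma nu_three_pos : 0 < nu 3 := nu.pos (by norm_num)

lemma nu_le_three {x : K83} (h : nu x < 1) : nu x ≤ nu 3 := by
  obtain ⟨m, d, hd, hp, e⟩ := exists_frac x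
  have hd' : ¬ 3 ∣ d := by
    intro h3
    have : nu (io m) < 1 := by
      rw [← e, map_mul]
      exact mul_lt_one_of_nonneg_of_lt_one_left (nu.nonneg _) h (nu_le_one d)
    exact prime_three.not_isUnit (hp (nu_lt_one.mp this) h3)
  have hd1 : nu (io d) = 1 := le_antisymm (nu_le_one d) (not_lt.mp (mt nu_lt_one.mp hd'))
  have hx : nu x = nu (io m) := by rw [← e, map_mul, hd1, mul_one]
  rw [hx] at h ⊢
  obtain ⟨c, rfl⟩ := nu_lt_one.mp h
  rw [map_mul, map_mul, map_ofNat]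
  exact mul_le_of_le_one_right (nu.nonneg _) (nu_le_one c)

end X166

namespace X166
open Polynomial NumberField

lemma nu_eq_one {a : O83} (h : ¬ 3 ∣ a) : nu (io a) = 1 :=
  le_antisymm (nu_le_one a) (not_lt.mp (mt nu_lt_one.mp h))

lemma three_dvd_int {m : ℤ} : (3 : O83) ∣ (m : O83) ↔ 3 ∣ m := by
  have := three_dvd (a := m) (b := 0) (c := 0)
  simpa using this

lemma nu_int_lt {m : ℤ} : nu (m : K83) < 1 ↔ 3 ∣ m := by
  rw [← map_intCast io, nu_lt_one, three_dvd_int]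

lemma nu_int {m : ℤ} (h : ¬ 3 ∣ m) : nu (m : K83) = 1 := by
  rw [← map_intCast io]; exact nu_eq_one (mt three_dvd_int.mp h)

lemma nu_nat (m : ℕ) (h : ¬ 3 ∣ m) : nu (m : K83) = 1 := by
  rw [← Int.cast_natCast]; exact nu_int (by omega)

/-- `Z` is a rational number times an element congruent to `1` at the place above `3`. -/
def RL (Z : K83) : Prop := ∃ q : ℚ, q ≠ 0 ∧ Near nu Z q

lemma RL.rat {q : ℚ} (h : q ≠ 0) : RL (q : K83) := ⟨q, h, Near.rfl (by exact_mod_cast h)⟩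

lemma RL.of_near {x y : K83} (h : Near nu x y) (hy : RL y) : RL x := by
  obtain ⟨q, hq, h'⟩ := hy
  exact ⟨q, hq, h.trans nu_na h'⟩

lemma RL.mul {x y : K83} (hx : RL x) (hy : RL y) : RL (x * y) := by
  obtain ⟨q, hq, h⟩ := hx
  obtain ⟨q', hq', h'⟩ := hy
  exact ⟨q * q', mul_ne_zero hq hq', by push_cast; exact h.mul nu_na h'⟩

lemma RL.inv {x : K83} (hx : RL x) : RL x⁻¹ := by
  obtain ⟨q, hq, h⟩ := hx
  exact ⟨q⁻¹, inv_ne_zero hq, by push_cast; exact h.inv nu_na⟩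

lemma RL.div {x y : K83} (hx : RL x) (hy : RL y) : RL (x / y) := by
  rw [div_eq_mul_inv]; exact hx.mul hy.inv

lemma not_RL_div {X Y : O83} (hX : ¬ 3 ∣ X) (hY : ¬ 3 ∣ Y) (h1 : ¬ 3 ∣ X - Y) (h2 : ¬ 3 ∣ X + Y) :
    ¬ RL (io X / io Y) := by
  rintro ⟨q, hq, h⟩
  have hx := nu_eq_one hX
  have hy := nu_eq_one hY
  have hy0 : io Y ≠ 0 := nu.pos_iff.mp (by rw [hy]; norm_num)
  have h' := h.eq nu_na
  rw [map_div₀, hx, hy, div_one] at h'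
  have hden : (q.den : K83) ≠ 0 := by exact_mod_cast q.den_nz
  have hqe : (q : K83) = q.num / q.den := Rat.cast_def q
  have hcop := q.reduced
  have hnd : nu (q.num : K83) = nu (q.den : K83) := by
    rw [hqe, map_div₀, eq_div_iff (nu.pos hden).ne', one_mul] at h'
    exact h'.symm
  have hd3 : ¬ (3 : ℤ) ∣ q.den := by
    intro hd
    have e1 : nu ((q.den : ℤ) : K83) < 1 := nu_int_lt.mpr hd
    rw [Int.cast_natCast, ← hnd, nu_int_lt] at e1
    have : 3 ∣ Nat.gcd q.num.natAbs q.den := Nat.dvd_gcd (by omega) (by omega)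
    rw [hcop] at this
    omega
  have hn3 : ¬ (3 : ℤ) ∣ q.num := by
    intro hd
    rw [← nu_int_lt, hnd, ← Int.cast_natCast, nu_int_lt] at hd
    exact hd3 hd
  have hdn : nu (q.den : K83) = 1 := by rw [← Int.cast_natCast]; exact nu_int hd3
  rw [Near, ← h', hqe, div_sub_div _ _ hy0 hden, map_div₀, map_mul, hy, hdn, one_mul, div_one] at h
  have key : (3 : O83) ∣ X * (q.den : ℤ) - Y * (q.num : ℤ) := by
    rw [← nu_lt_one]; simpa using h
  have hc : ∀ m : ℤ, ¬ 3 ∣ m → ∃ s : ℤ, m = 3 * s + 1 ∨ m = 3 * s - 1 := fun m hm =>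
    ⟨(m + 1) / 3, by omega⟩
  obtain ⟨s, hs⟩ := hc _ hd3
  obtain ⟨t, ht⟩ := hc _ hn3
  obtain ⟨Z, hZ⟩ := key
  rcases hs with hs | hs <;> rcases ht with ht | ht <;> rw [hs, ht] at hZ <;> push_cast at hZ
  · exact h1 ⟨Z - X * s + Y * t, by linear_combination hZ⟩
  · exact h2 ⟨Z - X * s + Y * t, by linear_combination hZ⟩
  · exact h2 ⟨-(Z - X * s + Y * t), by linear_combination -hZ⟩
  · exact h1 ⟨-(Z - X * s + Y * t), by linear_combination -hZ⟩

lemma nu_coeff (n : ℕ) : nu (-(io (E₁ n) + io (E₂ n))) ≤ 1 ∧ nu (io (E₁ n) * io (E₂ n)) ≤ 1 := by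
  constructor
  · rw [nu.map_neg, ← map_add]; exact nu_le_one _
  · rw [← map_mul]; exact nu_le_one _

lemma RL_of_smul {n : ℕ} {P R : (cE n).Point} (hP : InKer nu P) (hR : InKer nu R)
    (hz : zpar P ≠ 0) (hz' : zpar R ≠ 0) {m g : ℤ} (hm0 : m ≠ 0) (e : m • P = g • R) :
    RL (zpar P / zpar R) := by
  obtain ⟨q, hq, h⟩ := zpar_ratio nu_na (nu_coeff n).1 (nu_coeff n).2 (fun _ => nu_le_three)
    nu_three_lt nu_nat hP hR hz hz' hm0 e
  refine ⟨q, hq, ?_⟩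
  have := h.div nu_na (Near.rfl (v := nu) hz')
  rwa [mul_div_cancel_right₀ _ hz'] at this

lemma zpar_ne {n : ℕ} {w V : K83} {h : (cE n).Nonsingular w V} (hw : w ≠ 0) (hV : V ≠ 0) :
    zpar (.some w V h : (cE n).Point) ≠ 0 := div_ne_zero hw hV

/-- The difference of two affine points with the same reduction is in the kernel of reduction. -/
lemma sub_near {n : ℕ} {w V w₀ V₀ : K83} (h : (cE n).Nonsingular w V) (h₀ : (cE n).Nonsingular w₀ V₀)
    (hw : nu w₀ ≤ 1) (hV : nu V₀ = 1) (hw' : nu (w - w₀) < 1) (hne : w ≠ w₀) :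
    ∃ P : (cE n).Point, (P = .some w V h ∨ P = - .some w V h) ∧
      InKer nu (P - .some w₀ V₀ h₀) ∧ zpar (P - .some w₀ V₀ h₀) ≠ 0 ∧
      RL (zpar (P - .some w₀ V₀ h₀) / ((w - w₀) / V₀)) := by
  have main : ∀ V h, nu (V - V₀) < 1 → InKer nu ((.some w V h : (cE n).Point) - .some w₀ V₀ h₀) ∧
      zpar ((.some w V h : (cE n).Point) - .some w₀ V₀ h₀) ≠ 0 ∧
      RL (zpar ((.some w V h : (cE n).Point) - .some w₀ V₀ h₀) / ((w - w₀) / V₀)) := by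
    intro V h hVV
    obtain ⟨h₀', e₀⟩ := neg_some' h₀
    obtain ⟨x₃, y₃, h3, e, ex, ey⟩ := add_of_ne h h₀' hne
    rw [sub_eq_add_neg, e₀, e]
    obtain ⟨ca, cb⟩ := nu_coeff n
    have hw1 : nu w ≤ 1 := by
      rw [← sub_add_cancel w w₀]; exact na_add nu_na hw'.le hw
    have n2 : nu 2 = 1 := by exact_mod_cast nu_nat 2 (by norm_num)
    have nV : Near nu V V₀ := by rw [Near, hV]; exact hVV
    have hs : Near nu (V - -V₀) (2 * V₀) := by
      rw [Near, map_mul, n2, hV, show V - -V₀ - 2 * V₀ = V - V₀ by ring]; simpa using hVV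
    have hd : w - w₀ ≠ 0 := sub_ne_zero.mpr hne
    have hl : Near nu ((V - -V₀) / (w - w₀)) (2 * V₀ / (w - w₀)) := hs.div nu_na (Near.rfl hd)
    set l := (V - -V₀) / (w - w₀) with hl'
    have hl1 : 1 < nu l := by
      rw [hl.eq nu_na, map_div₀, map_mul, n2, hV, lt_div_iff₀ (nu.pos hd)]; simpa using hw'
    have hl0 : l ≠ 0 := hl.ne_left nu_na
    have hx : Near nu x₃ (l ^ 2) := by
      rw [Near, ex, map_pow]
      have : nu (l ^ 2 - -(io (E₁ n) + io (E₂ n)) - w - w₀ - l ^ 2) ≤ 1 := by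
        rw [show l ^ 2 - -(io (E₁ n) + io (E₂ n)) - w - w₀ - l ^ 2 =
          -(-(io (E₁ n) + io (E₂ n))) - w - w₀ by ring]
        exact na_sub nu_na (na_sub nu_na (by rw [nu.map_neg]; exact ca) hw1) hw
      exact this.trans_lt (one_lt_pow₀ hl1 two_ne_zero)
    have hx1 : 1 < nu x₃ := by
      rw [hx.eq nu_na, map_pow]; exact one_lt_pow₀ hl1 two_ne_zero
    have hV1 : nu V = 1 := by rw [nV.eq nu_na, hV]
    have hxw : Near nu (x₃ - w) (l ^ 2) := by
      refine Near.trans nu_na ?_ hx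
      rw [Near, show x₃ - w - x₃ = -w by ring, nu.map_neg]
      exact hw1.trans_lt hx1
    have hy1 : Near nu (l * (x₃ - w)) (l ^ 3) := by
      rw [pow_succ']; exact (Near.rfl hl0).mul nu_na hxw
    have hy : Near nu y₃ (-l ^ 3) := by
      rw [ey]
      refine Near.neg (Near.trans nu_na ?_ hy1)
      rw [Near, add_sub_cancel_left, hV1, hy1.eq nu_na, map_pow]
      exact one_lt_pow₀ hl1 three_ne_zero
    have hz := hx.div nu_na hy
    refine ⟨hx1, hz.ne_left nu_na, ?_⟩
    have hz2 : Near nu (l ^ 2 / -l ^ 3) (-1 * (2 * V₀ / (w - w₀))⁻¹) := by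
      rw [show l ^ 2 / -l ^ 3 = -1 * l⁻¹ by field_simp]
      exact (Near.rfl (by norm_num)).mul nu_na (hl.inv nu_na)
    have hV0 : V₀ ≠ 0 := nV.ne_right
    have hD : (w - w₀) / V₀ ≠ 0 := div_ne_zero hd hV0
    have hz3 := (hz.trans nu_na hz2).div nu_na (Near.rfl (v := nu) hD)
    refine RL.of_near hz3 ?_
    rw [show -1 * (2 * V₀ / (w - w₀))⁻¹ / ((w - w₀) / V₀) = ((-1 / 2 : ℚ) : K83) by
      push_cast; field_simp]
    exact RL.rat (by norm_num)
  have hsq : (V - V₀) * (V + V₀) = (w - w₀) * (w ^ 2 + w * w₀ + w₀ ^ 2 -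
      (io (E₁ n) + io (E₂ n)) * (w + w₀) + io (E₁ n) * io (E₂ n)) := by
    have e := cE_nonsingular.mp h
    have e₀ := cE_nonsingular.mp h₀
    linear_combination e - e₀
  have hw1 : nu w ≤ 1 := by
    rw [← sub_add_cancel w w₀]; exact na_add nu_na hw'.le hw
  obtain ⟨ca, cb⟩ := nu_coeff n
  rw [nu.map_neg] at ca
  have hprod : nu (V - V₀) * nu (V + V₀) < 1 := by
    rw [← map_mul, hsq, map_mul]
    have hle : nu (w ^ 2 + w * w₀ + w₀ ^ 2 -
      (io (E₁ n) + io (E₂ n)) * (w + w₀) + io (E₁ n) * io (E₂ n)) ≤ 1 := by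
      refine na_add nu_na (na_sub nu_na (na_add nu_na (na_add nu_na ?_ ?_) ?_) ?_) cb
      · rw [map_pow]; exact pow_le_one₀ (nu.nonneg _) hw1
      · rw [map_mul]; exact mul_le_one₀ hw1 (nu.nonneg _) hw
      · rw [map_pow]; exact pow_le_one₀ (nu.nonneg _) hw
      · rw [map_mul]; exact mul_le_one₀ ca (nu.nonneg _) (na_add nu_na hw1 hw)
    exact (mul_le_of_le_one_right (nu.nonneg _) hle).trans_lt hw'
  by_cases c : nu (V - V₀) < 1
  · exact ⟨_, Or.inl rfl, main V h c⟩
  · obtain ⟨h', e⟩ := neg_some' h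
    refine ⟨_, Or.inr rfl, ?_⟩
    rw [e]
    apply main
    rw [show -V - V₀ = -(V + V₀) by ring, nu.map_neg]
    by_contra! c'
    push Not at c
    nlinarith

end X166

namespace X166
open Polynomial NumberField

lemma io_poly (a b c : ℤ) : io (a + b * al + c * al ^ 2) = a + b * alK + c * alK ^ 2 := by
  simp [io_al]

lemma io_E₁ (n : ℕ) : io (E₁ n) = (alK - 1) ^ n * (3 + 2 * alK - 2 * alK ^ 2) := by
  have h : E₁ n = (al - 1) ^ n * ((3 : ℤ) + (2 : ℤ) * al + (-2 : ℤ) * al ^ 2) := by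
    rw [E₁, e1, ep]; push_cast; ring
  rw [h, map_mul, map_pow, map_sub, map_one, io_poly, io_al]; push_cast; ring

lemma io_E₂ (n : ℕ) : io (E₂ n) = (alK - 1) ^ n * (2 - alK - alK ^ 2) := by
  have h : E₂ n = (al - 1) ^ n * ((2 : ℤ) + (-1 : ℤ) * al + (-1 : ℤ) * al ^ 2) := by
    rw [E₂, e2, ep]; push_cast; ring
  rw [h, map_mul, map_pow, map_sub, map_one, io_poly, io_al]; push_cast; ring

lemma not_three_dvd (a b c : ℤ) (h : ¬ (3 ∣ a ∧ 3 ∣ b ∧ 3 ∣ c)) :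
    ¬ (3 : O83) ∣ a + b * al + c * al ^ 2 := mt three_dvd.mp h

lemma E_unit {n : ℕ} (hn : n < 2) : nu (io (E₁ n)) = 1 ∧ nu (io (E₂ n)) = 1 := by
  have h := al_rel
  constructor
  · apply nu_eq_one
    obtain rfl | rfl : n = 0 ∨ n = 1 := by omega
    · convert not_three_dvd 3 2 (-2) (by norm_num) using 2
      rw [E₁, e1]; push_cast; ring
    · convert not_three_dvd (-7) 3 2 (by norm_num) using 2
      rw [E₁, e1, ep]; push_cast; linear_combination (-2) * h
  · apply nu_eq_one
    obtain rfl | rfl : n = 0 ∨ n = 1 := by omega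
    · convert not_three_dvd 2 (-1) (-1) (by norm_num) using 2
      rw [E₂, e2]; push_cast; ring
    · convert not_three_dvd (-4) 4 (-1) (by norm_num) using 2
      rw [E₂, e2, ep]; push_cast; linear_combination (-1) * h

lemma dbl {n : ℕ} {x y l w V : K83} (h : (cE n).Nonsingular x y) (hy : y ≠ 0)
    (hl : l * (2 * y) = 3 * x ^ 2 + 2 * (-(io (E₁ n) + io (E₂ n))) * x + io (E₁ n) * io (E₂ n))
    (hw : w = l ^ 2 - -(io (E₁ n) + io (E₂ n)) - 2 * x) (hV : V = -(l * (w - x) + y)) :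
    ∃ h', 2 • (.some x y h : (cE n).Point) = .some w V h' := by
  obtain ⟨x₃, y₃, h₃, e, ex, ey⟩ := two_nsmul_of_ne two_ne_zero h hy
  rw [← hl, mul_div_cancel_right₀ _ (mul_ne_zero two_ne_zero hy)] at ex ey
  obtain rfl : x₃ = w := by rw [ex, hw]
  obtain rfl : y₃ = V := by rw [ey, hV]
  exact ⟨h₃, e⟩

lemma add_T₁_ker {n : ℕ} (hn : n < 2) {w V : K83} (h : (cE n).Nonsingular w V) (hw : w ≠ 0)
    (hV : V ≠ 0) (hw1 : nu w < 1) : InKer nu ((.some w V h : (cE n).Point) + T₁ n) ∧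
      zpar ((.some w V h : (cE n).Point) + T₁ n) = -(w / V) := by
  obtain ⟨x₃, y₃, h₃, e, ex, ey⟩ := add_of_ne h (nonsing_left (n := n)) hw
  rw [T₁, e]
  have hx : x₃ = io (E₁ n) * io (E₂ n) / w := by
    have hVw : V / w * w = V := div_mul_cancel₀ V hw
    rw [ex, eq_div_iff hw, sub_zero, sub_zero, sub_zero]
    apply mul_left_cancel₀ hw
    linear_combination (V / w * w + V) * hVw + cE_nonsingular.mp h
  have hy : y₃ = -(V * x₃ / w) := by
    rw [ey]; field_simp; ring
  obtain ⟨u1, u2⟩ := E_unit hn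
  have hx0 : 1 < nu x₃ := by
    rw [hx, map_div₀, map_mul, u1, u2, lt_div_iff₀ (nu.pos hw)]; simpa using hw1
  refine ⟨hx0, ?_⟩
  have : x₃ ≠ 0 := by
    rintro rfl
    norm_num at hx0
  change x₃ / y₃ = _
  rw [hy]; field_simp

lemma RL_quot {X Y ξ : O83} (hY : ¬ 3 ∣ Y) (hξ : ¬ 3 ∣ ξ) (h : 3 ∣ X - ξ * Y) :
    RL (io X / io Y / io ξ) := by
  have uY := nu_eq_one hY
  have uξ := nu_eq_one hξ
  have hY0 : io Y ≠ 0 := nu.pos_iff.mp (by rw [uY]; norm_num)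
  have hξ0 : io ξ ≠ 0 := nu.pos_iff.mp (by rw [uξ]; norm_num)
  refine ⟨1, one_ne_zero, ?_⟩
  rw [Near, Rat.cast_one, map_one, div_div, div_sub_one (mul_ne_zero hY0 hξ0), map_div₀, map_mul, uY,
    uξ, mul_one, div_one, ← map_mul, ← map_sub, nu_lt_one, mul_comm]
  exact h

lemma nu_poly_eq {w : K83} {X : O83} {d : ℤ} (hX : ¬ 3 ∣ X) (hd : ¬ 3 ∣ d) (h : w = io X / d) :
    nu w = 1 := by
  rw [h, map_div₀, nu_eq_one hX, nu_int hd, div_one]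

/-- The data needed to pin down the reduction kernel up to rational multiples. -/
lemma log_of {n : ℕ} (hn : n < 2) {G : (cE n).Point} (hG : Form G 1 ep) {w V : K83}
    (h : (cE n).Nonsingular w V) {k : ℤ} (hk : k • G = .some w V h) (hk0 : k ≠ 0) {X Y ξ : O83}
    {c d : ℤ} (hX : ¬ 3 ∣ X) (hY : ¬ 3 ∣ Y) (hξ : ¬ 3 ∣ ξ) (hc : ¬ 3 ∣ c) (hd : ¬ 3 ∣ d)
    (hw : w = 9 * (io X / c)) (hV : V = 3 * (io Y / d)) (hXY : 3 ∣ X - ξ * Y) :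
    InKer nu ((2 * k) • G) ∧ ∀ P : (cE n).Point, InKer nu P → zpar P ≠ 0 → RL (zpar P / io ξ) := by
  have nw := nu_poly_eq hX hc rfl
  have nV := nu_poly_eq hY hd rfl
  have n3 := nu_three_lt
  have hw0 : io X / c ≠ 0 := nu.pos_iff.mp (by rw [nw]; norm_num)
  have hV0 : io Y / d ≠ 0 := nu.pos_iff.mp (by rw [nV]; norm_num)
  have hw' : w ≠ 0 := by rw [hw]; exact mul_ne_zero (by norm_num) hw0
  have hV' : V ≠ 0 := by rw [hV]; exact mul_ne_zero (by norm_num) hV0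
  have hw1 : nu w < 1 := by
    rw [hw, map_mul, nw, show (9 : K83) = 3 * 3 by norm_num, map_mul]
    nlinarith [nu_three_pos]
  obtain ⟨k1, k2⟩ := add_T₁_ker hn h hw' hV' hw1
  set R : (cE n).Point := .some w V h + T₁ n with hR
  have hz : zpar R ≠ 0 := by rw [k2]; exact neg_ne_zero.mpr (div_ne_zero hw' hV')
  have hkR : (2 * k) • G = 2 • R := by
    have e : 2 • R = 2 • (k • G) + 2 • T₁ n := by rw [hR, ← hk]; module
    rw [e, (two_nsmul_T n).1]; module
  have hc0 : (c : ℚ) ≠ 0 := by rintro e; exact hc (by rw [Int.cast_eq_zero.mp e]; exact dvd_zero 3)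
  have hd0 : (d : ℚ) ≠ 0 := by rintro e; exact hd (by rw [Int.cast_eq_zero.mp e]; exact dvd_zero 3)
  have hc0' : (c : K83) ≠ 0 := by exact_mod_cast hc0
  have hd0' : (d : K83) ≠ 0 := by exact_mod_cast hd0
  have hzR : RL (zpar R / io ξ) := by
    have h1 := RL_quot hY hξ hXY
    have h2 := (RL.rat (q := -3 * d / c) (div_ne_zero (mul_ne_zero (by norm_num) hd0) hc0)).mul h1
    convert h2 using 1
    rw [k2, hw, hV]
    have : io Y ≠ 0 := by rintro e; simp [e] at hV0
    push_cast
    field_simp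
    ring
  obtain ⟨ca, cb⟩ := nu_coeff n
  refine ⟨?_, ?_⟩
  · rw [hkR, two_nsmul]
    exact (zpar_add nu_na ca cb k1 k1).1
  · intro P hP hzP
    obtain ⟨m, g, hm, e⟩ := exists_odd_smul hn hG P
    have e2 : (2 * m * k) • P = (2 * g) • R := by
      have e3 : (2 * m * k) • P = k • ((2 * m) • P) := by module
      have e4 : k • ((2 * g) • G) = g • ((2 * k) • G) := by module
      rw [e3, e, e4, hkR]; module
    have hm0 : m ≠ 0 := by rintro rfl; simp at hm
    have := RL_of_smul hP k1 hzP hz (by positivity) e2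
    have h3 := this.mul hzR
    rwa [div_mul_div_cancel₀ hz] at h3

lemma poly_ne {x : K83} (X : O83) {d : ℤ} (hX : ¬ 3 ∣ X) (hd : ¬ 3 ∣ d) (h : x = io X / d) : x ≠ 0 :=
  nu.pos_iff.mp (by rw [nu_poly_eq hX hd h]; norm_num)

lemma G0_nonsing : (cE 0).Nonsingular ((4)) ((2) * alK ^ 1 + (2) * alK ^ 2) := by
  have hA := alK_rel
  rw [cE_nonsingular, io_E₁, io_E₂]
  linear_combination ((4) + (-4) * alK ^ 1) * hA

/-- A generator of infinite order. -/
noncomputable def G0 : (cE 0).Point := .some _ _ G0_nonsing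

lemma G1_nonsing : (cE 1).Nonsingular ((-6) + (5) * alK ^ 1) ((8) + (-2) * alK ^ 1 + (-3) * alK ^ 2) := by
  have hA := alK_rel
  rw [cE_nonsingular, io_E₁, io_E₂]
  linear_combination ((-68) + (78) * alK ^ 1 + (-32) * alK ^ 2 + (22) * alK ^ 3 + (-10) * alK ^ 4) * hA

/-- A generator of infinite order. -/
noncomputable def G1 : (cE 1).Point := .some _ _ G1_nonsing

lemma G0_form : Form G0 1 ep := by
  have hA := alK_rel
  refine ⟨_, _, G0_nonsing, rfl, ?_, ⟨(2), ?_, ?_⟩, ⟨(1) + (1) * alK ^ 1, ?_, ?_⟩⟩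
  · exact poly_ne (((0 : ℤ) + (2 : ℤ) * al + (2 : ℤ) * al ^ 2 : O83)) (not_three_dvd _ _ _ (by norm_num)) (d := 1)
      (by norm_num) (by rw [io_poly]; push_cast; ring)
  · exact poly_ne (((2 : ℤ) + (0 : ℤ) * al + (0 : ℤ) * al ^ 2 : O83)) (not_three_dvd _ _ _ (by norm_num)) (d := 1)
      (by norm_num) (by rw [io_poly]; push_cast; ring)
  · rw [map_one]
    linear_combination (0) * hA
  · exact poly_ne (((1 : ℤ) + (1 : ℤ) * al + (0 : ℤ) * al ^ 2 : O83)) (not_three_dvd _ _ _ (by norm_num)) (d := 1)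
      (by norm_num) (by rw [io_poly]; push_cast; ring)
  · rw [io_E₁, show io ep = alK - 1 by simp [ep, io_al]]
    linear_combination ((-1)) * hA

lemma G1_form : Form G1 1 ep := by
  have hA := alK_rel
  refine ⟨_, _, G1_nonsing, rfl, ?_, ⟨(2) * alK ^ 1 + (-1) * alK ^ 2, ?_, ?_⟩, ⟨(1) + (-1) * alK ^ 1, ?_, ?_⟩⟩
  · exact poly_ne (((8 : ℤ) + (-2 : ℤ) * al + (-3 : ℤ) * al ^ 2 : O83)) (not_three_dvd _ _ _ (by norm_num)) (d := 1)
      (by norm_num) (by rw [io_poly]; push_cast; ring)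
  · exact poly_ne (((0 : ℤ) + (2 : ℤ) * al + (-1 : ℤ) * al ^ 2 : O83)) (not_three_dvd _ _ _ (by norm_num)) (d := 1)
      (by norm_num) (by rw [io_poly]; push_cast; ring)
  · rw [map_one]
    linear_combination ((3) + (-1) * alK ^ 1) * hA
  · exact poly_ne (((1 : ℤ) + (-1 : ℤ) * al + (0 : ℤ) * al ^ 2 : O83)) (not_three_dvd _ _ _ (by norm_num)) (d := 1)
      (by norm_num) (by rw [io_poly]; push_cast; ring)
  · rw [io_E₁, show io ep = alK - 1 by simp [ep, io_al]]
    linear_combination ((1)) * hA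

lemma two_G0 : ∃ h', 2 • G0 = (.some ((-99/200) + (387/400) * alK ^ 1 + (279/400) * alK ^ 2) ((-7917/4000) + (46821/8000) * alK ^ 1 + (-28443/8000) * alK ^ 2) h' : (cE 0).Point) := by
  have hA := alK_rel
  refine dbl (l := (3/10) + (31/20) * alK ^ 1 + (7/20) * alK ^ 2) _ ?_ ?_ ?_ ?_
  · exact poly_ne (((0 : ℤ) + (2 : ℤ) * al + (2 : ℤ) * al ^ 2 : O83)) (not_three_dvd _ _ _ (by norm_num)) (d := 1) (by norm_num)
      (by rw [io_poly]; push_cast; ring)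
  · rw [io_E₁, io_E₂]
    linear_combination ((7) + (-3/5) * alK ^ 1) * hA
  · rw [io_E₁, io_E₂]
    linear_combination ((-483/400) + (-49/400) * alK ^ 1) * hA
  · linear_combination ((13311/8000) + (1953/8000) * alK ^ 1) * hA

lemma two_G1 : ∃ h', 2 • G1 = (.some ((23/16) + (13/16) * alK ^ 1 + (21/16) * alK ^ 2) ((385/64) + (195/64) * alK ^ 1 + (15/64) * alK ^ 2) h' : (cE 1).Point) := by
  have hA := alK_rel
  refine dbl (l := (-5/4) + (-5/4) * alK ^ 1 + (1/4) * alK ^ 2) _ ?_ ?_ ?_ ?_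
  · exact poly_ne (((8 : ℤ) + (-2 : ℤ) * al + (-3 : ℤ) * al ^ 2 : O83)) (not_three_dvd _ _ _ (by norm_num)) (d := 1) (by norm_num)
      (by rw [io_poly]; push_cast; ring)
  · rw [io_E₁, io_E₂]
    linear_combination ((37) + (-41/2) * alK ^ 1 + (2) * alK ^ 2 + (-2) * alK ^ 3) * hA
  · rw [io_E₁, io_E₂]
    linear_combination ((57/16) + (-1/16) * alK ^ 1) * hA
  · linear_combination ((-151/64) + (21/64) * alK ^ 1) * hA

lemma two_two_G1 (h : (cE 1).Nonsingular ((23/16) + (13/16) * alK ^ 1 + (21/16) * alK ^ 2) ((385/64) + (195/64) * alK ^ 1 + (15/64) * alK ^ 2)) : ∃ h', 2 • (.some _ _ h : (cE 1).Point) = (.some ((-1108524130533/58935053120) + (3984446675421/294675265600) * alK ^ 1 + (302309712837/294675265600) * alK ^ 2) ((-4960374412868770641/159961521178304000) + (-5505825576243322803/159961521178304000) * alK ^ 1 + (6887125570247590209/159961521178304000) * alK ^ 2) h' : (cE 1).Point) := by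
  have hA := alK_rel
  refine dbl (l := (931553/542840) + (-1093479/542840) * alK ^ 1 + (1280027/542840) * alK ^ 2) _ ?_ ?_ ?_ ?_
  · exact poly_ne (((385 : ℤ) + (195 : ℤ) * al + (15 : ℤ) * al ^ 2 : O83)) (not_three_dvd _ _ _ (by norm_num)) (d := 64) (by norm_num)
      (by rw [io_poly]; push_cast; ring)
  · rw [io_E₁, io_E₂]
    linear_combination ((5148483/1737088) + (1017793/217136) * alK ^ 1 + (-47/8) * alK ^ 2 + (-2) * alK ^ 3) * hA
  · rw [io_E₁, io_E₂]
    linear_combination ((2044921963937/294675265600) + (-1638469120729/294675265600) * alK ^ 1) * hA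
  · linear_combination ((4777976311847411143/159961521178304000) + (-108100293969118101/159961521178304000) * alK ^ 1) * hA

lemma log_0 : InKer nu ((2 * 2 : ℤ) • G0) ∧ ∀ P : (cE 0).Point, InKer nu P → zpar P ≠ 0 →
    RL (zpar P / io ((2 : ℤ) + (1 : ℤ) * al + (2 : ℤ) * al ^ 2 : O83)) := by
  obtain ⟨h, e⟩ := two_G0
  refine log_of (by norm_num) G0_form h (k := 2) ?_ (by norm_num) (X := ((-22 : ℤ) + (43 : ℤ) * al + (31 : ℤ) * al ^ 2 : O83))
    (Y := ((-5278 : ℤ) + (15607 : ℤ) * al + (-9481 : ℤ) * al ^ 2 : O83)) (c := 400) (d := 8000)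
    (not_three_dvd _ _ _ (by norm_num)) (not_three_dvd _ _ _ (by norm_num))
    (not_three_dvd _ _ _ (by norm_num)) (by norm_num) (by norm_num) ?_ ?_ ?_
  · rw [← e]; module
  · rw [io_poly]; push_cast; ring
  · rw [io_poly]; push_cast; ring
  · refine ⟨(1664) + (4934) * al ^ 1 + (-2597) * al ^ 2, ?_⟩
    push_cast
    linear_combination ((-2771) + (18962) * al ^ 1) * al_rel

lemma log_1 : InKer nu ((2 * 4 : ℤ) • G1) ∧ ∀ P : (cE 1).Point, InKer nu P → zpar P ≠ 0 →
    RL (zpar P / io ((2 : ℤ) + (2 : ℤ) * al + (1 : ℤ) * al ^ 2 : O83)) := by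
  obtain ⟨h₂, e₂⟩ := two_G1
  obtain ⟨h, e⟩ := two_two_G1 h₂
  refine log_of (by norm_num) G1_form h (k := 4) ?_ (by norm_num) (X := ((-615846739185 : ℤ) + (442716297269 : ℤ) * al + (33589968093 : ℤ) * al ^ 2 : O83))
    (Y := ((-1653458137622923547 : ℤ) + (-1835275192081107601 : ℤ) * al + (2295708523415863403 : ℤ) * al ^ 2 : O83)) (c := 294675265600) (d := 159961521178304000)
    (not_three_dvd _ _ _ (by norm_num)) (not_three_dvd _ _ _ (by norm_num))
    (not_three_dvd _ _ _ (by norm_num)) (by norm_num) (by norm_num) ?_ ?_ ?_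
  · rw [← e, ← e₂]; module
  · rw [io_poly]; push_cast; ring
  · rw [io_poly]; push_cast; ring
  · refine ⟨(-2265595032311285769) + (2479300144486371789) * al ^ 1 + (-674516782069079723) * al ^ 2, ?_⟩
    push_cast
    linear_combination ((-5051850378166482608) + (-2295708523415863403) * al ^ 1) * al_rel

end X166

namespace X166
open Polynomial NumberField

/-- The quadratic cofactor of the linear factor `T - θ S`. -/
noncomputable def quadCo (T S : K83) : K83 :=
  T ^ 2 + (-alK - alK ^ 2) * T * S + (3 * alK ^ 2 - alK - 1) * S ^ 2

lemma exists_pt {n : ℕ} {T S Y D A : K83} (hD : D ≠ 0) (hA : A ≠ 0) (hD2 : D ^ 2 = T ^ 2 - 4 * S ^ 2)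
    (hTS : T - (-alK - alK ^ 2) * S = (alK - 1) ^ n * A ^ 2)
    (hY : Y ^ 2 = (T - (-alK - alK ^ 2) * S) * quadCo T S) :
    4 * (alK - 1) ^ n * quadCo T S / D ^ 2 = (2 * Y / (A * D)) ^ 2 ∧
    (∃ c, 4 * (alK - 1) ^ n * quadCo T S / D ^ 2 - io (E₁ n) = (alK - 1) ^ (n + 1) * c ^ 2) ∧
    ∃ V, (cE n).Nonsingular (4 * (alK - 1) ^ n * quadCo T S / D ^ 2) V := by
  have hα := alK_rel
  have hw : 4 * (alK - 1) ^ n * quadCo T S / D ^ 2 = (2 * Y / (A * D)) ^ 2 := by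
    rw [div_pow, mul_pow, mul_pow, hY, hTS]
    field_simp
    ring
  set δ := (alK - 1) ^ n with hδ
  have h1 : 4 * δ * quadCo T S / D ^ 2 - io (E₁ n) =
      δ * ((1) + (-2) * alK ^ 1 + (2) * alK ^ 2) * ((T - ((8/5) + (-2/5) * alK ^ 1 + (6/5) * alK ^ 2) * S) / D) ^ 2 := by
    rw [io_E₁, ← hδ, div_pow]
    field_simp
    rw [hD2, quadCo]
    linear_combination (25 * δ * (((-8/5) + (24/5) * alK ^ 1) * T * S + ((-68/25) + (-164/25) * alK ^ 1 + (48/25) * alK ^ 2 + (-72/25) * alK ^ 3) * S ^ 2)) * hα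
  have h2 : 4 * δ * quadCo T S / D ^ 2 - io (E₂ n) =
      δ * ((2) + (1) * alK ^ 1 + (1) * alK ^ 2) * ((T - ((-1) + (3) * alK ^ 1 + (-1) * alK ^ 2) * S) / D) ^ 2 := by
    rw [io_E₂, ← hδ, div_pow]
    field_simp
    rw [hD2, quadCo]
    linear_combination (δ * (((2) + (-2) * alK ^ 1) * T * S + ((-1) + (-2) * alK ^ 1 + (4) * alK ^ 2 + (-1) * alK ^ 3) * S ^ 2)) * hα
  have hκ : ((1) + (-2) * alK ^ 1 + (2) * alK ^ 2) * ((2) + (1) * alK ^ 1 + (1) * alK ^ 2) = ((1) * alK ^ 1 + (1) * alK ^ 2) ^ 2 := by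
    linear_combination ((-1) + (1) * alK ^ 1) * hα
  refine ⟨hw, ⟨(1 + alK) * ((T - ((8/5) + (-2/5) * alK ^ 1 + (6/5) * alK ^ 2) * S) / D), ?_⟩, 2 * Y / (A * D) * δ * ((1) * alK ^ 1 + (1) * alK ^ 2) *
    ((T - ((8/5) + (-2/5) * alK ^ 1 + (6/5) * alK ^ 2) * S) / D) * ((T - ((-1) + (3) * alK ^ 1 + (-1) * alK ^ 2) * S) / D), ?_⟩
  · have hf : ((1) + (-2) * alK ^ 1 + (2) * alK ^ 2) = (alK - 1) * (1 + alK) ^ 2 := by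
      linear_combination ((-1)) * hα
    rw [h1, hf, pow_succ]; ring
  · rw [cE_nonsingular, h1, h2, hw]
    linear_combination (-(2 * Y / (A * D) * δ * ((T - ((8/5) + (-2/5) * alK ^ 1 + (6/5) * alK ^ 2) * S) / D) * ((T - ((-1) + (3) * alK ^ 1 + (-1) * alK ^ 2) * S) / D)) ^ 2) * hκ

end X166

namespace X166
open Polynomial NumberField

lemma quadCo_int (T S : ℤ) : quadCo (T : K83) S =
    io ((T ^ 2 - S ^ 2 : ℤ) + (-(T * S) - S ^ 2 : ℤ) * al + (3 * S ^ 2 - T * S : ℤ) * al ^ 2) := by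
  rw [io_poly, quadCo]; push_cast; ring

lemma io_th : io th = -alK - alK ^ 2 := by
  rw [th, map_sub, map_neg, map_pow, io_al]

lemma io_ep : io ep = alK - 1 := by rw [ep, map_sub, map_one, io_al]

lemma pt_of_class {n : ℕ} {T S D Y : ℤ} {r : O83} (hD : D ≠ 0) (hr0 : r ≠ 0)
    (hD2 : D ^ 2 = T ^ 2 - 4 * S ^ 2) (hF : T ^ 3 - 7 * T * S ^ 2 + 10 * S ^ 3 = Y ^ 2)
    (hr : (T - th * S : O83) = ep ^ n * r ^ 2) :
    (∃ c : K83, 4 * (alK - 1) ^ n * quadCo T S / D ^ 2 = c ^ 2) ∧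
    (∃ c : K83, 4 * (alK - 1) ^ n * quadCo T S / D ^ 2 - io (E₁ n) = (alK - 1) ^ (n + 1) * c ^ 2) ∧
    ∃ V, (cE n).Nonsingular (4 * (alK - 1) ^ n * quadCo T S / D ^ 2) V := by
  have hα := alK_rel
  have hTS := congrArg io hr
  rw [map_mul, map_sub, map_mul, map_pow, map_pow, map_intCast, map_intCast, io_th, io_ep] at hTS
  have hY : (Y : K83) ^ 2 = (T - (-alK - alK ^ 2) * S) * quadCo T S := by
    have h : ((T ^ 3 - 7 * T * S ^ 2 + 10 * S ^ 3 : ℤ) : K83) = ((Y ^ 2 : ℤ) : K83) := by rw [hF]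
    push_cast at h
    rw [← h, quadCo]
    linear_combination (((3) + (1) * alK ^ 1) * T * S ^ 2 + ((-5) + (-3) * alK ^ 1) * S ^ 3) * hα
  obtain ⟨h1, h2, h3⟩ := exists_pt (D := (D : K83)) (by exact_mod_cast hD) (io_ne.mpr hr0)
    (by exact_mod_cast congrArg (Int.cast : ℤ → K83) hD2) hTS hY
  exact ⟨⟨_, h1⟩, h2, h3⟩

lemma nu_ep_pow (n : ℕ) : nu ((alK - 1) ^ n) = 1 := by
  have : nu (io ep) = 1 := nu_eq_one (by
    have := not_three_dvd (-1) 1 0 (by norm_num)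
    convert this using 1
    rw [ep]; push_cast; ring)
  rw [map_pow, ← io_ep, this, one_pow]

lemma nu_four : nu 4 = 1 := by exact_mod_cast nu_nat 4 (by norm_num)

lemma not_case_unit {n : ℕ} (hn : n < 2) {T S D Y : ℤ} {r : O83} (hD : D ≠ 0) (hr0 : r ≠ 0)
    (hD2 : D ^ 2 = T ^ 2 - 4 * S ^ 2) (hF : T ^ 3 - 7 * T * S ^ 2 + 10 * S ^ 3 = Y ^ 2)
    (hr : (T - th * S : O83) = ep ^ n * r ^ 2) (hT : T % 3 = 2) (hS : ¬ 3 ∣ S) (hD3 : 3 ∣ D) :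
    False := by
  obtain ⟨⟨c, hc⟩, ⟨c', hc'⟩, V, hV⟩ := pt_of_class hD hr0 hD2 hF hr
  have hcong : (T ^ 2 - S ^ 2) % 3 = 0 ∧ ((-(T * S) - S ^ 2) % 3 = 0 ∧ (3 * S ^ 2 - T * S) % 3 = 1 ∨
      (-(T * S) - S ^ 2) % 3 = 1 ∧ (3 * S ^ 2 - T * S) % 3 = 2) := by
    obtain ⟨t, rfl⟩ : ∃ t, T = 3 * t + 2 := ⟨T / 3, by omega⟩
    obtain ⟨s, rfl | rfl⟩ : ∃ s, S = 3 * s + 1 ∨ S = 3 * s + 2 := ⟨S / 3, by omega⟩ <;> ring_nf <;> omega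
  set w := 4 * (alK - 1) ^ n * quadCo (T : K83) S / D ^ 2 with hw
  have hq : nu (quadCo (T : K83) S) = 1 := by
    rw [quadCo_int]
    exact nu_eq_one (not_three_dvd _ _ _ (by omega))
  have hDK : (D : K83) ≠ 0 := by exact_mod_cast hD
  have hw1 : 1 < nu w := by
    rw [hw, map_div₀, map_mul, map_mul, nu_four, nu_ep_pow, hq, map_pow, one_mul, one_mul,
      lt_div_iff₀ (pow_pos (nu.pos hDK) 2), one_mul]
    exact pow_lt_one₀ (nu.nonneg _) (nu_int_lt.mpr hD3) two_ne_zero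
  obtain ⟨ca, cb⟩ := nu_coeff n
  have heq : V ^ 2 = w ^ 3 + -(io (E₁ n) + io (E₂ n)) * w ^ 2 + io (E₁ n) * io (E₂ n) * w := by
    linear_combination cE_nonsingular.mp hV
  obtain ⟨b1, b2, b3, b4, b5⟩ := big_point nu_na ca cb heq hw1
  have hw0 : w ≠ 0 := by rintro h; rw [h] at hw1; norm_num at hw1
  have hker : InKer nu (.some w V hV : (cE n).Point) := hw1
  obtain rfl | rfl : n = 0 ∨ n = 1 := by omega
  · have hform : Form (.some w V hV : (cE 0).Point) 1 ep := by
      refine ⟨w, V, hV, rfl, b1, ⟨c, ?_, by rw [map_one, one_mul, hc]⟩, ⟨c', ?_, ?_⟩⟩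
      · rintro rfl; apply hw0; rw [hc]; ring
      · rintro rfl
        have h0 := cE_nonsingular.mp hV
        rw [hc'] at h0
        apply b1
        apply pow_eq_zero_iff (two_ne_zero) |>.mp
        rw [h0]; ring
      · rw [hc', io_ep, zero_add, pow_one]
    set P : (cE 0).Point := .some w V hV with hP
    have h4 := log_0.1
    have hG1 : ¬ InKer nu G0 := by
      intro h
      have h : 1 < nu ((4 : K83)) := by
        have h : 1 < nu (((4) : K83)) := h
        exact h
      rw [nu_four] at h
      exact lt_irrefl _ h
    have hcl : ∀ A B : (cE 0).Point, InKer nu A → InKer nu B → InKer nu (A + B) := fun A B hA hB =>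
      (zpar_add nu_na ca cb hA hB).1
    let Kr : AddSubgroup (cE 0).Point :=
      { carrier := {A | InKer nu A}
        zero_mem' := trivial
        add_mem' := fun {A B} hA hB => hcl A B hA hB
        neg_mem' := fun {A} hA => InKer.neg hA }
    have hPK : P ∈ Kr := hker
    have hGK : (4 : ℤ) • G0 ∈ Kr := by
      have : (4 : ℤ) • G0 = (2 * 2 : ℤ) • G0 := by norm_num
      rw [this]; exact h4
    have hodd : ∀ m g : ℤ, Odd g → m • P = g • G0 → False := by
      intro m g hg e
      have h1 : g • G0 ∈ Kr := by rw [← e]; exact Kr.zsmul_mem hPK m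
      apply hG1
      have : G0 ∈ Kr := by
        obtain ⟨s, hs | hs⟩ : ∃ s, g = 4 * s + 1 ∨ g = 4 * s - 1 := by
          obtain ⟨k, rfl⟩ := hg
          exact ⟨(k + 1) / 2, by omega⟩
        · have e : G0 = g • G0 - s • ((4 : ℤ) • G0) := by rw [hs]; module
          rw [e]
          exact Kr.sub_mem h1 (Kr.zsmul_mem hGK s)
        · have e : G0 = s • ((4 : ℤ) • G0) - g • G0 := by rw [hs]; module
          rw [e]
          exact Kr.sub_mem (Kr.zsmul_mem hGK s) h1
      exact this
    have hG2 : (2 : ℤ) • G0 ∉ Kr := by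
      intro h
      obtain ⟨h', e⟩ := two_G0
      have e' : (2 : ℤ) • G0 = 2 • G0 := by module
      rw [e', e] at h
      have h : 1 < nu _ := h
      have hle : nu (9 * (io (((-22 : ℤ) + (43 : ℤ) * al + (31 : ℤ) * al ^ 2 : O83)) / (400 : ℤ))) ≤ 1 := by
        rw [map_mul, map_div₀, nu_int (m := 400) (by norm_num), div_one,
          show (9 : K83) = io ((9 : ℤ) : O83) by rw [map_intCast]; norm_num]
        exact mul_le_one₀ (nu_le_one _) (nu.nonneg _) (nu_le_one _)
      refine absurd h (not_lt.mpr (le_trans (le_of_eq ?_) hle))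
      congr 1
      rw [io_poly]; push_cast; ring
    let L : AddSubgroup (cE 0).Point :=
      { carrier := {A | (2 : ℤ) • A ∈ Kr}
        zero_mem' := by
          have e : (2 : ℤ) • (0 : (cE 0).Point) = 0 := by module
          change (2 : ℤ) • (0 : (cE 0).Point) ∈ Kr
          rw [e]; exact Kr.zero_mem
        add_mem' := by
          intro A B hA hB
          have e : (2 : ℤ) • (A + B) = (2 : ℤ) • A + (2 : ℤ) • B := by module
          change (2 : ℤ) • (A + B) ∈ Kr
          rw [e]; exact Kr.add_mem hA hB
        neg_mem' := by
          intro A hA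
          have e : (2 : ℤ) • (-A) = -((2 : ℤ) • A) := by module
          change (2 : ℤ) • (-A) ∈ Kr
          rw [e]; exact Kr.neg_mem hA }
    have hT : ∀ A : (cE 0).Point, 2 • A = 0 → A ∈ L := by
      intro A hA
      have e : (2 : ℤ) • A = 2 • A := by module
      change (2 : ℤ) • A ∈ Kr
      rw [e, hA]; exact Kr.zero_mem
    obtain ⟨t1, t2, t3⟩ := two_nsmul_T 0
    have hsum := Form.add_gen (hT _ t1) (hT _ t2) (hT _ t3) (P := G0) (G := P)
      (Kr.zsmul_mem hPK 2) hG2 G0_form hform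
    have hsum1 : Form (G0 + P) 1 1 := by
      obtain ⟨x, y, h, e, hy, h1, h2⟩ := hsum
      exact ⟨x, y, h, e, hy, h1.of_mul_sq one_ne_zero (by ring), h2.of_mul_sq ep_ne (by ring)⟩
    obtain ⟨R, hR⟩ := double_of_form_one hsum1
    obtain ⟨m, g, hm, e⟩ := exists_odd_smul (by norm_num) G0_form R
    refine hodd m (2 * g - m) ?_ ?_
    · obtain ⟨k, rfl⟩ := hm
      exact ⟨g - k - 1, by ring⟩
    · have e1 : (2 * m) • R = m • (G0 + P) := by rw [hR]; module
      have e2 : m • P = m • (G0 + P) - m • G0 := by module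
      rw [e2, ← e1, e]; module
  · have hz : zpar (.some w V hV : (cE 1).Point) ≠ 0 := zpar_ne hw0 b1
    have h := log_1.2 _ hker hz
    set ξ : O83 := (((2 : ℤ) + (2 : ℤ) * al + (1 : ℤ) * al ^ 2 : O83)) with hξ
    have hξ0 : io ξ ≠ 0 := by
      have := nu_eq_one (not_three_dvd 2 2 1 (by norm_num))
      exact nu.pos_iff.mp (by rw [hξ, this]; norm_num)
    have hq0 : quadCo (T : K83) S ≠ 0 := nu.pos_iff.mp (by rw [hq]; norm_num)
    have he0 : alK - 1 ≠ 0 := nu.pos_iff.mp (by rw [← pow_one (alK - 1), nu_ep_pow]; norm_num)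
    have hnear : Near nu ((w / V) ^ 2) (w⁻¹) := by
      have := (Near.rfl (v := nu) (pow_ne_zero 2 hw0)).div nu_na (near_sq_cube nu_na ca cb heq hw1)
      rw [div_pow]
      rwa [show w ^ 2 / w ^ 3 = w⁻¹ by field_simp] at this
    have h2 : RL ((w / V) ^ 2 / io ξ ^ 2) := by
      have := h.mul h
      rwa [← pow_two, div_pow] at this
    have h3 : RL (w⁻¹ / io ξ ^ 2) := RL.of_near
      ((hnear.symm nu_na).div nu_na (Near.rfl (pow_ne_zero 2 hξ0))) h2
    have h4 := h3.inv.mul (RL.rat (q := D ^ 2 / 4) (by positivity))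
    have h5 : (w⁻¹ / io ξ ^ 2)⁻¹ * ((D ^ 2 / 4 : ℚ) : K83) = (alK - 1) * quadCo (T : K83) S * io ξ ^ 2 := by
      rw [hw]
      push_cast
      field_simp
    rw [h5] at h4
    rw [quadCo_int] at h4
    generalize T ^ 2 - S ^ 2 = a at *
    generalize -(T * S) - S ^ 2 = b at *
    generalize 3 * S ^ 2 - T * S = d at *
    have h6 : (alK - 1) * io (a + b * al + d * al ^ 2) * io ξ ^ 2 =
        io ((10 * a + 10 * b + 4 * d : ℤ) + (-3 * a + 5 * b + 8 * d : ℤ) * al +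
          (5 * a + 2 * b + 7 * d : ℤ) * al ^ 2) / io ((1 : ℤ) + (0 : ℤ) * al + (0 : ℤ) * al ^ 2) := by
      have hα := alK_rel
      rw [hξ]
      simp only [io_poly]
      push_cast
      rw [zero_mul, zero_mul, add_zero, add_zero, div_one]
      linear_combination (((7) + (4) * alK ^ 1 + (1) * alK ^ 2) * a + ((5) + (7) * alK ^ 1 + (4) * alK ^ 2 + (1) * alK ^ 3) * b + ((2) + (5) * alK ^ 1 + (7) * alK ^ 2 + (4) * alK ^ 3 + (1) * alK ^ 4) * d) * hα
    rw [h6] at h4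
    have e1 : ∀ (X1 X2 X3 : ℤ), ¬ (3 ∣ X2 ∧ 3 ∣ X3) → ¬ RL (io (X1 + X2 * al + X3 * al ^ 2) /
        io ((1 : ℤ) + (0 : ℤ) * al + (0 : ℤ) * al ^ 2)) := by
      intro X1 X2 X3 hX
      apply not_RL_div
      · exact not_three_dvd _ _ _ (by omega)
      · exact not_three_dvd _ _ _ (by omega)
      · convert not_three_dvd (X1 - 1) X2 X3 (by omega) using 2
        push_cast; ring
      · convert not_three_dvd (X1 + 1) X2 X3 (by omega) using 2
        push_cast; ring
    exact e1 _ _ _ (by omega) h4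

lemma not_case_div {T S D Y : ℤ} {n : ℕ} (hn : n < 2) {r : O83} (hD : D ≠ 0) (hr0 : r ≠ 0)
    (hD2 : D ^ 2 = T ^ 2 - 4 * S ^ 2) (hF : T ^ 3 - 7 * T * S ^ 2 + 10 * S ^ 3 = Y ^ 2)
    (hr : (T - th * S : O83) = ep ^ n * r ^ 2) (hT : ¬ 3 ∣ T) (hS : 3 ∣ S) (hS0 : S ≠ 0)
    (hTS : 10 * S + 3 * T ≠ 0) : False := by
  obtain ⟨⟨c, hc⟩, ⟨c', hc'⟩, V, hV⟩ := pt_of_class hD hr0 hD2 hF hr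
  have hα := alK_rel
  have hDK : (D : K83) ≠ 0 := by exact_mod_cast hD
  have hDQ : (D : ℚ) ≠ 0 := by exact_mod_cast hD
  have hD3 : ¬ 3 ∣ D := by
    intro h
    have h1 : 3 ∣ T ^ 2 := by
      rw [show T ^ 2 = D * D + 4 * S * S by linear_combination -hD2]
      exact dvd_add (dvd_mul_of_dvd_left h _) (dvd_mul_of_dvd_right hS _)
    exact hT (Int.prime_three.dvd_of_dvd_pow h1)
  have hDn := nu_int hD3
  have hD2K : (D : K83) ^ 2 = T ^ 2 - 4 * S ^ 2 := by exact_mod_cast congrArg (Int.cast : ℤ → K83) hD2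
  have hTn := nu_int hT
  have hSn := nu_int_lt.mpr hS
  have hth : nu (io th) = 1 := by
    apply nu_eq_one
    convert not_three_dvd 0 (-1) (-1) (by norm_num) using 2
    rw [th]; push_cast; ring
  have hth0 : io th ≠ 0 := nu.pos_iff.mp (by rw [hth]; norm_num)
  have hT0 : (T : K83) ≠ 0 := nu.pos_iff.mp (by rw [hTn]; norm_num)
  have hTQ : (T : ℚ) ≠ 0 := by rintro h; apply hT; rw [Int.cast_eq_zero.mp h]; exact dvd_zero 3
  have hB : ∀ B X : O83, B - th * T = 3 * X → Near nu (io B) (io th * T) := by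
    intro B X h
    rw [Near, map_mul, hth, hTn, one_mul, ← map_intCast io, ← map_mul, ← map_sub, nu_lt_one]
    exact ⟨X, h⟩
  obtain ⟨s, hs⟩ := hS
  have fin : ∀ (w₀ V₀ : K83) (h₀ : (cE n).Nonsingular w₀ V₀) (ξ : O83), (∀ P : (cE n).Point, InKer nu P → zpar P ≠ 0 → RL (zpar P / io ξ)) →
      nu w₀ ≤ 1 → nu V₀ = 1 → ∀ (a : ℚ) (B X : O83), a ≠ 0 → B - th * T = 3 * X → nu (a : K83) < 1 →
      4 * (alK - 1) ^ n * quadCo T S / D ^ 2 - w₀ = a * (alK - 1) ^ n * io B →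
      RL (io th * (alK - 1) ^ n / (V₀ * io ξ)) := by
    intro w₀ V₀ h₀ ξ hlog hw₀ hV₀ a B X ha hBX ha1 hw
    have hnear := hB B X hBX
    have hB0 := hnear.ne_left nu_na
    have he0 : (alK - 1) ^ n ≠ 0 := nu.pos_iff.mp (by rw [nu_ep_pow]; norm_num)
    have haK : (a : K83) ≠ 0 := by exact_mod_cast ha
    have hne0 : (a : K83) * (alK - 1) ^ n * io B ≠ 0 := mul_ne_zero (mul_ne_zero haK he0) hB0
    obtain ⟨P, -, h1, h2, h3⟩ := sub_near hV h₀ hw₀ hV₀ (by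
      rw [hw, map_mul, map_mul, nu_ep_pow, mul_one]
      exact (mul_le_of_le_one_right (nu.nonneg _) (nu_le_one _)).trans_lt ha1)
      (fun h => hne0 (by rw [← hw, h, sub_self]))
    have h4 := hlog _ h1 h2
    have h5 := h4.div h3
    rw [hw] at h5
    have hV0 : V₀ ≠ 0 := nu.pos_iff.mp (by rw [hV₀]; norm_num)
    have h6 : RL (io B * (alK - 1) ^ n / (V₀ * io ξ)) := by
      have := h5.mul (RL.rat (q := a⁻¹) (inv_ne_zero ha))
      convert this using 1
      push_cast
      field_simp
    have hξ0 : io ξ ≠ 0 := by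
      intro h
      obtain ⟨q, hq, h'⟩ := h4
      have := h'.ne_left nu_na
      rw [h, div_zero] at this
      exact this rfl
    have h7 := (hnear.symm nu_na).mul nu_na (Near.rfl (v := nu) (x := (alK - 1) ^ n / (V₀ * io ξ))
      (div_ne_zero he0 (mul_ne_zero hV0 hξ0)))
    rw [← mul_div_assoc, ← mul_div_assoc] at h7
    have h8 := (RL.of_near h7 h6).mul (RL.rat (q := (T : ℚ)⁻¹) (inv_ne_zero hTQ))
    convert h8 using 1
    push_cast
    field_simp
  have hsK : (S : K83) = 3 * s := by exact_mod_cast congrArg (Int.cast : ℤ → K83) hs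
  have hsO : (S : O83) = 3 * s := by rw [hs]; push_cast; ring
  obtain rfl | rfl : n = 0 ∨ n = 1 := by omega
  · have h := fin _ _ G0_nonsing _ log_0.2 (by simpa using nu_four.le)
      ?_ (4 * S / D ^ 2) (th * T + ((3 : ℤ) + (-1 : ℤ) * al + (3 : ℤ) * al ^ 2) * S)
      (((3 : ℤ) + (-1 : ℤ) * al + (3 : ℤ) * al ^ 2) * s)
      (div_ne_zero (mul_ne_zero (by norm_num) (by exact_mod_cast hS0)) (pow_ne_zero 2 hDQ))
      (by rw [hsO]; ring) ?_ ?_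
    · refine not_RL_div (X := (0 : ℤ) + (-1 : ℤ) * al + (-1 : ℤ) * al ^ 2)
        (Y := (20 : ℤ) + (2 : ℤ) * al + (12 : ℤ) * al ^ 2) (not_three_dvd _ _ _ (by norm_num))
        (not_three_dvd _ _ _ (by norm_num)) ?_ ?_ ?_
      · convert not_three_dvd (-20) (-3) (-13) (by norm_num) using 2
        push_cast; ring
      · convert not_three_dvd 20 1 11 (by norm_num) using 2
        push_cast; ring
      · convert h using 1
        rw [io_th]
        simp only [io_poly]
        congr 1
        · push_cast; ring
        · push_cast; linear_combination ((-10) + (-4) * alK ^ 1) * hα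
    · exact nu_poly_eq (X := (0 : ℤ) + (2 : ℤ) * al + (2 : ℤ) * al ^ 2) (d := 1)
        (not_three_dvd _ _ _ (by norm_num)) (by norm_num) (by rw [io_poly]; push_cast; ring)
    · push_cast
      rw [map_div₀, map_mul, nu_four, map_pow, hDn]
      simpa using hSn
    · rw [map_add, map_mul, map_mul, map_intCast, map_intCast, io_poly, io_th]
      push_cast
      field_simp
      rw [hD2K, quadCo]
      ring
  · obtain ⟨h', e⟩ := two_G1
    have h := fin _ _ h' _ log_1.2 ?_
      ?_ ((10 * S + 3 * T) / (16 * D ^ 2)) ((10 : ℤ) * th * T +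
        ((3 : ℤ) + (-1 : ℤ) * al + (3 : ℤ) * al ^ 2) * ((10 * S - 3 * T : ℤ) : O83) - (12 : ℤ) * th * S)
      (3 * th * T + ((3 : ℤ) + (-1 : ℤ) * al + (3 : ℤ) * al ^ 2) * (10 * s - T) - (12 : ℤ) * th * s)
      (div_ne_zero (by exact_mod_cast hTS) (mul_ne_zero (by norm_num) (pow_ne_zero 2 hDQ)))
      (by push_cast; rw [hsO]; ring) ?_ ?_
    · refine not_RL_div (X := (-2 : ℤ) + (2 : ℤ) * al + (-1 : ℤ) * al ^ 2)
        (Y := (1250 : ℤ) + (950 : ℤ) * al + (1030 : ℤ) * al ^ 2) (not_three_dvd _ _ _ (by norm_num))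
        (not_three_dvd _ _ _ (by norm_num)) ?_ ?_ ?_
      · convert not_three_dvd (-1252) (-948) (-1031) (by norm_num) using 2
        push_cast; ring
      · convert not_three_dvd 1248 952 1029 (by norm_num) using 2
        push_cast; ring
      · convert h.mul (RL.rat (q := 1 / 64) (by norm_num)) using 1
        rw [io_th]
        simp only [io_poly]
        push_cast
        rw [div_mul_div_comm]
        congr 1
        · linear_combination ((1)) * hα
        · linear_combination ((-240) + (-15) * alK ^ 1) * hα
    · exact (nu_poly_eq (X := (23 : ℤ) + (13 : ℤ) * al + (21 : ℤ) * al ^ 2) (d := 16)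
        (not_three_dvd _ _ _ (by norm_num)) (by norm_num) (by rw [io_poly]; push_cast; ring)).le
    · exact nu_poly_eq (X := (385 : ℤ) + (195 : ℤ) * al + (15 : ℤ) * al ^ 2) (d := 64)
        (not_three_dvd _ _ _ (by norm_num)) (by norm_num) (by rw [io_poly]; push_cast; ring)
    · push_cast
      have h16 : nu (16 : K83) = 1 := by exact_mod_cast nu_nat 16 (by norm_num)
      rw [map_div₀, map_mul, h16, map_pow, hDn, one_pow, mul_one, div_one]
      have : nu ((10 * S + 3 * T : ℤ) : K83) < 1 := nu_int_lt.mpr (by omega)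
      push_cast at this
      exact this
    · rw [map_sub, map_add, map_mul, map_mul, map_mul, map_mul, map_mul]
      simp only [map_intCast, io_poly, io_th]
      push_cast
      field_simp
      rw [hD2K, quadCo]
      linear_combination (57 * (T : K83) ^ 2 - 228 * S ^ 2) * hα

lemma int_of_sq {r : ℚ} {n : ℤ} (h : r ^ 2 = n) : ∃ m : ℤ, r = m := by
  have h1 : IsIntegral ℤ r := ⟨X ^ 2 - C n, monic_X_pow_sub_C _ (by norm_num), by
    rw [eval₂_sub, eval₂_X_pow, eval₂_C, h, eq_intCast, sub_self]⟩
  obtain ⟨m, hm⟩ := IsIntegrallyClosed.isIntegral_iff.mp h1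
  exact ⟨m, by simpa using hm.symm⟩

/-- A rational point whose `x`-coordinate is not one of the known ones cannot exist. -/
lemma no_other_point {x y : ℚ} (h : y ^ 2 = x ^ 6 - 4 * x ^ 4 + 10 * x ^ 3 - 4 * x ^ 2 + 1)
    (h0 : x ≠ 0) (h1 : x ≠ 1) (h1' : x ≠ -1) (h3 : x ≠ -3) (h3' : x ≠ -1 / 3) : False := by
  obtain ⟨p, q, hpq, hq', rfl⟩ : ∃ p q : ℤ, IsCoprime p q ∧ q ≠ 0 ∧ x = p / q :=
    ⟨x.num, x.den, Int.isCoprime_iff_gcd_eq_one.mpr x.reduced, by exact_mod_cast x.den_ne_zero,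
      by exact_mod_cast (Rat.num_div_den x).symm⟩
  have hq : (q : ℚ) ≠ 0 := by exact_mod_cast hq'
  have hF' : (((p ^ 2 + q ^ 2) ^ 3 - 7 * (p ^ 2 + q ^ 2) * (p * q) ^ 2 + 10 * (p * q) ^ 3 : ℤ) : ℚ) =
      (q ^ 3 * y) ^ 2 := by
    rw [mul_pow _ y, h]
    push_cast
    field_simp
    ring
  obtain ⟨Y, hY⟩ := int_of_sq hF'.symm
  have hF : (p ^ 2 + q ^ 2) ^ 3 - 7 * (p ^ 2 + q ^ 2) * (p * q) ^ 2 + 10 * (p * q) ^ 3 = Y ^ 2 := by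
    rw [hY] at hF'
    exact_mod_cast hF'
  obtain ⟨k, r, hk, hr0, hr⟩ := linear_factor_class hpq hF
  have hp : p ≠ 0 := by rintro rfl; simp at h0
  have hne : ∀ a b : ℤ, b ≠ 0 → (p : ℚ) / q ≠ a / b → b * p - a * q ≠ 0 := by
    intro a b hb h1 h2
    apply h1
    have hb' : (b : ℚ) ≠ 0 := by exact_mod_cast hb
    rw [div_eq_div_iff hq hb']
    have : (b * p : ℚ) - a * q = 0 := by exact_mod_cast h2
    linear_combination this
  have e1 := hne 1 1 (by norm_num) (by simpa using h1)
  have e2 := hne (-1) 1 (by norm_num) (by simpa using h1')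
  have e3 := hne (-3) 1 (by norm_num) (by simpa using h3)
  have e4 := hne (-1) 3 (by norm_num) (by simpa using h3')
  have hD : p ^ 2 - q ^ 2 ≠ 0 := by
    rw [show p ^ 2 - q ^ 2 = (1 * p - 1 * q) * (1 * p - -1 * q) by ring]
    exact mul_ne_zero e1 e2
  have hD2 : (p ^ 2 - q ^ 2) ^ 2 = (p ^ 2 + q ^ 2) ^ 2 - 4 * (p * q) ^ 2 := by ring
  have hsq : ∀ a : ℤ, a ^ 2 % 3 = if 3 ∣ a then 0 else 1 := by
    intro a
    have : a % 3 = 0 ∨ a % 3 = 1 ∨ a % 3 = 2 := by omega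
    split_ifs with ha <;> rcases this with h | h | h <;> first | omega | simp [pow_two, Int.mul_emod, h]
  have hp2 := hsq p
  have hq2 := hsq q
  by_cases h3p : 3 ∣ p
  · have h3q : ¬ 3 ∣ q := fun h3q =>
      Int.prime_three.not_isUnit (hpq.isUnit_of_dvd' h3p h3q)
    rw [if_pos h3p] at hp2
    rw [if_neg h3q] at hq2
    refine not_case_div hk hD hr0 hD2 hF hr (by omega) (dvd_mul_of_dvd_left h3p _)
      (mul_ne_zero hp hq') ?_
    rw [show 10 * (p * q) + 3 * (p ^ 2 + q ^ 2) = (1 * p - -3 * q) * (3 * p - -1 * q) by ring]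
    exact mul_ne_zero e3 e4
  rw [if_neg h3p] at hp2
  by_cases h3q : 3 ∣ q
  · rw [if_pos h3q] at hq2
    refine not_case_div hk hD hr0 hD2 hF hr (by omega) (dvd_mul_of_dvd_right h3q _)
      (mul_ne_zero hp hq') ?_
    rw [show 10 * (p * q) + 3 * (p ^ 2 + q ^ 2) = (1 * p - -3 * q) * (3 * p - -1 * q) by ring]
    exact mul_ne_zero e3 e4
  · rw [if_neg h3q] at hq2
    exact not_case_unit hk hD hr0 hD2 hF hr (by omega)
      (fun h => (Int.prime_three.dvd_or_dvd h).elim h3p h3q) (by omega)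

end X166

/-- The affine rational points of the hyperelliptic model
`y² = x⁶ - 4x⁴ + 10x³ - 4x² + 1` of the modular curve `X₀(166)*`. -/
theorem X0_166_star_affine_rational_points (x y : ℚ) :
    y ^ 2 = x ^ 6 - 4 * x ^ 4 + 10 * x ^ 3 - 4 * x ^ 2 + 1 ↔
      (x, y) = (0, 1) ∨ (x, y) = (0, -1) ∨ (x, y) = (1, 2) ∨ (x, y) = (1, -2) ∨
      (x, y) = (-3, 10) ∨ (x, y) = (-3, -10) ∨
      (x, y) = (-1/3, 10/27) ∨ (x, y) = (-1/3, -10/27) := by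
  simp only [Prod.mk.injEq]
  constructor
  · intro h
    have sq : ∀ c : ℚ, y ^ 2 = c ^ 2 → y = c ∨ y = -c := fun c => sq_eq_sq_iff_eq_or_eq_neg.mp
    by_cases h0 : x = 0
    · subst h0
      rcases sq 1 (by rw [h]; norm_num) with h | h <;> simp [h]
    by_cases h1 : x = 1
    · subst h1
      rcases sq 2 (by rw [h]; norm_num) with h | h <;> simp [h]
    by_cases h2 : x = -1
    · subst h2
      nlinarith [sq_nonneg y]
    by_cases h3 : x = -3
    · subst h3
      rcases sq 10 (by rw [h]; norm_num) with h | h <;> simp [h]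
    by_cases h4 : x = -1 / 3
    · subst h4
      rcases sq (10 / 27) (by rw [h]; norm_num) with h | h <;> norm_num [h]
    exact (X166.no_other_point h h0 h1 h2 h3 h4).elim
  · rintro (⟨rfl, rfl⟩ | ⟨rfl, rfl⟩ | ⟨rfl, rfl⟩ | ⟨rfl, rfl⟩ | ⟨rfl, rfl⟩ | ⟨rfl, rfl⟩ | ⟨rfl, rfl⟩ | ⟨rfl, rfl⟩) <;>
      norm_num
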